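/- arXiv:1103.4456 — 2 statements merged into one kernel-verified Lean document; each statement's English description precedes it below -/
import Mathlib

section
/- Let A*_8 be the supremum of the areas of the convex hulls of sets of at most 8 points in ℝ² whose pairwise Euclidean distances are all at most 1 (the maximal area of a small octagon). Then 0.72686845 ≤ A*_8 ≤ 0.72686849. -/
open MeasureTheory

/-- `maxArea n` is the supremum of the areas (2-dimensional Lebesgue measures of convex
hulls) of sets of at most `n` points in the Euclidean plane whose pairwise Euclidean
distances are all at most `1`. -/
noncomputable def maxArea (n : ℕ) : ℝ :=
  sSup {a : ℝ | ∃ P : Finset (EuclideanSpace ℝ (Fin 2)),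
    P.card ≤ n ∧ (∀ p ∈ P, ∀ q ∈ P, dist p q ≤ 1) ∧
    a = (volume (convexHull ℝ (P : Set (EuclideanSpace ℝ (Fin 2))))).toReal}


namespace Oct

/-- Evaluation of an integer polynomial (low degree first) at a real point. -/
def ev : List ℤ → ℝ → ℝ
  | [], _ => 0
  | c :: l, x => (c : ℝ) + x * ev l x

/-- Coefficients of `c + (x+h) * s(x)`. -/
def pstep (h : ℤ) : ℤ → List ℤ → List ℤ
  | c, [] => [c]
  | c, s :: r => (c + h * s) :: pstep h s r

/-- Taylor shift by `h`. -/
def pshift (h : ℤ) : List ℤ → List ℤ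
  | [] => []
  | c :: l => pstep h c (pshift h l)

/-- Lower bound for the polynomial on `[0,H]`. -/
def plb (H : ℤ) : List ℤ → ℤ
  | [] => 0
  | c :: l => c + H * min 0 (plb H l)

def ppos : ℕ → List ℤ → ℤ → Bool
  | 0, l, H => decide (0 ≤ plb H l)
  | n+1, l, H => decide (0 ≤ plb H l) ||
      (ppos n l (H/2) && ppos n (pshift (H/2) l) (H - H/2))

theorem ev_pstep (h : ℤ) (x : ℝ) : ∀ (s : List ℤ) (c : ℤ),
    ev (pstep h c s) x = c + (x + h) * ev s x
  | [], c => by simp [pstep, ev]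
  | s :: r, c => by
    simp only [pstep, ev, ev_pstep h x r s]; push_cast; ring

theorem ev_pshift (h : ℤ) (x : ℝ) : ∀ l, ev (pshift h l) x = ev l (x + h)
  | [] => rfl
  | c :: l => by simp only [pshift, ev_pstep, ev, ev_pshift h x l]

theorem plb_le (H : ℤ) (x : ℝ) (h0 : 0 ≤ x) (h1 : x ≤ H) : ∀ l, (plb H l : ℝ) ≤ ev l x
  | [] => by simp [plb, ev]
  | c :: l => by
    have ih := plb_le H x h0 h1 l
    simp only [plb, ev]; push_cast
    have h2 : min 0 (plb H l : ℝ) ≤ 0 := min_le_left _ _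
    have h3 : min 0 (plb H l : ℝ) ≤ ev l x := (min_le_right _ _).trans ih
    nlinarith [mul_le_mul_of_nonneg_left h3 h0, mul_nonneg (sub_nonneg.2 h1) (neg_nonneg.2 h2)]

theorem ppos_sound : ∀ (n : ℕ) (l : List ℤ) (H : ℤ), ppos n l H = true →
    ∀ x : ℝ, 0 ≤ x → x ≤ H → 0 ≤ ev l x
  | 0, l, H, h, x, h0, h1 => by
    simp only [ppos, decide_eq_true_eq] at h
    exact le_trans (by exact_mod_cast h) (plb_le H x h0 h1 l)
  | n+1, l, H, h, x, h0, h1 => by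
    simp only [ppos, Bool.or_eq_true, decide_eq_true_eq, Bool.and_eq_true] at h
    rcases h with h | ⟨h2, h3⟩
    · exact le_trans (by exact_mod_cast h) (plb_le H x h0 h1 l)
    · rcases le_total x ((H/2 : ℤ) : ℝ) with hx | hx
      · exact ppos_sound n l _ h2 x h0 hx
      · have := ppos_sound n _ _ h3 (x - (H/2 : ℤ)) (by linarith) (by push_cast; linarith)
        rwa [ev_pshift, sub_add_cancel] at this

/-- Scaled edge polynomial; parameters: `dl dr` (node defects, unit 1e-6), `a b wl wr mu lam`
(unit 1e-6), `n0 n2` (unit 1e-6), `v` (unit 1e-12). Variable is `t = 10^6 T`. -/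
def ecoef (dl dr a b wl wr mu lam n0 n2 v : ℤ) : List ℤ :=
  let al : ℤ := 1000000 * (v - wl * dl + wr * dr) - mu * 392699081699
  let ga : ℤ := 12466 * 100 * lam * (dl + dr)
  let De : ℤ := (dl - dr)^2
  let X : ℤ := 1000000 * ((1000000 - dl) * (1000000 - dr))
  let U : ℤ := 1000000 * ((b - a) * (dr - dl) + (a - b)^2)
  let W : ℤ := 1000000 * ((a + b) * (2000000 - dl - dr) - (a + b)^2)
  let m : ℤ := mu * 1000000000000
  let B0 := -n0 * De - 4 * U
  let B1 := 8 * al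
  let B2 := -8 * ga - n2 * De - 4 * W + 16 * m
  [3465 * B0 * 10^84, 3465 * B1 * 10^78, 3465 * (B2 + B0 - 4 * X) * 10^72, 3465 * B1 * 10^66,
   (-18480 * m + 3465 * (B2 + 4 * X)) * 10^60, 0, (11088 - 18480) * m * 10^48, 0,
   (11088 - 7920) * m * 10^36, 0, (6160 - 7920) * m * 10^24, 0, (6160 - 5040) * m * 10^12, 0,
   -5040 * m]

def corner (f : ℕ) (lo hi dl dr a b wl wr mu lam n0 n2 v : ℤ) : Bool :=
  ppos f (pshift lo (ecoef dl dr a b wl wr mu lam n0 n2 v)) (hi - lo)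

end Oct


namespace Oct

/-- The edge function in terms of `T = tan (φ/2)`. -/
noncomputable def EE (T x y a b : ℝ) : ℝ :=
  T * (1 - T^2) / (2 * (1 + T^2)) * ((1 - x) * (1 - y)) + (1 - T^2) / (8 * T) * (x - y)^2
  + ((b - a) * (y - x) + (a + b) * (2 - x - y) * T^2) / (2 * T)
  + ((a - b)^2 - (a + b)^2 * T^2) / (2 * T)

/-- The chord term. -/
noncomputable def CH (T x y : ℝ) : ℝ :=
  1.2466 * T * (x + y) - (1 + T^2) / (2 * T) * (x - y)^2

noncomputable def LL (T : ℝ) : ℝ := T - T^3/3 + T^5/5 - T^7/7 + T^9/9 - T^11/11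

theorem LL_le_arctan {T : ℝ} (hT : 0 ≤ T) : LL T ≤ Real.arctan T := by
  have hmono : MonotoneOn (fun x => Real.arctan x - LL x) (Set.Ici 0) := by
    apply monotoneOn_of_deriv_nonneg (convex_Ici 0)
    · apply Continuous.continuousOn
      unfold LL
      have := Real.continuous_arctan
      fun_prop
    · intro x hx
      unfold LL
      exact ((Real.differentiableAt_arctan x).sub (by fun_prop)).differentiableWithinAt
    · intro x hx
      have h : HasDerivAt (fun x => Real.arctan x - LL x)
          (1 / (1 + x^2) - (1 - x^2 + x^4 - x^6 + x^8 - x^10)) x := by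
        apply (Real.hasDerivAt_arctan x).sub
        unfold LL
        have h1 := hasDerivAt_id x
        have := (((((h1.sub ((h1.pow 3).div_const 3)).add ((h1.pow 5).div_const 5)).sub
          ((h1.pow 7).div_const 7)).add ((h1.pow 9).div_const 9)).sub ((h1.pow 11).div_const 11))
        refine this.congr_deriv ?_
        simp
      rw [h.deriv]
      have : 1 / (1 + x^2) - (1 - x^2 + x^4 - x^6 + x^8 - x^10) = x^12 / (1 + x^2) := by
        field_simp; ring
      rw [this]; positivity
  have := hmono (Set.mem_Ici.2 le_rfl) (Set.mem_Ici.2 hT) hT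
  simp [LL] at this
  simp only [LL]; linarith

theorem concave1 {p q k x0 x1 x : ℝ} (hk : 0 ≤ k) (h0 : x0 ≤ x) (h1 : x ≤ x1)
    (g0 : 0 ≤ p + q * x0 - k * x0^2) (g1 : 0 ≤ p + q * x1 - k * x1^2) :
    0 ≤ p + q * x - k * x^2 := by
  rcases eq_or_lt_of_le h0 with h | h
  · rwa [← h]
  · have hx : 0 < x1 - x0 := by linarith
    have : 0 ≤ (x1 - x0) * (p + q * x - k * x^2) := by
      have e : (x1 - x0) * (p + q * x - k * x^2) = (x1 - x) * (p + q * x0 - k * x0^2)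
        + (x - x0) * (p + q * x1 - k * x1^2) + k * ((x - x0) * (x1 - x) * (x1 - x0)) := by ring
      rw [e]
      have a1 := sub_nonneg.2 h0
      have a2 := sub_nonneg.2 h1
      positivity
    exact nonneg_of_mul_nonneg_right this hx

theorem concave2 {p q r s k x0 x1 x y0 y1 y : ℝ} (hk : 0 ≤ k) (hx0 : x0 ≤ x) (hx1 : x ≤ x1)
    (hy0 : y0 ≤ y) (hy1 : y ≤ y1) (f : ℝ → ℝ → ℝ)
    (hf : ∀ x y, f x y = p + q * x + r * y + s * x * y - k * (x - y)^2)
    (h00 : 0 ≤ f x0 y0) (h01 : 0 ≤ f x0 y1) (h10 : 0 ≤ f x1 y0) (h11 : 0 ≤ f x1 y1) :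
    0 ≤ f x y := by
  have key : ∀ z, 0 ≤ f x0 z → 0 ≤ f x1 z → 0 ≤ f x z := by
    intro z a b
    rw [hf] at a b ⊢
    have := concave1 (p := p + r * z - k * z^2) (q := q + s * z + 2 * k * z) hk hx0 hx1
      (by linarith) (by linarith)
    linarith
  have a := key y0 h00 h10
  have b := key y1 h01 h11
  rw [hf] at a b ⊢
  have := concave1 (p := p + q * x - k * x^2) (q := r + s * x + 2 * k * x) hk hy0 hy1
      (by linarith) (by linarith)
  linarith

/-- Real form of the edge polynomial. -/
noncomputable def RP (T x y a b wl wr mu lam n0 n2 v : ℝ) : ℝ :=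
  (1 + T^2) * (8 * (v - wl * x + wr * y - mu * 0.392699081699) * T
    - 8 * (1.2466 * lam * (x + y)) * T^2
    - (n0 + n2 * T^2) * (x - y)^2 - 4 * ((b - a) * (y - x) + (a - b)^2)
    - 4 * ((a + b) * (2 - x - y) - (a + b)^2) * T^2 + 16 * mu * T * LL T)
  - 4 * ((1 - x) * (1 - y)) * (T^2 - T^4)

theorem ev_ecoef (dl dr a b wl wr mu lam n0 n2 v : ℤ) (T : ℝ) :
    ev (ecoef dl dr a b wl wr mu lam n0 n2 v) (10^6 * T) =
     3465 * 10^102 * RP T (dl/10^6) (dr/10^6) (a/10^6) (b/10^6) (wl/10^6) (wr/10^6) (mu/10^6)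
      (lam/10^6) (n0/10^6) (n2/10^6) (v/10^12) := by
  simp only [ecoef, ev, RP, LL]
  push_cast
  ring

theorem edge_real {T x y a b wl wr mu lam n0 n2 v : ℝ} (hT : 0 < T) (hmu : 0 ≤ mu)
    (hn : (1 - T^2) - 4 * lam * (1 + T^2) ≤ n0 + n2 * T^2)
    (h : 0 ≤ RP T x y a b wl wr mu lam n0 n2 v) :
    EE T x y a b + lam * CH T x y + wl * x - wr * y ≤ v + mu * (2 * Real.arctan T - Real.pi / 8) := by
  have hL := LL_le_arctan hT.le
  have hpi : Real.pi / 8 ≤ 0.392699081699 := by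
    have := Real.pi_lt_d20; linarith
  have h1 : v + mu * (2 * LL T - 0.392699081699) ≤ v + mu * (2 * Real.arctan T - Real.pi / 8) := by
    gcongr
  refine le_trans ?_ h1
  have h2 : 0 ≤ RP T x y a b wl wr mu lam (1 - 4 * lam) (-(1 + 4 * lam)) v := by
    refine h.trans ?_
    unfold RP
    have : 0 ≤ (1 + T^2) * ((n0 + n2 * T^2) - ((1 - T^2) - 4 * lam * (1 + T^2))) * (x - y)^2 := by
      have := sub_nonneg.2 hn
      positivity
    nlinarith [this]
  have h3 : v + mu * (2 * LL T - 0.392699081699) - (EE T x y a b + lam * CH T x y + wl * x - wr * y)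
      = RP T x y a b wl wr mu lam (1 - 4 * lam) (-(1 + 4 * lam)) v / (8 * T * (1 + T^2)) := by
    unfold RP EE CH
    field_simp
    ring
  have : 0 ≤ RP T x y a b wl wr mu lam (1 - 4 * lam) (-(1 + 4 * lam)) v / (8 * T * (1 + T^2)) := by
    positivity
  linarith

theorem RP_corners {T x y a b wl wr mu lam n0 n2 v x0 x1 y0 y1: ℝ} (hn : 0 ≤ n0 + n2 * T^2)
    (hx0 : x0 ≤ x) (hx1 : x ≤ x1) (hy0 : y0 ≤ y) (hy1 : y ≤ y1)
    (h00 : 0 ≤ RP T x0 y0 a b wl wr mu lam n0 n2 v)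
    (h01 : 0 ≤ RP T x0 y1 a b wl wr mu lam n0 n2 v)
    (h10 : 0 ≤ RP T x1 y0 a b wl wr mu lam n0 n2 v)
    (h11 : 0 ≤ RP T x1 y1 a b wl wr mu lam n0 n2 v) :
    0 ≤ RP T x y a b wl wr mu lam n0 n2 v := by
  refine concave2 (k := (1 + T^2) * (n0 + n2 * T^2))
    (p := (1 + T^2) * (8 * (v - mu * 0.392699081699) * T - 4 * (a - b)^2
        - 4 * ((a + b) * 2 - (a + b)^2) * T^2 + 16 * mu * T * LL T) - 4 * (T^2 - T^4))
    (q := (1 + T^2) * (-8 * wl * T - 8 * 1.2466 * lam * T^2 + 4 * (b - a) + 4 * (a + b) * T^2)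
      + 4 * (T^2 - T^4))
    (r := (1 + T^2) * (8 * wr * T - 8 * 1.2466 * lam * T^2 - 4 * (b - a) + 4 * (a + b) * T^2)
      + 4 * (T^2 - T^4))
    (s := - 4 * (T^2 - T^4))
    (by positivity) hx0 hx1 hy0 hy1 (fun x y => RP T x y a b wl wr mu lam n0 n2 v) ?_ h00 h01 h10 h11
  intro x y
  unfold RP
  ring

def corners (f : ℕ) (lo hi dl0 dl1 dr0 dr1 a b wl wr mu lam n0 n2 v : ℤ) : Bool :=
  corner f lo hi dl0 dr0 a b wl wr mu lam n0 n2 v &&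
  (corner f lo hi dl0 dr1 a b wl wr mu lam n0 n2 v &&
  (corner f lo hi dl1 dr0 a b wl wr mu lam n0 n2 v &&
  corner f lo hi dl1 dr1 a b wl wr mu lam n0 n2 v))

def quadl (hi lam : ℤ) : ℤ :=
  min (4 * lam) (10^6 * (10^12 - hi^2) / (10^12 + hi^2))

def edgeOK (f : ℕ) (lo hi dl0 dl1 dr0 dr1 a b wl wr mu lam v : ℤ) : Bool :=
  decide (0 ≤ lo) && (decide (0 ≤ mu) &&
  (if 10^6 * (10^12 - lo^2) ≤ 4 * lam * (10^12 + lo^2) then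
    decide (0 ≤ lam) && corners f lo hi dl0 dl1 dr0 dr1 a b wl wr mu lam 0 0 v
  else corners f lo hi dl0 dl1 dr0 dr1 a b wl wr mu lam (10^6 - quadl hi lam)
    (-(10^6 + quadl hi lam)) v))

theorem corner_sound {f : ℕ} {lo hi dl dr a b wl wr mu lam n0 n2 v : ℤ}
    (h : corner f lo hi dl dr a b wl wr mu lam n0 n2 v = true) {T : ℝ}
    (h0 : (lo : ℝ) ≤ 10^6 * T) (h1 : 10^6 * T ≤ hi) :
    0 ≤ RP T (dl/10^6) (dr/10^6) (a/10^6) (b/10^6) (wl/10^6) (wr/10^6) (mu/10^6)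
      (lam/10^6) (n0/10^6) (n2/10^6) (v/10^12) := by
  have := ppos_sound _ _ _ h (10^6 * T - lo) (by linarith) (by push_cast; linarith)
  rw [ev_pshift, sub_add_cancel, ev_ecoef] at this
  exact nonneg_of_mul_nonneg_right this (by positivity)

theorem edge_sound {f : ℕ} {lo hi dl0 dl1 dr0 dr1 a b wl wr mu lam v : ℤ}
    (h : edgeOK f lo hi dl0 dl1 dr0 dr1 a b wl wr mu lam v = true) {T x y : ℝ} (hT : 0 < T)
    (h0 : (lo : ℝ) ≤ 10^6 * T) (h1 : 10^6 * T ≤ hi)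
    (hx0 : (dl0 : ℝ) / 10^6 ≤ x) (hx1 : x ≤ dl1 / 10^6)
    (hy0 : (dr0 : ℝ) / 10^6 ≤ y) (hy1 : y ≤ dr1 / 10^6) :
    EE T x y (a/10^6) (b/10^6) + (lam / 10^6) * CH T x y + (wl/10^6) * x - (wr/10^6) * y
      ≤ v / 10^12 + (mu/10^6) * (2 * Real.arctan T - Real.pi / 8) := by
  simp only [edgeOK, Bool.and_eq_true, decide_eq_true_eq] at h
  obtain ⟨hlo, hmu, h⟩ := h
  have hlo' : (0:ℝ) ≤ lo := by exact_mod_cast hlo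
  have hmu' : (0:ℝ) ≤ (mu : ℝ) / 10^6 := div_nonneg (by exact_mod_cast hmu) (by norm_num)
  split_ifs at h with hc
  · simp only [corners, Bool.and_eq_true, decide_eq_true_eq] at h
    obtain ⟨hl, h00, h01, h10, h11⟩ := h
    have hl' : (0:ℝ) ≤ (lam : ℝ) := by exact_mod_cast hl
    have hc' : (10^6 * (10^12 - lo^2) : ℝ) ≤ 4 * lam * (10^12 + lo^2) := by exact_mod_cast hc
    have hsq : (lo : ℝ)^2 ≤ (10^6 * T)^2 := by gcongr
    apply edge_real hT hmu' (n0 := ((0:ℤ):ℝ)/10^6) (n2 := ((0:ℤ):ℝ)/10^6)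
    · push_cast
      nlinarith [mul_le_mul_of_nonneg_left hsq hl']
    · exact RP_corners (by simp) hx0 hx1 hy0 hy1 (corner_sound h00 h0 h1) (corner_sound h01 h0 h1)
        (corner_sound h10 h0 h1) (corner_sound h11 h0 h1)
  · simp only [corners, Bool.and_eq_true] at h
    obtain ⟨h00, h01, h10, h11⟩ := h
    have hl1 : quadl hi lam ≤ 4 * lam := min_le_left _ _
    have hl2 : quadl hi lam * (10^12 + hi^2) ≤ 10^6 * (10^12 - hi^2) := by
      have : quadl hi lam ≤ 10^6 * (10^12 - hi^2) / (10^12 + hi^2) := min_le_right _ _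
      exact (mul_le_mul_of_nonneg_right this (by positivity)).trans
        (Int.ediv_mul_le _ (by positivity))
    set q := quadl hi lam
    have hl1' : (q : ℝ) ≤ 4 * lam := by exact_mod_cast hl1
    have hl2' : (q : ℝ) * (10^12 + hi^2) ≤ 10^6 * (10^12 - hi^2) := by exact_mod_cast hl2
    have hsq : (10^6 * T)^2 ≤ (hi : ℝ)^2 := by gcongr
    apply edge_real hT hmu' (n0 := ((10^6 - q:ℤ):ℝ)/10^6) (n2 := ((-(10^6+q):ℤ):ℝ)/10^6)
    · push_cast
      nlinarith [mul_le_mul_of_nonneg_right hl1' (sq_nonneg T)]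
    · refine RP_corners ?_ hx0 hx1 hy0 hy1 (corner_sound h00 h0 h1) (corner_sound h01 h0 h1)
        (corner_sound h10 h0 h1) (corner_sound h11 h0 h1)
      push_cast
      have hq : (q : ℝ) ≤ 10^6 := by
        by_contra hq
        push Not at hq
        nlinarith [sq_nonneg (hi : ℝ)]
      rcases le_total 0 ((10:ℝ)^6 + q) with hh | hh
      · nlinarith [mul_le_mul_of_nonneg_left hsq hh]
      · nlinarith [mul_nonneg (neg_nonneg.2 hh) (sq_nonneg T)]

end Oct


namespace Oct

structure Sys (A : ℝ) (T x : Fin 8 → ℝ) (eps : Fin 8 → ℤ) : Prop where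
  pos : ∀ k, 0 < T k
  sum : ∑ k, 2 * Real.arctan (T k) = Real.pi
  bound : ∀ be : Fin 8 → ℝ, A ≤ ∑ k, EE (T k) (x k) (x (k+1)) (eps k * be k) (be (k+1))
  chord : 0 ≤ ∑ k, CH (T k) (x k) (x (k+1))

theorem total0 {A : ℝ} {T x : Fin 8 → ℝ} {eps : Fin 8 → ℤ}
    (hsum : ∑ k, 2 * Real.arctan (T k) = Real.pi) (hch : 0 ≤ ∑ k, CH (T k) (x k) (x (k+1)))
    (be w : Fin 8 → ℝ)
    (h3 : A ≤ ∑ k, EE (T k) (x k) (x (k+1)) (eps k * be k) (be (k+1))) (mu lam : ℝ) (hl : 0 ≤ lam) (V : Fin 8 → ℝ)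
    (h : ∀ k, EE (T k) (x k) (x (k+1)) (eps k * be k) (be (k+1)) + lam * CH (T k) (x k) (x (k+1))
      + w k * x k - w (k+1) * x (k+1) ≤ V k + mu * (2 * Real.arctan (T k) - Real.pi / 8)) :
    A ≤ ∑ k, V k := by
  have h1 := Finset.sum_le_sum (fun k (_ : k ∈ Finset.univ) => h k)
  have h2 : ∑ k : Fin 8, w (k+1) * x (k+1) = ∑ k, w k * x k :=
    Equiv.sum_comp (Equiv.addRight (1 : Fin 8)) (fun k => w k * x k)
  have h4 := mul_nonneg hl hch
  have h5 := hsum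
  simp only [Finset.sum_add_distrib, Finset.sum_sub_distrib, ← Finset.mul_sum] at h1 h5
  rw [h5, h2] at h1
  simp at h1
  linarith

theorem Sys.total {A : ℝ} {T x : Fin 8 → ℝ} {eps : Fin 8 → ℤ} (S : Sys A T x eps)
    (be w : Fin 8 → ℝ) (mu lam : ℝ) (hl : 0 ≤ lam) (V : Fin 8 → ℝ)
    (h : ∀ k, EE (T k) (x k) (x (k+1)) (eps k * be k) (be (k+1)) + lam * CH (T k) (x k) (x (k+1))
      + w k * x k - w (k+1) * x (k+1) ≤ V k + mu * (2 * Real.arctan (T k) - Real.pi / 8)) :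
    A ≤ ∑ k, V k :=
  total0 S.sum S.chord be w (S.bound be) mu lam hl V h

structure Cert where
  be : List ℤ
  w : List ℤ
  mu : ℤ
  lam : ℤ
  v : List ℤ

inductive Tree where
  | leaf (c : Cert)
  | shrink (c : Cert) (nlo nhi : List ℤ) (t : Tree)
  | splitT (i : Fin 8) (m : ℤ) (t1 t2 : Tree)
  | splitD (i : Fin 8) (m : ℤ) (t1 t2 : Tree)

def gt (l : List ℤ) (k : Fin 8) : ℤ := l.getD k.val 0

def all8 (f : Fin 8 → Bool) : Bool :=
  f 0 && (f 1 && (f 2 && (f 3 && (f 4 && (f 5 && (f 6 && f 7))))))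

theorem all8_iff {f : Fin 8 → Bool} (h : all8 f = true) (k : Fin 8) : f k = true := by
  simp only [all8, Bool.and_eq_true] at h
  obtain ⟨h0, h1, h2, h3, h4, h5, h6, h7⟩ := h
  fin_cases k <;> assumption

def sum8 (f : Fin 8 → ℤ) : ℤ := f 0 + f 1 + f 2 + f 3 + f 4 + f 5 + f 6 + f 7

def upd (f : Fin 8 → ℤ) (i : Fin 8) (m : ℤ) : Fin 8 → ℤ := fun k => if k = i then m else f k

def edgeC (eps : Fin 8 → ℤ) (c : Cert) (dl dh : Fin 8 → ℤ) (k : Fin 8) (lo hi v : ℤ) : Bool :=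
  edgeOK 16 lo hi (dl k) (dh k) (dl (k+1)) (dh (k+1)) (eps k * gt c.be k) (gt c.be (k+1))
    (gt c.w k) (gt c.w (k+1)) c.mu c.lam v

def shrinkOK (eps : Fin 8 → ℤ) (tgt : ℤ) (c : Cert) (nlo nhi : List ℤ)
    (tl th dl dh : Fin 8 → ℤ) : Bool :=
  decide (0 ≤ c.lam) && ((all8 fun k => edgeC eps c dl dh k (tl k) (th k) (gt c.v k)) &&
  ((all8 fun k => decide (gt nlo k ≤ tl k) || edgeC eps c dl dh k (tl k) (gt nlo k)
      (gt c.v k - (sum8 (gt c.v) - tgt))) &&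
  (all8 fun k => decide (th k ≤ gt nhi k) || edgeC eps c dl dh k (gt nhi k) (th k)
      (gt c.v k - (sum8 (gt c.v) - tgt)))))

def Tree.check (eps : Fin 8 → ℤ) (tgt : ℤ) :
    Tree → (Fin 8 → ℤ) → (Fin 8 → ℤ) → (Fin 8 → ℤ) → (Fin 8 → ℤ) → Bool
  | .leaf c, tl, th, dl, dh => decide (0 ≤ c.lam) && (decide (sum8 (gt c.v) ≤ tgt) &&
      all8 fun k => edgeC eps c dl dh k (tl k) (th k) (gt c.v k))
  | .shrink c nlo nhi t, tl, th, dl, dh =>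
      shrinkOK eps tgt c nlo nhi tl th dl dh && t.check eps tgt (gt nlo) (gt nhi) dl dh
  | .splitT i m t1 t2, tl, th, dl, dh =>
      t1.check eps tgt tl (upd th i m) dl dh && t2.check eps tgt (upd tl i m) th dl dh
  | .splitD i m t1 t2, tl, th, dl, dh =>
      t1.check eps tgt tl th dl (upd dh i m) && t2.check eps tgt tl th (upd dl i m) dh

def InB (y : Fin 8 → ℝ) (l h : Fin 8 → ℤ) : Prop := ∀ k, (l k : ℝ) ≤ 10^6 * y k ∧ 10^6 * y k ≤ h k

theorem InB.updR {y : Fin 8 → ℝ} {l h : Fin 8 → ℤ} (H : InB y l h) {i : Fin 8} {m : ℤ}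
    (hm : 10^6 * y i ≤ m) : InB y l (upd h i m) := by
  intro k
  refine ⟨(H k).1, ?_⟩
  unfold upd
  split_ifs with hk
  · rw [hk]; exact hm
  · exact (H k).2

theorem InB.updL {y : Fin 8 → ℝ} {l h : Fin 8 → ℤ} (H : InB y l h) {i : Fin 8} {m : ℤ}
    (hm : (m : ℝ) ≤ 10^6 * y i) : InB y (upd l i m) h := by
  intro k
  refine ⟨?_, (H k).2⟩
  unfold upd
  split_ifs with hk
  · rw [hk]; exact hm
  · exact (H k).1

theorem edgeC_sound {eps : Fin 8 → ℤ} {c : Cert} {dl dh : Fin 8 → ℤ} {k : Fin 8} {lo hi v : ℤ}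
    (h : edgeC eps c dl dh k lo hi v = true) {T x : Fin 8 → ℝ} (hT : 0 < T k)
    (h0 : (lo : ℝ) ≤ 10^6 * T k) (h1 : 10^6 * T k ≤ hi) (hx : InB x dl dh) :
    EE (T k) (x k) (x (k+1)) (eps k * ((gt c.be k : ℝ)/10^6)) ((gt c.be (k+1) : ℝ)/10^6)
      + ((c.lam : ℝ) / 10^6) * CH (T k) (x k) (x (k+1)) + ((gt c.w k : ℝ)/10^6) * x k
      - ((gt c.w (k+1) : ℝ)/10^6) * x (k+1)
      ≤ v / 10^12 + ((c.mu : ℝ)/10^6) * (2 * Real.arctan (T k) - Real.pi / 8) := by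
  have p : (0:ℝ) < 10^6 := by norm_num
  have := edge_sound h hT h0 h1 (x := x k) (y := x (k+1)) (by rw [div_le_iff₀ p]; linarith [hx k])
    (by rw [le_div_iff₀ p]; linarith [hx k]) (by rw [div_le_iff₀ p]; linarith [hx (k+1)])
    (by rw [le_div_iff₀ p]; linarith [hx (k+1)])
  push_cast at this
  rwa [mul_div_assoc] at this

theorem sum8_cast (f : Fin 8 → ℤ) : ∑ k, ((f k : ℝ) / 10^12) = (sum8 f : ℝ) / 10^12 := by
  simp only [Fin.sum_univ_eight, sum8]; push_cast; ring

theorem shrink_sound {A : ℝ} {T x : Fin 8 → ℝ} {eps : Fin 8 → ℤ} {tgt : ℤ}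
    (hpos : ∀ k, 0 < T k) (hsum : ∑ k, 2 * Real.arctan (T k) = Real.pi)
    (hch : 0 ≤ ∑ k, CH (T k) (x k) (x (k+1))) {c : Cert}
    (hb : A ≤ ∑ k, EE (T k) (x k) (x (k+1)) (eps k * ((gt c.be k : ℝ)/10^6))
      ((gt c.be (k+1) : ℝ)/10^6)) {nlo nhi : List ℤ} {tl th dl dh : Fin 8 → ℤ}
    (h : shrinkOK eps tgt c nlo nhi tl th dl dh = true)
    (hT : InB T tl th) (hx : InB x dl dh) : A ≤ tgt / 10^12 ∨ InB T (gt nlo) (gt nhi) := by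
  simp only [shrinkOK, Bool.and_eq_true, decide_eq_true_eq] at h
  obtain ⟨hl, h, hlo, hhi⟩ := h
  by_cases hin : InB T (gt nlo) (gt nhi)
  · exact Or.inr hin
  · simp only [InB, not_forall] at hin
    obtain ⟨j, hj⟩ := hin
    have hj' : EE (T j) (x j) (x (j+1)) (eps j * ((gt c.be j : ℝ)/10^6)) ((gt c.be (j+1) : ℝ)/10^6)
      + ((c.lam : ℝ) / 10^6) * CH (T j) (x j) (x (j+1)) + ((gt c.w j : ℝ)/10^6) * x j
      - ((gt c.w (j+1) : ℝ)/10^6) * x (j+1)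
      ≤ ((gt c.v j - (sum8 (gt c.v) - tgt) : ℤ) : ℝ) / 10^12
        + ((c.mu : ℝ)/10^6) * (2 * Real.arctan (T j) - Real.pi / 8) := by
      by_cases h1 : (gt nlo j : ℝ) ≤ 10^6 * T j
      · have h2 : ¬ (10^6 * T j ≤ gt nhi j) := fun h2 => hj ⟨h1, h2⟩
        push Not at h2
        have := all8_iff hhi j
        simp only [Bool.or_eq_true, decide_eq_true_eq] at this
        rcases this with h3 | h3
        · have : (th j : ℝ) ≤ gt nhi j := by exact_mod_cast h3
          linarith [(hT j).2]
        · exact edgeC_sound h3 (hpos j) h2.le (hT j).2 hx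
      · push Not at h1
        have := all8_iff hlo j
        simp only [Bool.or_eq_true, decide_eq_true_eq] at this
        rcases this with h3 | h3
        · have : (gt nlo j : ℝ) ≤ tl j := by exact_mod_cast h3
          linarith [(hT j).1]
        · exact edgeC_sound h3 (hpos j) (hT j).1 h1.le hx
    have := total0 hsum hch (fun k => (gt c.be k : ℝ)/10^6) (fun k => (gt c.w k : ℝ)/10^6) hb (c.mu/10^6)
      (c.lam/10^6) (div_nonneg (by exact_mod_cast hl) (by norm_num))
      (fun k => (gt c.v k : ℝ)/10^12 - if k = j then ((sum8 (gt c.v) - tgt : ℤ) : ℝ)/10^12 else 0)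
      (fun k => by
        split_ifs with hk
        · rw [hk]; push_cast at hj' ⊢; rw [sub_div] at hj'; exact hj'
        · rw [sub_zero]
          exact edgeC_sound (all8_iff h k) (hpos k) (hT k).1 (hT k).2 hx)
    rw [Finset.sum_sub_distrib, sum8_cast, Finset.sum_ite_eq'] at this
    simp only [Finset.mem_univ, if_true] at this
    refine Or.inl (this.trans (le_of_eq ?_))
    push_cast; ring

theorem Tree.sound {A : ℝ} {T x : Fin 8 → ℝ} {eps : Fin 8 → ℤ} {tgt : ℤ} (S : Sys A T x eps) :
    ∀ (t : Tree) (tl th dl dh : Fin 8 → ℤ), t.check eps tgt tl th dl dh = true →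
      InB T tl th → InB x dl dh → A ≤ tgt / 10^12
  | .leaf c, tl, th, dl, dh, h, hT, hx => by
    simp only [Tree.check, Bool.and_eq_true, decide_eq_true_eq] at h
    obtain ⟨hl, hs, h⟩ := h
    have := S.total (fun k => (gt c.be k : ℝ)/10^6) (fun k => (gt c.w k : ℝ)/10^6) (c.mu/10^6)
      (c.lam/10^6) (div_nonneg (by exact_mod_cast hl) (by norm_num)) (fun k => (gt c.v k : ℝ)/10^12)
      (fun k => edgeC_sound (all8_iff h k) (S.pos k) (hT k).1 (hT k).2 hx)
    rw [sum8_cast] at this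
    refine this.trans ?_
    gcongr
  | .shrink c nlo nhi t, tl, th, dl, dh, h, hT, hx => by
    simp only [Tree.check, Bool.and_eq_true] at h
    rcases shrink_sound S.pos S.sum S.chord (S.bound _) h.1 hT hx with h1 | h1
    · exact h1
    · exact Tree.sound S t _ _ _ _ h.2 h1 hx
  | .splitT i m t1 t2, tl, th, dl, dh, h, hT, hx => by
    simp only [Tree.check, Bool.and_eq_true] at h
    rcases le_total (10^6 * T i) (m : ℝ) with hm | hm
    · exact Tree.sound S t1 _ _ _ _ h.1 (hT.updR hm) hx
    · exact Tree.sound S t2 _ _ _ _ h.2 (hT.updL hm) hx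
  | .splitD i m t1 t2, tl, th, dl, dh, h, hT, hx => by
    simp only [Tree.check, Bool.and_eq_true] at h
    rcases le_total (10^6 * x i) (m : ℝ) with hm | hm
    · exact Tree.sound S t1 _ _ _ _ h.1 hT (hx.updR hm)
    · exact Tree.sound S t2 _ _ _ _ h.2 hT (hx.updL hm)

end Oct


namespace Oct

def cert1 : Cert :=
  ⟨[0,0,0,0,0,0,0,0],[0,0,0,0,0,0,0,0],192000,250000,[92086709748,92086709748,92086709748,92086709748,92086709748,92086709748,92086709748,92086709748]⟩
def cert2 : Cert :=
  ⟨[0,0,0,0,0,0,0,0],[0,0,0,0,0,0,0,0],209000,250000,[91987563908,91987563908,91987563908,91987563908,91987563908,91987563908,91987563908,91987563908]⟩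

def treeData : Tree :=
 (.shrink ⟨[-29110,-23060,12630,-5350,660,4160,-11320,23600],
 [610,15450,18800,9920,-3190,3180,-17230,-11200],194641,248210,[82266939984,100346111627,88421930569,93348140247,92804065561,88913746783,100246815200,82161077628]⟩ [59980,167700,129329,159860,156599,98391,163124,59980] 
 [214531,303512,252780,277295,274556,255489,302818,213865]
 (.splitT 0 100335
 (.shrink ⟨[-24600,-18290,10580,-4370,870,2130,-6880,16910],
 [-14060,20100,-33740,15470,-5180,7800,6940,-13780],192822,248210,[82128481439,98782725539,88989300364,93235703036,92351292755,90180839829,97665859980,83978759240]⟩ [59980,201593,169167,192189,188201,176280,191793,59980] 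
 [100335,274960,232308,253024,248984,238548,269882,201674]
 (.splitD 0 45000
 (.splitD 0 22500
 (.splitD 7 45000
 (.shrink ⟨[-20970,-13900,8300,-3270,810,950,-3450,9190],
 [-22990,23110,3460,2000,21900,-720,-12790,-10740],193119,248210,[83071681537,97124906022,89649516043,92951872264,92082536155,91111713337,94926354825,86277890335]⟩ [59980,201593,177449,195044,190755,185834,203536,131241] 
 [100335,264165,231030,247174,243295,238548,255226,201674]
 (.splitD 1 45000
 (.shrink ⟨[-24440,-15850,9310,-3780,1050,970,-3950,10880],
 [-2300,38960,-20730,17040,-36040,-1290,5480,-18180],192662,173020,[82538615477,97881468832,89352847232,93141352999,92053368647,91018887282,95486483424,85437697799]⟩ [59980,221587,193941,213551,208492,203238,223172,163970] 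
 [100335,251824,213625,232460,227542,222481,241933,185327]
 (.splitD 1 22500
 (.leaf ⟨[-30190,-16320,6320,-2330,210,1780,-5280,14080],
 [-14160,71360,-50450,-6840,35270,12210,16950,-39970],192750,14280,[82547991828,97453194316,90295388968,92678257129,92464010488,90622459986,96641299608,84157133649]⟩)
 (.leaf ⟨[-20480,-18230,15820,-6730,2220,290,-3070,8820],
 [-92360,70720,-83810,7040,-27780,26020,31250,7580],192410,0,[80634744917,99448353346,87672558661,94204394318,91764792612,91458620846,94898266164,86509340483]⟩)))
 (.leaf ⟨[-17680,-20880,19580,-8320,2830,-120,-2530,7540],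
 [-21950,41450,-60190,11090,-2030,-760,480,-13580],193433,142760,[79786857891,100633437543,86778949290,94665474535,91515690360,91630680856,94411640813,87224078527]⟩)))
 (.leaf ⟨[-13180,-9470,5560,-1320,-1820,6520,-15840,12560],
 [5690,33060,-22810,1020,10820,-5510,-27390,-20800],192765,180950,[84183262811,95555238975,90720265598,92071353702,94052040183,87725734077,96945673708,84388251127]⟩))
 (.leaf ⟨[-20950,-12550,9770,-3770,520,2160,-6580,8690],
 [-6690,33910,12300,-12450,12950,-4200,-25180,-33870],192168,232780,[81757512101,97279633684,89377852040,93151204755,92556797434,90342931985,95626894931,85211905240]⟩))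
 (.leaf ⟨[-24640,-11940,14400,-5600,1110,2260,-7330,10080],
 [-6110,56700,-39030,30990,21880,-9890,48330,-41180],188046,144390,[79155525102,98618249740,88180444573,93955740287,92657987164,90288956323,96453813149,82329982224]⟩)))
 (.splitT 7 100335
 (.shrink ⟨[-23010,-11590,5220,-1380,-790,3860,-10010,16340],
 [-47600,20000,-21170,2340,270,6040,-6910,-22320],193724,248210,[85464674082,95855370505,90651890048,92162878848,93059273942,89204044428,98068650544,82695369947]⟩ [100335,193248,183275,191318,195791,174320,204515,59980] 
 [200885,256727,233876,241142,245399,226127,265627,100335]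
 (.splitD 0 45000
 (.splitD 0 22500
 (.splitD 1 45000
 (.splitD 7 45000
 (.shrink ⟨[-24170,-10880,4270,-1300,-750,3430,-8830,15200],
 [-44080,20020,-33250,-11750,-23480,14460,-19140,-32220],193221,207870,[85492200641,95514734446,90866142255,92170583889,92972086610,89515422727,97564920835,82775620937]⟩ [170393,228900,207942,214484,218235,200483,228762,59980] 
 [177479,234947,214272,220714,224313,206837,243586,100335]
 (.shrink ⟨[-24180,-10750,4010,-1130,-800,3460,-8800,15200],
 [-41940,17040,-54400,3250,20130,14740,-1600,-31810],193223,209610,[85524651764,95429336161,90956213746,92121589909,92989391517,89513822253,97558430640,82775630977]⟩ [171756,229580,209586,215402,219419,201594,230314,59980] 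
 [176114,233434,213559,219326,223324,205628,242397,100335]
 (.splitD 1 22500
 (.shrink ⟨[-24180,-10770,4040,-1160,-770,3430,-8800,15200],
 [-49190,17230,-41570,3580,6880,15710,5360,-31770],193224,209840,[85519556622,95440388689,90943431406,92134593642,92976124171,89520785843,97558351327,82774581228]⟩ [172703,230475,210390,216323,220210,202511,231218,59980] 
 [175154,232643,212625,218531,222406,204781,241579,100335]
 (.splitT 7 80121
 (.leaf ⟨[-19090,-4430,-2720,4590,-4330,4330,-7160,11500],
 [11400,-18550,-46710,-26800,-16170,8830,-22290,-78760],0,330,[78908846944,104984055605,98772468840,97447211380,102738029583,91901686360,112073640158,37520572825]⟩)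
 (.leaf ⟨[-30180,-16180,8090,-3240,-1080,6090,-13180,20260],
 [-16370,49070,34930,38620,51110,120,-22630,-71570],188402,15020,[83283970285,97964876875,89804511504,92748942126,93902941349,88175689163,100198008932,80787382729]⟩)))
 (.leaf ⟨[-22040,-29530,42960,-42080,35650,-22650,3880,13480],
 [-42170,90440,-55930,11820,3710,-11640,-61940,-50750],172713,0,[77384135875,109156284493,73955588378,109420906253,80164542528,98583225984,96462433360,79288212757]⟩))))
 (.leaf ⟨[-16060,-6850,2220,300,-2920,8230,-19000,18210],
 [-47150,-6360,-15400,-15010,46640,-27440,-48160,-44950],193542,146300,[87624562926,94173971099,91731101941,91453821678,94655224298,86879324850,99874295124,80281574186]⟩))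
 (.leaf ⟨[-10440,-11250,15720,-6480,1790,1020,-4600,7380],
 [16930,42180,24590,13040,-2570,20240,-11180,-35230],192372,165440,[83896506591,97382085423,87748823618,94056908117,92022133404,90985991543,94866120688,84585165816]⟩))
 (.leaf ⟨[-18550,-1540,370,450,-1700,4300,-10220,8860],
 [2990,31390,-12420,-9970,9250,-1690,-46770,-42820],192792,230340,[87052585195,92577397488,92175555002,91693571333,93493654457,89168596743,96460676064,82554782407]⟩))
 (.leaf ⟨[-19540,3200,-630,910,-1900,4230,-9660,7460],
 [27320,42650,-19300,12220,-11340,2080,730,-52190],191686,81670,[86336119604,91377464337,92539244065,91586166740,93575266203,89294648773,96090608528,80221381391]⟩)))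
 (.splitD 1 40000
 (.shrink ⟨[-28520,-16320,6890,-2080,-1020,5020,-12810,19300],
 [7890,21790,-26070,20,18520,-12310,-31320,-28060],194688,218940,[83816377166,97364308431,90164556663,92244231827,93339174576,88471814274,99354576449,83125553236]⟩ [100335,178953,155734,167621,173083,143915,172309,100335] 
 [208134,280844,250250,260484,265193,240558,289144,205487]
 (.splitD 7 40000
 (.shrink ⟨[-32160,-17370,7410,-2500,-240,2700,-7150,17620],
 [-6690,60750,-39180,4520,-28850,-15360,940,-59540],194792,5720,[83307743951,97741684981,89972800569,92494400340,92637926846,89974500726,97762617850,83243943192]⟩ [100335,186949,155734,192130,192829,178318,186322,100335] 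
 [175410,260861,226997,239739,240427,227051,260533,175165]
 (.splitD 1 30000
 (.shrink ⟨[-34720,-16630,6170,-1940,-810,3970,-9910,19770],
 [-5400,66470,-27470,14100,6500,-16940,39410,-66370],193939,0,[83313779668,97366898761,90339584304,92279046943,93080149308,89195049572,98954555731,82478842705]⟩ [100335,203933,189173,199449,203222,182305,201903,100335] 
 [164045,254108,224108,233735,237424,217719,260533,162519]
 (.splitD 7 30000
 (.shrink ⟨[-35570,-18150,6860,-2360,-60,2540,-7060,17980],
 [-8000,66440,-47930,-8260,-11200,4440,51590,-67320],194372,0,[82927902990,97886246312,90109286541,92513528094,92579223694,90031302534,97875692003,82974186892]⟩ [100335,212885,196557,209172,209428,196059,213221,100335] 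
 [148334,246257,212700,225032,225311,212286,246468,148281]
 (.splitD 0 45000
 (.splitD 0 22500
 (.splitD 0 11250
 (.splitD 0 5625
 (.splitD 7 15000
 (.shrink ⟨[-36810,-19360,8060,-2910,150,2340,-6710,18070],
 [49040,68610,-48820,-20580,-46880,2780,25710,-66930],193835,0,[82513546549,98492918917,89769123492,92702491194,92509654838,90148320594,97876701218,82870298065]⟩ [100335,219023,197925,213206,212319,200147,233777,127474] 
 [142784,246257,209625,224634,223758,211798,244962,142977]
 (.splitD 1 15000
 (.leaf ⟨[-37224,-18437,6933,-2480,0,2480,-6933,18437],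
 [26850,55000,14340,38490,42020,6330,-27580,-55000],193905,0,[82774765737,98015818896,90073706008,92569954296,92569954296,90073706008,98015818896,82774765737]⟩)
 (.leaf ⟨[-32110,-19100,11410,-4490,960,1640,-5510,14800],
 [91830,68700,-73350,25520,17300,-7780,-28550,-17590],193414,0,[81750509028,98923461457,88918053180,93355673929,92297735780,90642585254,96879026739,83926048393]⟩)))
 (.leaf ⟨[-32790,-15430,5720,-1640,-1070,4710,-11800,19810],
 [-56320,59200,-72390,29240,7260,8030,-32340,-69800],193513,0,[83763056411,97083323018,90600565756,92271744799,93425951231,88801149330,99206347233,81561099456]⟩))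
 (.leaf ⟨[-37290,-17240,6690,-2390,-20,2430,-6700,17230],
 [90100,68120,-72280,-9070,-17960,-31220,76580,-68200],193754,0,[82971989819,97747398063,90241601709,92650827432,92668261018,90230579142,97746996977,81960218489]⟩))
 (.leaf ⟨[-38410,-15560,6050,-2110,-60,2190,-6060,15550],
 [82520,69550,-42980,-8060,7870,16270,-38150,-69620],193290,0,[83066116694,97198303844,90433953255,92596082484,92639416966,90413759467,97197877176,81212106516]⟩))
 (.leaf ⟨[-41230,-13060,5080,-1810,10,1770,-5010,13010],
 [-90380,72080,27710,-17940,35050,-32460,-22230,-71900],192132,0,[79190438355,96419837320,90715839018,92589084951,92575685333,90738852369,96392629583,83270832761]⟩))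
 (.leaf ⟨[-45740,-7840,1360,670,-160,-310,-1840,7420],
 [360,70560,-20050,13160,-9360,-12000,9770,-72690],189120,12330,[79375859149,94508430582,92103499435,92129557496,92282256462,91921405683,94499055528,79450087968]⟩)))
 (.leaf ⟨[-27410,-12190,4390,-820,-2110,7050,-17050,21390],
 [26730,40210,-19270,22760,27460,-21980,71550,-67070],193019,0,[84934700921,95992033091,91056720334,91888416146,94227811968,87424225140,100364878162,80248581582]⟩)))
 (.leaf ⟨[-27310,-21370,17090,-7110,2130,780,-4360,12360],
 [13340,66990,-59430,25410,22590,16210,36360,-46240],193262,0,[80290297317,100343209904,87408378565,94233872018,91867331810,91065840891,96014934470,84916431019]⟩)))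
 (.leaf ⟨[-24840,-10840,3620,240,-4330,9950,-21460,24600],
 [-23990,38840,-37420,-16600,39190,-26700,-50260,-40000],194261,132310,[85567719442,95390509315,91397708581,91150417175,95305136787,86150463275,101907297722,79986629396]⟩)))
 (.leaf ⟨[-24340,-20600,18350,-7420,1370,3280,-10750,16490],
 [1360,39940,-40350,23050,-41230,-20320,-45670,-33560],194218,161980,[81145880749,100388808239,87106579959,94034726492,92493202030,89238080716,98245574399,84211952348]⟩)))))

def eps0 (k : Fin 8) : ℤ := if k = 0 then 1 else -1

theorem treeData_ok : treeData.check eps0 726868490000 (gt (List.replicate 8 59980))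
    (gt (List.replicate 8 325000)) (gt []) (gt (List.replicate 8 90000)) = true := by
  decide +kernel

theorem shrink1_ok : shrinkOK (fun _ => 1) 726868490000 cert1 (List.replicate 8 59980)
    (List.replicate 8 500000) (gt []) (gt (List.replicate 8 500000)) (gt [])
    (gt (List.replicate 8 90000)) = true := by
  decide +kernel

theorem shrink2_ok : shrinkOK (fun _ => 1) 726868490000 cert2 (List.replicate 8 59980)
    (List.replicate 8 325000) (gt (List.replicate 8 59980)) (gt (List.replicate 8 500000)) (gt [])
    (gt (List.replicate 8 90000)) = true := by
  decide +kernel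

theorem j00_ok : edgeOK 16 59980 325000 0 90000 0 90000 0 0 0 0 198000 250000 91918900000
    = true := by decide +kernel
theorem j10_ok : edgeOK 16 59980 325000 0 90000 0 90000 (-9000) 0 0 0 198000 250000 90368900000
    = true := by decide +kernel
theorem j01_ok : edgeOK 16 59980 325000 0 90000 0 90000 0 (-9000) 0 0 198000 250000 90368900000
    = true := by decide +kernel
theorem j11_ok : edgeOK 16 59980 325000 0 90000 0 90000 (-9000) (-9000) 0 0 198000 250000
    88818900000 = true := by decide +kernel

end Oct


namespace Oct

theorem Sys.rot {A : ℝ} {T x : Fin 8 → ℝ} {eps : Fin 8 → ℤ} (S : Sys A T x eps) (j : Fin 8) :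
    Sys A (fun k => T (k + j)) (fun k => x (k + j)) (fun k => eps (k + j)) := by
  refine ⟨fun k => S.pos _, ?_, ?_, ?_⟩
  · rw [← S.sum]
    exact Equiv.sum_comp (Equiv.addRight j) (fun k => 2 * Real.arctan (T k))
  · intro be
    have h := S.bound (fun k => be (k - j))
    rw [← Equiv.sum_comp (Equiv.addRight j)] at h
    refine h.trans (le_of_eq (Finset.sum_congr rfl fun k _ => ?_))
    simp only [Equiv.coe_addRight, add_sub_cancel_right, add_right_comm k j 1]
  · have h := S.chord
    rw [← Equiv.sum_comp (Equiv.addRight j)] at h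
    refine h.trans (le_of_eq (Finset.sum_congr rfl fun k _ => ?_))
    simp only [Equiv.coe_addRight, add_right_comm k j 1]

theorem gt_rep (m : ℤ) (k : Fin 8) : gt (List.replicate 8 m) k = m := by
  fin_cases k <;> rfl

theorem gt_nil (k : Fin 8) : gt [] k = 0 := rfl

theorem narrow {A : ℝ} {T x : Fin 8 → ℝ} {eps : Fin 8 → ℤ} (S : Sys A T x eps)
    (hT : ∀ k, T k ≤ 1/2) (hx : ∀ k, 0 ≤ x k ∧ x k ≤ 0.09) :
    A ≤ 0.72686849 ∨ InB T (gt (List.replicate 8 59980)) (gt (List.replicate 8 325000)) := by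
  have hb : ∀ c : Cert, (∀ k, gt c.be k = 0) → A ≤ ∑ k, EE (T k) (x k) (x (k+1))
      ((((fun _ => 1) : Fin 8 → ℤ) k) * ((gt c.be k : ℝ)/10^6)) ((gt c.be (k+1) : ℝ)/10^6) := by
    intro c hc
    have := S.bound 0
    simpa [hc] using this
  have hxB : InB x (gt []) (gt (List.replicate 8 90000)) := by
    intro k
    rw [gt_nil, gt_rep]
    constructor
    · push_cast; linarith [hx k]
    · push_cast; linarith [hx k]
  have hTB : InB T (gt []) (gt (List.replicate 8 500000)) := by
    intro k
    rw [gt_nil, gt_rep]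
    constructor
    · push_cast; linarith [S.pos k]
    · push_cast; linarith [hT k]
  have e : ((726868490000 : ℤ) : ℝ) / 10^12 = 0.72686849 := by norm_num
  rcases shrink_sound S.pos S.sum S.chord (hb cert1 (by decide)) shrink1_ok hTB hxB with h | h
  · left; rwa [e] at h
  rcases shrink_sound S.pos S.sum S.chord (hb cert2 (by decide)) shrink2_ok h hxB with h | h
  · left; rwa [e] at h
  · right; exact h

theorem core1 {A : ℝ} {T x : Fin 8 → ℝ} (S : Sys A T x eps0)
    (hT : ∀ k, T k ≤ 1/2) (hx : ∀ k, 0 ≤ x k ∧ x k ≤ 0.09) : A ≤ 0.72686849 := by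
  rcases narrow S hT hx with h | h
  · exact h
  have hxB : InB x (gt []) (gt (List.replicate 8 90000)) := by
    intro k
    rw [gt_nil, gt_rep]
    constructor
    · push_cast; linarith [hx k]
    · push_cast; linarith [hx k]
  have := Tree.sound S treeData _ _ _ _ treeData_ok h hxB
  refine this.trans (le_of_eq ?_)
  norm_num

theorem core3 {A : ℝ} {T x : Fin 8 → ℝ} {eps : Fin 8 → ℤ} (S : Sys A T x eps)
    (hT : ∀ k, T k ≤ 1/2) (hx : ∀ k, 0 ≤ x k ∧ x k ≤ 0.09)
    (hc : 3 ≤ (Finset.univ.filter fun k => eps k = 1).card) : A ≤ 0.72686849 := by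
  rcases narrow S hT hx with h | h
  · exact h
  have hT0 : ∀ k, ((59980 : ℤ) : ℝ) ≤ 10^6 * T k := fun k => by
    have := (h k).1; rwa [gt_rep] at this
  have hT1 : ∀ k, 10^6 * T k ≤ ((325000 : ℤ) : ℝ) := fun k => by
    have := (h k).2; rwa [gt_rep] at this
  have x0 : ∀ k, ((0 : ℤ) : ℝ) / 10^6 ≤ x k := fun k => by push_cast; linarith [hx k]
  have x1 : ∀ k, x k ≤ ((90000 : ℤ) : ℝ) / 10^6 := fun k => by push_cast; linarith [hx k]
  let i : Fin 8 → ℝ := fun k => if eps k = 1 then 1 else 0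
  have := S.total (fun k => -0.009 * i k) 0 0.198 0.25 (by norm_num)
    (fun k => 0.0919189 - 0.00155 * i k - 0.00155 * i (k+1)) (by
      intro k
      have e00 := edge_sound j00_ok (S.pos k) (hT0 k) (hT1 k) (x0 k) (x1 k) (x0 (k+1)) (x1 (k+1))
      have e01 := edge_sound j01_ok (S.pos k) (hT0 k) (hT1 k) (x0 k) (x1 k) (x0 (k+1)) (x1 (k+1))
      have e10 := edge_sound j10_ok (S.pos k) (hT0 k) (hT1 k) (x0 k) (x1 k) (x0 (k+1)) (x1 (k+1))
      have e11 := edge_sound j11_ok (S.pos k) (hT0 k) (hT1 k) (x0 k) (x1 k) (x0 (k+1)) (x1 (k+1))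
      simp only [i, Pi.zero_apply]
      by_cases h1 : eps k = 1 <;> by_cases h2 : eps (k+1) = 1
      · norm_num [h1, h2] at e11 ⊢; linarith
      · norm_num [h1, h2] at e10 ⊢; linarith
      · norm_num [h1, h2] at e01 ⊢; linarith
      · norm_num [h1, h2] at e00 ⊢; linarith)
  have hi : ∑ k, i k = ((Finset.univ.filter fun k => eps k = 1).card : ℝ) := by
    simp [i]
  have hi' : ∑ k, i (k+1) = ∑ k, i k := Equiv.sum_comp (Equiv.addRight (1 : Fin 8)) i
  rw [Finset.sum_sub_distrib, Finset.sum_sub_distrib, ← Finset.mul_sum, ← Finset.mul_sum, hi', hi]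
    at this
  have hc' : (3:ℝ) ≤ ((Finset.univ.filter fun k => eps k = 1).card : ℝ) := by exact_mod_cast hc
  simp at this
  norm_num at this
  linarith

theorem core {A : ℝ} {T x : Fin 8 → ℝ} {eps : Fin 8 → ℤ} (S : Sys A T x eps)
    (heps : ∀ k, eps k = 1 ∨ eps k = -1) (hprod : ∏ k, eps k = -1)
    (hT : ∀ k, T k ≤ 1/2) (hx : ∀ k, 0 ≤ x k ∧ x k ≤ 0.09) : A ≤ 0.72686849 := by
  by_cases hc : 3 ≤ (Finset.univ.filter fun k => eps k = 1).card
  · exact core3 S hT hx hc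
  have hp : ∏ k, eps k = (-1)^(8 - (Finset.univ.filter fun k => eps k = 1).card) := by
    have h1 : ∀ k, eps k = if eps k = 1 then 1 else -1 := by
      intro k
      rcases heps k with h | h <;> simp [h]
    rw [Finset.prod_congr rfl (fun k _ => h1 k), Finset.prod_ite]
    simp only [Finset.prod_const_one, one_mul, Finset.prod_const]
    congr 1
    have := Finset.card_filter_add_card_filter_not (s := (Finset.univ : Finset (Fin 8))) (fun k => eps k = 1)
    simp at this
    omega
  have h1 : (Finset.univ.filter fun k => eps k = 1).card = 1 := by
    generalize (Finset.univ.filter fun k => eps k = 1).card = n at *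
    interval_cases n
    · rw [hp] at hprod; norm_num at hprod
    · rfl
    · rw [hp] at hprod; norm_num at hprod
  obtain ⟨j, hj⟩ := Finset.card_eq_one.1 h1
  have hS := S.rot j
  have he : (fun k => eps (k + j)) = eps0 := by
    funext k
    unfold eps0
    have hm : ∀ k, eps k = 1 ↔ k = j := by
      intro k
      have := congrArg (k ∈ ·) hj
      simpa using this
    split_ifs with hk
    · rw [hm]; simp [hk]
    · rcases heps (k + j) with h | h
      · rw [hm] at h; exact absurd (by simpa using h) hk
      · exact h
  rw [he] at hS
  exact core1 hS (fun k => hT _) (fun k => hx _)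

end Oct


namespace Oct
open Real

/-- The quadratic energy of one step. -/
noncomputable def qq (a b p : ℝ) : ℝ := ((a^2 + b^2) * cos p - 2 * a * b) / sin p

theorem qq_same (a : ℝ) : qq a a 0 = 0 := by simp [qq]

theorem qq_merge {a b c p r : ℝ} (hp : 0 < p) (hr : 0 < r) (hpr : p + r < π) :
    qq a c (p + r) ≤ qq a b p + qq b c r := by
  have s1 : 0 < sin p := sin_pos_of_pos_of_lt_pi hp (by linarith)
  have s2 : 0 < sin r := sin_pos_of_pos_of_lt_pi hr (by linarith)
  have s3 : 0 < sin (p + r) := sin_pos_of_pos_of_lt_pi (by linarith) hpr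
  have e : qq a b p + qq b c r - qq a c (p + r) =
      (b * sin (p + r) - a * sin r - c * sin p)^2 / (sin p * sin r * sin (p + r)) := by
    unfold qq
    rw [eq_div_iff (by positivity)]
    have : (((a^2 + b^2) * cos p - 2 * a * b) / sin p + ((b^2 + c^2) * cos r - 2 * b * c) / sin r -
        ((a^2 + c^2) * cos (p + r) - 2 * a * c) / sin (p + r)) * (sin p * sin r * sin (p + r))
        = ((a^2 + b^2) * cos p - 2 * a * b) * (sin r * sin (p + r)) +
          ((b^2 + c^2) * cos r - 2 * b * c) * (sin p * sin (p + r)) -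
          ((a^2 + c^2) * cos (p + r) - 2 * a * c) * (sin p * sin r) := by
      field_simp
    rw [this, sin_add, cos_add]
    have h1 := sin_sq_add_cos_sq p
    have h2 := sin_sq_add_cos_sq r
    have e1 : cos p^2 = 1 - sin p^2 := by linarith
    have e2 : cos r^2 = 1 - sin r^2 := by linarith
    ring_nf
    simp only [e1, e2]
    ring
  have : 0 ≤ qq a b p + qq b c r - qq a c (p + r) := by rw [e]; positivity
  linarith

theorem wirt_part {m : ℕ} {ψ z : ℕ → ℝ}
    (hs : ∀ k < m, ψ k < ψ (k+1) ∨ (ψ (k+1) = ψ k ∧ z (k+1) = z k)) :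
    ∀ j ≤ m, ψ j < ψ 0 + π → ((ψ 0 < ψ j) ∨ (ψ j = ψ 0 ∧ z j = z 0)) ∧
      qq (z 0) (z j) (ψ j - ψ 0) ≤ ∑ k ∈ Finset.range j, qq (z k) (z (k+1)) (ψ (k+1) - ψ k) := by
  intro j
  induction j with
  | zero => intro _ _; simp [qq_same]
  | succ j ih =>
    intro hj hlt
    have hle : ψ j ≤ ψ (j+1) := by
      rcases hs j (by omega) with h | h
      · exact h.le
      · exact h.1.ge
    obtain ⟨h1, h2⟩ := ih (by omega) (by linarith)
    rw [Finset.sum_range_succ]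
    rcases hs j (by omega) with h | ⟨h, h'⟩
    · rcases h1 with h1 | ⟨h1, h1'⟩
      · refine ⟨Or.inl (by linarith), ?_⟩
        have := qq_merge (a := z 0) (b := z j) (c := z (j+1)) (p := ψ j - ψ 0)
          (r := ψ (j+1) - ψ j) (by linarith) (by linarith) (by linarith)
        rw [show ψ j - ψ 0 + (ψ (j+1) - ψ j) = ψ (j+1) - ψ 0 by ring] at this
        linarith
      · refine ⟨Or.inl (by linarith), ?_⟩
        rw [h1, h1', sub_self, qq_same] at h2
        rw [h1, h1']
        linarith
    · rw [h, h', sub_self, qq_same, add_zero]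
      exact ⟨h1, h2⟩

theorem wirt : ∀ {m : ℕ} {ψ z : ℕ → ℝ}
    (_ : ∀ k < m, ψ k < ψ (k+1) ∨ (ψ (k+1) = ψ k ∧ z (k+1) = z k))
    (_ : ψ m = ψ 0 + π) (_ : z m = - z 0),
    0 ≤ ∑ k ∈ Finset.range m, qq (z k) (z (k+1)) (ψ (k+1) - ψ k) := by
  intro m
  induction m with
  | zero => intros; simp
  | succ m ih =>
    intro ψ z hs hψ hz
    rw [Finset.sum_range_succ]
    rcases hs m (by omega) with h | ⟨h, h'⟩
    · obtain ⟨h1, h2⟩ := wirt_part hs m (by omega) (by linarith)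
      have e : qq (z 0) (z m) (ψ m - ψ 0) + qq (z m) (z (m+1)) (ψ (m+1) - ψ m) = 0 := by
        rw [hψ, hz, show ψ 0 + π - ψ m = π - (ψ m - ψ 0) by ring]
        unfold qq
        rw [sin_pi_sub, cos_pi_sub]
        ring
      linarith
    · rw [h, h', sub_self, qq_same, add_zero]
      exact ih (fun k hk => hs k (by omega)) (by rw [← h, hψ]) (by rw [← h', hz])

/-- The one-step identity. -/
theorem step_id {X Y X' Y' p p' : ℝ}
    (h : sin (p' - p) ≠ 0 ∨ (p' = p ∧ (X' - X) * cos p + (Y' - Y) * sin p = 0)) :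
    X * Y' - Y * X' =
      (X' * cos p' + Y' * sin p') * (cos p' * Y' - sin p' * X')
      - (X * cos p + Y * sin p) * (cos p * Y - sin p * X)
      - qq (X * cos p + Y * sin p) (X' * cos p' + Y' * sin p') (p' - p)
      + ((X' - X) * cos p + (Y' - Y) * sin p) * ((X' - X) * cos p' + (Y' - Y) * sin p')
        / sin (p' - p) := by
  rcases h with h | ⟨h, h'⟩
  · unfold qq
    have e1 : cos p^2 = 1 - sin p^2 := by linarith [sin_sq_add_cos_sq p]
    have e2 : cos p'^2 = 1 - sin p'^2 := by linarith [sin_sq_add_cos_sq p']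
    have e3 : ∀ a b c d: ℝ, a - b / sin (p' - p) + c / sin (p' - p) = d ↔
       a * sin (p' - p) - b + c = d * sin (p' - p) := by
      intro a b c d
      constructor
      · intro hh; rw [← hh]; field_simp
      · intro hh; field_simp; linarith
    symm
    rw [e3, sin_sub, cos_sub]
    have e13 : cos p^3 = cos p * (1 - sin p^2) := by rw [← e1]; ring
    have e23 : cos p'^3 = cos p' * (1 - sin p'^2) := by rw [← e2]; ring
    ring_nf
    simp only [e1, e2, e13, e23]
    ring
  · subst h
    have e1 : cos p'^2 = 1 - sin p'^2 := by linarith [sin_sq_add_cos_sq p']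
    have ht : X' * cos p' + Y' * sin p' = X * cos p' + Y * sin p' := by linarith
    rw [h', zero_mul, zero_div, sub_self, ht, qq_same]
    have : X * Y' - Y * X' = (X * cos p' + Y * sin p') * (cos p' * (Y' - Y) - sin p' * (X' - X))
       - ((X' - X) * cos p' + (Y' - Y) * sin p') * (cos p' * Y - sin p' * X) := by
      ring_nf
      simp only [e1]
      ring
    rw [this, h']
    ring

/-- The bilinear telescoping identity for a test sequence. -/
theorem step_bil {X Y X' Y' p p' τ τ' : ℝ} (h : sin (p' - p) ≠ 0) :
    τ' * (cos p' * Y' - sin p' * X') - τ * (cos p * Y - sin p * X) =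
    ((τ' * (X' * cos p' + Y' * sin p') + τ * (X * cos p + Y * sin p)) * cos (p' - p)
      - τ' * (X * cos p + Y * sin p) - τ * (X' * cos p' + Y' * sin p')
      - τ' * ((X' - X) * cos p + (Y' - Y) * sin p)
      + τ * ((X' - X) * cos p' + (Y' - Y) * sin p')) / sin (p' - p) := by
  rw [eq_div_iff h, sin_sub, cos_sub]
  have e1 : cos p^2 = 1 - sin p^2 := by linarith [sin_sq_add_cos_sq p]
  have e2 : cos p'^2 = 1 - sin p'^2 := by linarith [sin_sq_add_cos_sq p']
  ring_nf
  simp only [e1, e2]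
  ring

end Oct


namespace Oct
open Real

theorem half_tan {p : ℝ} (h0 : 0 < p) (h1 : p < π) : 0 < tan (p/2) ∧
    sin p = 2 * tan (p/2) / (1 + tan (p/2)^2) ∧ cos p = (1 - tan (p/2)^2) / (1 + tan (p/2)^2) ∧
    2 * arctan (tan (p/2)) = p := by
  have hc : 0 < cos (p/2) := cos_pos_of_mem_Ioo ⟨by linarith, by linarith⟩
  have hs := sin_sq_add_cos_sq (p/2)
  have e : p = 2 * (p/2) := by ring
  have hd : 1 + (sin (p/2) / cos (p/2))^2 = 1 / cos (p/2)^2 := by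
    field_simp; linarith
  refine ⟨tan_pos_of_pos_of_lt_pi_div_two (by linarith) (by linarith), ?_, ?_, ?_⟩
  · conv_lhs => rw [e, sin_two_mul]
    rw [tan_eq_sin_div_cos, hd]; field_simp
  · conv_lhs => rw [e, cos_two_mul]
    rw [tan_eq_sin_div_cos, hd]; field_simp; linarith
  · rw [arctan_tan (by linarith) (by linarith)]; ring

theorem EE_eq {p d d' σ τ τ' : ℝ} (h0 : 0 < p) (h1 : p < π) (hσ : σ^2 = 1) :
    EE (tan (p/2)) (1 - d) (1 - d') (σ * τ) (σ * τ') =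
     d * d' * sin p / 4 + (σ * (d' * cos p - d) / 2) * (σ * (d' - d * cos p) / 2) / sin p
     + qq τ τ' p - 2 * (τ' * (σ * (d' * cos p - d) / 2) - τ * (σ * (d' - d * cos p) / 2)) / sin p := by
  obtain ⟨hT, hs, hc, -⟩ := half_tan h0 h1
  unfold qq EE
  rw [hs, hc]
  set T := tan (p/2)
  have e : ∀ x y : ℝ, (σ * x / 2) * (σ * y / 2) = x * y / 4 := by
    intro x y
    linear_combination (x * y / 4) * hσ
  rw [e]
  have e2 : (σ * τ - σ * τ')^2 = (τ - τ')^2 := by linear_combination (τ - τ')^2 * hσ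
  have e3 : (σ * τ + σ * τ')^2 = (τ + τ')^2 := by linear_combination (τ + τ')^2 * hσ
  rw [e2, e3]
  field_simp
  ring

theorem wirt1 {m : ℕ} {X Y ψ : ℕ → ℝ} (hX : X m = X 0) (hY : Y m = Y 0) (hψ : ψ m = ψ 0 + π)
    (hs : ∀ k < m, (ψ k < ψ (k+1) ∧ ψ (k+1) < ψ k + π) ∨
      (ψ (k+1) = ψ k ∧ (X (k+1) - X k) * cos (ψ k) + (Y (k+1) - Y k) * sin (ψ k) = 0)) :
    ∑ k ∈ Finset.range m, (X k * Y (k+1) - Y k * X (k+1)) =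
    ∑ k ∈ Finset.range m, ((X (k+1) - X k) * cos (ψ k) + (Y (k+1) - Y k) * sin (ψ k)) *
      ((X (k+1) - X k) * cos (ψ (k+1)) + (Y (k+1) - Y k) * sin (ψ (k+1))) / sin (ψ (k+1) - ψ k)
    - ∑ k ∈ Finset.range m, qq (X k * cos (ψ k) + Y k * sin (ψ k))
        (X (k+1) * cos (ψ (k+1)) + Y (k+1) * sin (ψ (k+1))) (ψ (k+1) - ψ k) := by
  have h : ∀ k ∈ Finset.range m, X k * Y (k+1) - Y k * X (k+1) = _ := fun k hk => step_id (p := ψ k) (p' := ψ (k+1)) (by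
    rcases hs k (Finset.mem_range.1 hk) with h | h
    · left
      exact (sin_pos_of_pos_of_lt_pi (by linarith) (by linarith)).ne'
    · exact Or.inr h)
  rw [Finset.sum_congr rfl h]
  simp only [Finset.sum_add_distrib, Finset.sum_sub_distrib]
  rw [← Finset.sum_sub_distrib]
  have tel := Finset.sum_range_sub (fun k => (X k * cos (ψ k) + Y k * sin (ψ k)) * (cos (ψ k) * Y k - sin (ψ k) * X k)) m
  rw [tel, hX, hY, hψ, cos_add_pi, sin_add_pi]
  ring

theorem wirt1_le {m : ℕ} {X Y ψ : ℕ → ℝ} (hX : X m = X 0) (hY : Y m = Y 0) (hψ : ψ m = ψ 0 + π)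
    (hs : ∀ k < m, (ψ k < ψ (k+1) ∧ ψ (k+1) < ψ k + π) ∨
      (ψ (k+1) = ψ k ∧ (X (k+1) - X k) * cos (ψ k) + (Y (k+1) - Y k) * sin (ψ k) = 0)) :
    ∑ k ∈ Finset.range m, (X k * Y (k+1) - Y k * X (k+1)) ≤
    ∑ k ∈ Finset.range m, ((X (k+1) - X k) * cos (ψ k) + (Y (k+1) - Y k) * sin (ψ k)) *
      ((X (k+1) - X k) * cos (ψ (k+1)) + (Y (k+1) - Y k) * sin (ψ (k+1))) / sin (ψ (k+1) - ψ k) := by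
  rw [wirt1 hX hY hψ hs]
  have := wirt (m := m) (ψ := ψ) (z := fun k => X k * cos (ψ k) + Y k * sin (ψ k)) (by
    intro k hk
    rcases hs k hk with h | ⟨h, h'⟩
    · exact Or.inl h.1
    · refine Or.inr ⟨h, ?_⟩
      rw [h]; linarith) hψ (by rw [hX, hY, hψ, cos_add_pi, sin_add_pi]; ring)
  linarith

theorem node_bound {m : ℕ} {X Y d θ τ σ : ℕ → ℝ} (hX : X m = X 0) (hY : Y m = Y 0)
    (hθ : θ m = θ 0 + π) (hs : ∀ k < m, θ k < θ (k+1) ∧ θ (k+1) < θ k + π)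
    (hσ : ∀ k < m, σ k ^ 2 = 1)
    (hdX : ∀ k < m, X (k+1) - X k = σ k / 2 * (d (k+1) * cos (θ (k+1)) - d k * cos (θ k)))
    (hdY : ∀ k < m, Y (k+1) - Y k = σ k / 2 * (d (k+1) * sin (θ (k+1)) - d k * sin (θ k)))
    (hτ : τ m = - τ 0) :
    ∑ k ∈ Finset.range m, (d k * d (k+1) * sin (θ (k+1) - θ k) / 4 + (X k * Y (k+1) - Y k * X (k+1)))
    ≤ ∑ k ∈ Finset.range m, EE (tan ((θ (k+1) - θ k)/2)) (1 - d k) (1 - d (k+1))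
        (σ k * τ k) (σ k * τ (k+1)) := by
  have hsin : ∀ k < m, 0 < sin (θ (k+1) - θ k) := fun k hk =>
    sin_pos_of_pos_of_lt_pi (by linarith [hs k hk]) (by linarith [hs k hk])
  set t : ℕ → ℝ := fun k => X k * cos (θ k) + Y k * sin (θ k) with ht
  have key := wirt1 (ψ := θ) hX hY hθ (fun k hk => Or.inl (hs k hk))
  have hw := wirt (m := m) (ψ := θ) (z := fun k => t k - τ k) (fun k hk => Or.inl (hs k hk).1) hθ (by
    simp only [ht]; rw [hX, hY, hθ, cos_add_pi, sin_add_pi, hτ]; ring)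
  have tel := Finset.sum_range_sub (fun k => τ k * (cos (θ k) * Y k - sin (θ k) * X k)) m
  rw [Finset.sum_congr rfl (fun k hk => step_bil (hsin k (Finset.mem_range.1 hk)).ne'),
    hX, hY, hθ, cos_add_pi, sin_add_pi, hτ] at tel
  have tel' : ∑ k ∈ Finset.range m, ((τ (k+1) * t (k+1) + τ k * t k) * cos (θ (k+1) - θ k)
      - τ (k+1) * t k - τ k * t (k+1)
      - τ (k+1) * ((X (k+1) - X k) * cos (θ k) + (Y (k+1) - Y k) * sin (θ k))
      + τ k * ((X (k+1) - X k) * cos (θ (k+1)) + (Y (k+1) - Y k) * sin (θ (k+1)))) / sin (θ (k+1) - θ k)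
      = 0 := by rw [tel]; ring
  rw [Finset.sum_add_distrib, key]
  have fin : ∀ k ∈ Finset.range m, EE (tan ((θ (k+1) - θ k)/2)) (1 - d k) (1 - d (k+1))
        (σ k * τ k) (σ k * τ (k+1)) =
      d k * d (k+1) * sin (θ (k+1) - θ k) / 4
      + ((X (k+1) - X k) * cos (θ k) + (Y (k+1) - Y k) * sin (θ k)) *
      ((X (k+1) - X k) * cos (θ (k+1)) + (Y (k+1) - Y k) * sin (θ (k+1))) / sin (θ (k+1) - θ k)
      - qq (t k) (t (k+1)) (θ (k+1) - θ k)
      + qq (t k - τ k) (t (k+1) - τ (k+1)) (θ (k+1) - θ k)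
      + 2 * (((τ (k+1) * t (k+1) + τ k * t k) * cos (θ (k+1) - θ k)
      - τ (k+1) * t k - τ k * t (k+1)
      - τ (k+1) * ((X (k+1) - X k) * cos (θ k) + (Y (k+1) - Y k) * sin (θ k))
      + τ k * ((X (k+1) - X k) * cos (θ (k+1)) + (Y (k+1) - Y k) * sin (θ (k+1)))) / sin (θ (k+1) - θ k)) := by
    intro k hk
    have hk := Finset.mem_range.1 hk
    rw [EE_eq (by linarith [hs k hk]) (by linarith [hs k hk]) (hσ k hk)]
    have e1 : (X (k+1) - X k) * cos (θ k) + (Y (k+1) - Y k) * sin (θ k) =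
        σ k * (d (k+1) * cos (θ (k+1) - θ k) - d k) / 2 := by
      rw [hdX k hk, hdY k hk, cos_sub]
      linear_combination (- σ k / 2 * d k) * sin_sq_add_cos_sq (θ k)
    have e2 : (X (k+1) - X k) * cos (θ (k+1)) + (Y (k+1) - Y k) * sin (θ (k+1)) =
        σ k * (d (k+1) - d k * cos (θ (k+1) - θ k)) / 2 := by
      rw [hdX k hk, hdY k hk, cos_sub]
      linear_combination (σ k / 2 * d (k+1)) * sin_sq_add_cos_sq (θ (k+1))
    rw [e1, e2]
    unfold qq
    have := (hsin k hk).ne'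
    field_simp
    ring
  rw [Finset.sum_congr rfl fin]
  simp only [Finset.sum_add_distrib, Finset.sum_sub_distrib, ← Finset.mul_sum]
  rw [tel']
  simp only [ht] at hw ⊢
  linarith

end Oct


namespace Oct
open Real

theorem chord_node {T T' d0 d d2 : ℝ} (hT : 0 < T) (hT' : 0 < T') (h0 : 0 < d0) (h : 0 < d)
    (h2 : 0 < d2)
    (H : ((1 - T^2) / (2 * T) + (1 - T'^2) / (2 * T')) / d ≤
      (1 + T^2) / (2 * T) / d0 + (1 + T'^2) / (2 * T') / d2) :
    ((1 + T^2) / (2 * T) * (d0 - d) - d * T - (1 + T^2) / (2 * T) * (d0 - d)^2 / d0) +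
    ((1 + T'^2) / (2 * T') * (d2 - d) - d * T' - (1 + T'^2) / (2 * T') * (d2 - d)^2 / d2) ≤ 0 := by
  have e : ((1 + T^2) / (2 * T) * (d0 - d) - d * T - (1 + T^2) / (2 * T) * (d0 - d)^2 / d0) +
    ((1 + T'^2) / (2 * T') * (d2 - d) - d * T' - (1 + T'^2) / (2 * T') * (d2 - d)^2 / d2) =
    d^2 * (((1 - T^2) / (2 * T) + (1 - T'^2) / (2 * T')) / d -
      ((1 + T^2) / (2 * T) / d0 + (1 + T'^2) / (2 * T') / d2)) := by
    field_simp
    ring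
  rw [e]
  exact mul_nonpos_of_nonneg_of_nonpos (by positivity) (by linarith)

theorem chord_edge {T d d' : ℝ} (hT : 0 < T) (h : 0.91 ≤ d) (h1 : d ≤ 1) (h' : 0.91 ≤ d')
    (h1' : d' ≤ 1) :
    - 1.2466 * ((1 - d') * ((1 + T^2) / (2 * T) * (d - d') - d' * T - (1 + T^2) / (2 * T) * (d - d')^2 / d)
      + (1 - d) * ((1 + T^2) / (2 * T) * (d' - d) - d * T - (1 + T^2) / (2 * T) * (d' - d)^2 / d'))
    ≤ CH T (1 - d) (1 - d') := by
  unfold CH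
  have hd : 0 < d := by linarith
  have hd' : 0 < d' := by linarith
  set K := (1 + T^2) / (2 * T) with hK
  have hK0 : 0 < K := by positivity
  have b1 : (1 - d') / d ≤ 0.09 / 0.91 := by
    rw [div_le_div_iff₀ hd (by norm_num)]; nlinarith
  have b2 : (1 - d) / d' ≤ 0.09 / 0.91 := by
    rw [div_le_div_iff₀ hd' (by norm_num)]; nlinarith
  have e : (1 - d') * (K * (d - d') - d' * T - K * (d - d')^2 / d)
      + (1 - d) * (K * (d' - d) - d * T - K * (d' - d)^2 / d')
      = K * (d - d')^2 * (1 - (1 - d') / d - (1 - d) / d') - T * ((1 - d') * d' + (1 - d) * d) := by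
    field_simp
    ring
  rw [e]
  have q1 : 0 ≤ K * (d - d')^2 := by positivity
  have q2 : K * (d - d')^2 * (1 - 0.18/0.91) ≤ K * (d - d')^2 * (1 - (1 - d') / d - (1 - d) / d') := by
    apply mul_le_mul_of_nonneg_left _ q1
    linarith
  have q3 : T * ((1 - d') * d' + (1 - d) * d) ≤ T * ((1 - d') + (1 - d)) := by
    apply mul_le_mul_of_nonneg_left _ hT.le
    nlinarith
  have e2 : (1 - d - (1 - d'))^2 = (d - d')^2 := by ring
  rw [e2]
  nlinarith

theorem chord_sum {T d : Fin 8 → ℝ} (hT : ∀ k, 0 < T k) (h0 : ∀ k, 0.91 ≤ d k) (h1 : ∀ k, d k ≤ 1)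
    (H : ∀ k, ((1 - T k^2) / (2 * T k) + (1 - T (k+1)^2) / (2 * T (k+1))) / d (k+1) ≤
      (1 + T k^2) / (2 * T k) / d k + (1 + T (k+1)^2) / (2 * T (k+1)) / d (k+1+1)) :
    0 ≤ ∑ k, CH (T k) (1 - d k) (1 - d (k+1)) := by
  have hd : ∀ k, 0 < d k := fun k => by linarith [h0 k]
  have a := Finset.sum_le_sum (fun k (_ : k ∈ Finset.univ) =>
    chord_edge (hT k) (h0 k) (h1 k) (h0 (k+1)) (h1 (k+1)))
  refine le_trans ?_ a
  have b := Finset.sum_nonpos (fun k (_ : k ∈ Finset.univ) =>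
    mul_nonpos_of_nonneg_of_nonpos (sub_nonneg.2 (h1 (k+1)))
      (chord_node (hT k) (hT (k+1)) (hd k) (hd (k+1)) (hd (k+1+1)) (H k)))
  simp only [mul_add, Finset.sum_add_distrib] at b
  have c := Equiv.sum_comp (Equiv.addRight (1 : Fin 8)) (fun k => (1 - d k) * ((1 + T k^2) / (2 * T k) * (d (k+1) - d k) - d k * T k - (1 + T k^2) / (2 * T k) * (d (k+1) - d k)^2 / d (k+1)))
  simp only [Equiv.coe_addRight] at c
  rw [c] at b
  rw [← Finset.mul_sum, Finset.sum_add_distrib]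
  linarith

/-- The trigonometric form of the convexity condition at a node. -/
theorem chord_trig {p p' d0 d d2 : ℝ} (hp : 0 < p) (hp1 : p < π) (hp' : 0 < p') (hp1' : p' < π)
    (h0 : 0 < d0) (h : 0 < d) (h2 : 0 < d2)
    (H : 0 ≤ d * d2 * sin p' + d0 * d * sin p - d0 * d2 * sin (p + p')) :
    ((1 - tan (p/2)^2) / (2 * tan (p/2)) + (1 - tan (p'/2)^2) / (2 * tan (p'/2))) / d ≤
      (1 + tan (p/2)^2) / (2 * tan (p/2)) / d0 + (1 + tan (p'/2)^2) / (2 * tan (p'/2)) / d2 := by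
  obtain ⟨hT, hs, hc, -⟩ := half_tan hp hp1
  obtain ⟨hT', hs', hc', -⟩ := half_tan hp' hp1'
  rw [sin_add, hs, hs', hc, hc'] at H
  set T := tan (p/2)
  set T' := tan (p'/2)
  have : (1 + T^2) / (2 * T) / d0 + (1 + T'^2) / (2 * T') / d2 -
      ((1 - T^2) / (2 * T) + (1 - T'^2) / (2 * T')) / d =
      (d * d2 * (2 * T' / (1 + T' ^ 2)) + d0 * d * (2 * T / (1 + T ^ 2)) -
      d0 * d2 * (2 * T / (1 + T ^ 2) * ((1 - T' ^ 2) / (1 + T' ^ 2)) +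
            (1 - T ^ 2) / (1 + T ^ 2) * (2 * T' / (1 + T' ^ 2)))) *
      ((1 + T^2) * (1 + T'^2) / (4 * T * T' * d * d0 * d2)) := by
    field_simp
    ring
  have : 0 ≤ (1 + T^2) / (2 * T) / d0 + (1 + T'^2) / (2 * T') / d2 -
      ((1 - T^2) / (2 * T) + (1 - T'^2) / (2 * T')) / d := by
    rw [this]; exact mul_nonneg H (by positivity)
  linarith

end Oct


namespace Oct

theorem s1a {T : ℝ} (h0 : 0 ≤ T) (h1 : T ≤ 0.334) :
    0 ≤ (0.012543 + 0.4041 * (T - T^3/3 + T^5/5 - T^7/7)) * (1 + T^2) - 1/2 * T * (1 - T^2) := by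
  have := ppos_sound 10 (pshift 0 [878010000000000000000000000000, -6713000000000000000000000000, 878010000000000000000000, 53858000000000000000000, 0, -3771600000000000, 0, 1616400000, 0, -4041]) 334 (by decide +kernel)
    (1000 * T - 0) (by norm_num; linarith) (by norm_num; linarith)
  rw [ev_pshift] at this
  push_cast at this
  rw [sub_add_cancel] at this
  simp only [ev] at this
  push_cast at this
  linarith

theorem s1b {T : ℝ} (h0 : 0 ≤ T) (h1 : T ≤ 0.251) :
    0.0041172 * (1 + T^2) ≤ (0.012543 + 0.4041 * (T - T^3/3 + T^5/5 - T^7/7)) * (1 + T^2) - 1/2 * T * (1 - T^2) + T * (0.0183 * (1 + T^2) + 0.009 / 0.1178 * ((1 - T^2) - 0.8822 * (1 + T^2))) := by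
  have := ppos_sound 10 (pshift 0 [347395734000000000000000000000000, -2828378000000000000000000000000, 347395734000000000000000000, 26547941000000000000000000, 0, -2221472400000000000, 0, 952059600000, 0, -2380149]) 251 (by decide +kernel)
    (1000 * T - 0) (by norm_num; linarith) (by norm_num; linarith)
  rw [ev_pshift] at this
  push_cast at this
  rw [sub_add_cancel] at this
  simp only [ev] at this
  push_cast at this
  linarith

theorem s1c {T : ℝ} (h0 : 0.25 ≤ T) (h1 : T ≤ 0.3) :
    0.0041172 * (1 + T^2) ≤ (0.012543 + 0.4041 * (T - T^3/3 + T^5/5 - T^7/7)) * (1 + T^2) - 1/2 * T * (1 - T^2) + T * (0.0085 * (1 + T^2) + 0.0098 / 0.0474 * ((1 - T^2) - 0.8348 * (1 + T^2))) := by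
  have := ppos_sound 10 (pshift 250 [139784022000000000000000000000000, -883330000000000000000000000000, 139784022000000000000000000, 6611997000000000000000000, 0, -893869200000000000, 0, 383086800000, 0, -957717]) 50 (by decide +kernel)
    (1000 * T - 250) (by norm_num; linarith) (by norm_num; linarith)
  rw [ev_pshift] at this
  push_cast at this
  rw [sub_add_cancel] at this
  simp only [ev] at this
  push_cast at this
  linarith

theorem s1d {T : ℝ} (h0 : 0.3 ≤ T) (h1 : T ≤ 0.334) :
    0.0041172 * (1 + T^2) ≤ (0.012543 + 0.4041 * (T - T^3/3 + T^5/5 - T^7/7)) * (1 + T^2) - 1/2 * T * (1 - T^2) := by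
  have := ppos_sound 10 (pshift 300 [589806000000000000000000000000, -6713000000000000000000000000, 589806000000000000000000, 53858000000000000000000, 0, -3771600000000000, 0, 1616400000, 0, -4041]) 34 (by decide +kernel)
    (1000 * T - 300) (by norm_num; linarith) (by norm_num; linarith)
  rw [ev_pshift] at this
  push_cast at this
  rw [sub_add_cancel] at this
  simp only [ev] at this
  push_cast at this
  linarith

theorem s1e {T : ℝ} (h0 : 0.333 ≤ T) (h1 : T ≤ 0.6) :
    0.0083 * (1 + T^2) ≤ (0.012543 + 0.4041 * (T - T^3/3 + T^5/5 - T^7/7)) * (1 + T^2) - T * (0.1888 * (1 + T^2) + 0.264 * (1 - T^2)) := by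
  have := ppos_sound 10 (pshift 333 [297010000000000000000000000000, -3409000000000000000000000000, 297010000000000000000000, 24122000000000000000000, 0, -3771600000000000, 0, 1616400000, 0, -4041]) 267 (by decide +kernel)
    (1000 * T - 333) (by norm_num; linarith) (by norm_num; linarith)
  rw [ev_pshift] at this
  push_cast at this
  rw [sub_add_cancel] at this
  simp only [ev] at this
  push_cast at this
  linarith

/-- The deficit function. -/
noncomputable def FF (c K d e : ℝ) : ℝ :=
  1/2 * c * (1 - d*e) - 1/4 * (1/d + 1/e - 2) + 1/4 * (d - e)^2 + K * (1/4 * (d - e)^2 * (1/(d*e) - 1))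

noncomputable def VV (T d e : ℝ) : ℝ :=
  EE T (1 - d) (1 - e) 0 0 + 1/4 * (T * (1/d + 1/e - 2) - (1 + T^2) / (2*T) * (d - e)^2 / (d * e))

theorem VV_eq {T d e c : ℝ} (hT : 0 < T) (hd : 0 < d) (he : 0 < e) (hc : c = (1 - T^2) / (1 + T^2)) :
    VV T d e = 1/2 * T * c - T * FF c (1 / (1 - c)) d e := by
  have : 1 - c = 2 * T^2 / (1 + T^2) := by rw [hc]; field_simp; ring
  rw [this, hc]
  unfold VV FF EE
  field_simp
  ring

theorem VV_symm (T d e : ℝ) : VV T d e = VV T e d := by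
  unfold VV EE
  rw [mul_comm d e]
  ring

theorem FF_mono {c c' K K' d e : ℝ} (hd : 0 < d) (hd1 : d ≤ 1) (he : 0 < e) (he1 : e ≤ 1)
    (hc : c ≤ c') (hK : K ≤ K') : FF c K d e ≤ FF c' K' d e := by
  unfold FF
  have p1 : d * e ≤ 1 := by nlinarith
  have p2 : 1 ≤ 1 / (d*e) := by rw [le_div_iff₀ (by positivity)]; linarith
  have := mul_le_mul_of_nonneg_right hK
    (show 0 ≤ 1/4 * (d - e)^2 * (1/(d*e) - 1) from mul_nonneg (by positivity) (by linarith))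
  nlinarith

theorem FF_base {d e : ℝ} (h0 : 0.7268 ≤ d) (h1 : d ≤ 1) (h2 : 0.7268 ≤ e) (h3 : e ≤ 1) :
    0 ≤ FF 0.8 0 d e := by
  unfold FF
  have a : 1/d - 1 ≤ 0.8 * (1 + e) * (1 - d) := by
    rw [show 1/d - 1 = (1 - d)/d by field_simp, div_le_iff₀ (by linarith)]
    nlinarith [mul_nonneg (sub_nonneg.2 h1) (show 0 ≤ 0.8 * (1+e) * d - 1 by nlinarith)]
  have b : 1/e - 1 ≤ 0.8 * (1 + d) * (1 - e) := by
    rw [show 1/e - 1 = (1 - e)/e by field_simp, div_le_iff₀ (by linarith)]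
    nlinarith [mul_nonneg (sub_nonneg.2 h3) (show 0 ≤ 0.8 * (1+d) * e - 1 by nlinarith)]
  nlinarith [sq_nonneg (d-e)]

theorem FF_of_poly {c K m d e : ℝ} (hd : 0 < d) (he : 0 < e)
    (h : 0 ≤ 2*c*(1-d*e)*(d*e) - (d+e-2*(d*e)) + d*e*(d-e)^2 + K*(d-e)^2*(1-d*e) - 4*m*(d*e)) :
    m ≤ FF c K d e := by
  have : FF c K d e - m = (2*c*(1-d*e)*(d*e) - (d+e-2*(d*e)) + d*e*(d-e)^2 + K*(d-e)^2*(1-d*e) - 4*m*(d*e)) / (4*d*e) := by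
    unfold FF; field_simp; ring
  have h2 : 0 ≤ FF c K d e - m := by rw [this]; positivity
  linarith

theorem FF_1 {d e : ℝ} (h0 : 0.7268 ≤ d) (h1 : d ≤ 1) (h2 : 0.7268 ≤ e) (h3 : e ≤ 0.91) :
    0.0085 ≤ FF 0.8348 (12.5 + 156.25 * (0.8348 - 0.92)) d e := by
  apply FF_of_poly (by linarith) (by linarith)
  nlinarith [mul_nonneg (sub_nonneg.2 h0) (sub_nonneg.2 h1), mul_nonneg (sub_nonneg.2 h2) (sub_nonneg.2 h3), mul_nonneg (sub_nonneg.2 h0) (sub_nonneg.2 h2), mul_nonneg (sub_nonneg.2 h1) (sub_nonneg.2 h3), mul_nonneg (sub_nonneg.2 h0) (sub_nonneg.2 h3), mul_nonneg (sub_nonneg.2 h1) (sub_nonneg.2 h2)]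

theorem FF_2 {d e : ℝ} (h0 : 0.7268 ≤ d) (h1 : d ≤ 1) (h2 : 0.7268 ≤ e) (h3 : e ≤ 0.91) :
    0.0183 ≤ FF 0.8822 (12.5 + 156.25 * (0.8822 - 0.92)) d e := by
  apply FF_of_poly (by linarith) (by linarith)
  nlinarith [mul_nonneg (sub_nonneg.2 h0) (sub_nonneg.2 h1), mul_nonneg (sub_nonneg.2 h2) (sub_nonneg.2 h3), mul_nonneg (sub_nonneg.2 h0) (sub_nonneg.2 h2), mul_nonneg (sub_nonneg.2 h1) (sub_nonneg.2 h3), mul_nonneg (sub_nonneg.2 h0) (sub_nonneg.2 h3), mul_nonneg (sub_nonneg.2 h1) (sub_nonneg.2 h2)]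

theorem FF_3 {d e : ℝ} (h0 : 0.7268 ≤ d) (h1 : d ≤ 1) (h2 : 0.7268 ≤ e) (h3 : e ≤ 0.91) :
    0.0273 ≤ FF 1 (12.5 + 156.25 * (1 - 0.92)) d e := by
  apply FF_of_poly (by linarith) (by linarith)
  nlinarith [mul_nonneg (sub_nonneg.2 h0) (sub_nonneg.2 h1), mul_nonneg (sub_nonneg.2 h2) (sub_nonneg.2 h3), mul_nonneg (sub_nonneg.2 h0) (sub_nonneg.2 h2), mul_nonneg (sub_nonneg.2 h1) (sub_nonneg.2 h3), mul_nonneg (sub_nonneg.2 h0) (sub_nonneg.2 h3), mul_nonneg (sub_nonneg.2 h1) (sub_nonneg.2 h2)]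

theorem FF_tan {c d e : ℝ} (hc : c < 1) (hd : 0 < d) (hd1 : d ≤ 1) (he : 0 < e) (he1 : e ≤ 1) :
    FF c (12.5 + 156.25 * (c - 0.92)) d e ≤ FF c (1 / (1 - c)) d e := by
  apply FF_mono hd hd1 he he1 le_rfl
  rw [le_div_iff₀ (by linarith)]
  nlinarith [sq_nonneg (c - 0.92)]

theorem FF_lin (c a b s t d e : ℝ) (hs : s * a + t * b = c) (hst : s + t = 1) :
    FF c (12.5 + 156.25 * (c - 0.92)) d e = s * FF a (12.5 + 156.25 * (a - 0.92)) d e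
      + t * FF b (12.5 + 156.25 * (b - 0.92)) d e := by
  have : s = 1 - t := by linarith
  subst this
  rw [← hs]
  unfold FF
  ring

theorem arctan_ge {T : ℝ} (h0 : 0 ≤ T) (h1 : T ≤ 1) : T - T^3/3 + T^5/5 - T^7/7 ≤ Real.arctan T := by
  refine le_trans ?_ (LL_le_arctan h0)
  unfold LL
  have : T^11 ≤ T^9 := pow_le_pow_of_le_one h0 h1 (by norm_num)
  have : 0 ≤ T^9 := by positivity
  linarith

theorem VV_a {T d e : ℝ} (hT : 0 < T) (h0 : 0.7268 ≤ d) (h1 : d ≤ 1) (h2 : 0.7268 ≤ e) (h3 : e ≤ 1)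
    (hT3 : T ≤ 1/3) : VV T d e ≤ 1/2 * T * ((1 - T^2) / (1 + T^2)) := by
  rw [VV_eq hT (by linarith) (by linarith) rfl]
  set c := (1 - T^2) / (1 + T^2) with hc
  have c1 : 0.8 ≤ c := by rw [hc, le_div_iff₀ (by positivity)]; nlinarith
  have c2 : c < 1 := by rw [hc, div_lt_one (by positivity)]; nlinarith
  have : 0 ≤ FF c (1/(1-c)) d e := (FF_base h0 h1 h2 h3).trans
    (FF_mono (by linarith) h1 (by linarith) h3 c1 (by apply div_nonneg <;> linarith))
  nlinarith

theorem VV_big {T d e : ℝ} (h0 : 0.7268 ≤ d) (h1 : d ≤ 1) (h2 : 0.7268 ≤ e) (h3 : e ≤ 1)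
    (hT3 : 1/3 ≤ T) : VV T d e ≤ 0.012543 + 0.4041 * Real.arctan T - 0.0083 := by
  have hT : 0 < T := by linarith
  rw [VV_eq hT (by linarith) (by linarith) rfl]
  set c := (1 - T^2) / (1 + T^2) with hc
  have c1 : c ≤ 0.8 := by rw [hc, div_le_iff₀ (by positivity)]; nlinarith
  have c2 : c < 1 := by linarith
  have k : FF c 0 d e ≤ FF c (1/(1-c)) d e :=
    FF_mono (by linarith) h1 (by linarith) h3 le_rfl (by apply div_nonneg <;> linarith)
  have k2 : FF c 0 d e = FF 0.8 0 d e - 1/2 * (0.8 - c) * (1 - d*e) := by unfold FF; ring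
  have k3 : 1 - d*e ≤ 0.472 := by nlinarith
  have k4 : -(0.236 * (0.8 - c)) ≤ FF c (1/(1-c)) d e := by
    have := FF_base h0 h1 h2 h3
    nlinarith
  have k5 : 1/2 * T * c - T * FF c (1/(1-c)) d e ≤ T * (0.1888 + 0.264 * c) := by nlinarith
  refine k5.trans ?_
  have hq : 0 < 1 + T^2 := by positivity
  have hcq : c * (1 + T^2) = 1 - T^2 := by rw [hc]; field_simp
  suffices h : T * (0.1888 * (1 + T^2) + 0.264 * (1 - T^2)) ≤ (0.012543 + 0.4041 * Real.arctan T - 0.0083) * (1 + T^2) by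
    rw [← hcq] at h
    refine le_of_mul_le_mul_right (le_trans (le_of_eq ?_) h) hq
    ring
  rcases le_total T 0.6 with h | h
  · have := s1e (T := T) (by norm_num; linarith) h
    have a := arctan_ge hT.le (by linarith)
    nlinarith
  · have a : (0.5395:ℝ) ≤ Real.arctan 0.6 := le_trans (by norm_num) (arctan_ge (T := 0.6) (by norm_num) (by norm_num))
    have b := Real.arctan_mono h
    have : 0.2222 ≤ 0.012543 + 0.4041 * Real.arctan T - 0.0083 := by linarith
    nlinarith [mul_nonneg (sub_nonneg.2 this) hq.le, mul_nonneg hT.le (sq_nonneg (T - 1)), sq_nonneg (T-1), mul_nonneg hT.le (mul_nonneg hT.le (sub_nonneg.2 h))]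

theorem VV_le {T d e : ℝ} (hT : 0 < T) (h0 : 0.7268 ≤ d) (h1 : d ≤ 1) (h2 : 0.7268 ≤ e) (h3 : e ≤ 1) :
    VV T d e ≤ 0.012543 + 0.4041 * Real.arctan T := by
  rcases le_total T (1/3) with h | h
  · refine (VV_a hT h0 h1 h2 h3 h).trans ?_
    have := s1a hT.le (by linarith)
    have a := arctan_ge hT.le (by linarith)
    rw [← mul_div_assoc, div_le_iff₀ (by positivity)]
    nlinarith [mul_nonneg (sub_nonneg.2 a) (show 0 ≤ 1 + T^2 by positivity)]
  · linarith [VV_big h0 h1 h2 h3 h]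

theorem VV_bad {T d e : ℝ} (hT : 0 < T) (h0 : 0.7268 ≤ d) (h1 : d ≤ 1) (h2 : 0.7268 ≤ e) (h3 : e ≤ 0.91) :
    VV T d e ≤ 0.012543 + 0.4041 * Real.arctan T - 0.0041172 := by
  have hq : 0 < 1 + T^2 := by positivity
  rcases le_total (1/3) T with h | h
  · linarith [VV_big h0 h1 h2 (by linarith) h]
  have a := arctan_ge hT.le (by linarith)
  have a' := mul_nonneg (sub_nonneg.2 a) hq.le
  rcases le_total 0.3 T with g | g
  · refine (VV_a hT h0 h1 h2 (by linarith) h).trans ?_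
    have := s1d g (by linarith)
    rw [← mul_div_assoc, div_le_iff₀ hq]
    nlinarith
  rw [VV_eq hT (by linarith) (by linarith) rfl]
  set c := (1 - T^2) / (1 + T^2) with hc
  have c2 : c < 1 := by rw [hc, div_lt_one (by positivity)]; nlinarith
  have hcq : 1 - T^2 = c * (1 + T^2) := by rw [hc]; field_simp
  have k := FF_tan c2 (show 0 < d by linarith) h1 (show 0 < e by linarith) (by linarith)
  have f1 := FF_1 h0 h1 h2 h3
  have f2 := FF_2 h0 h1 h2 h3
  have f3 := FF_3 h0 h1 h2 h3
  refine le_of_mul_le_mul_right ?_ hq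
  rcases le_total 0.8822 c with c1 | c1
  · have u : T ≤ 0.251 := by
      by_contra hh
      have : c < 0.8822 := by rw [hc, div_lt_iff₀ hq]; nlinarith
      linarith
    have l := FF_lin c 0.8822 1 ((1 - c)/0.1178) ((c - 0.8822)/0.1178) d e (by ring) (by ring)
    have z := s1b hT.le u
    have y : 0.0183 + 0.009/0.1178*(c - 0.8822) ≤ FF c (1/(1-c)) d e := by
      refine le_trans ?_ k
      rw [l]
      generalize FF 0.8822 _ d e = A at *
      generalize FF 1 _ d e = B at *
      linear_combination (1/0.1178) * mul_nonneg (sub_nonneg.2 f2) (sub_nonneg.2 c2.le) + (1/0.1178) * mul_nonneg (sub_nonneg.2 f3) (sub_nonneg.2 c1)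
    have y' := mul_nonneg (mul_nonneg hT.le (sub_nonneg.2 y)) hq.le
    rw [hcq] at z
    generalize FF c (1/(1-c)) d e = A at *
    linarith
  · have u : 0.25 ≤ T := by
      by_contra hh
      have : 0.8822 < c := by rw [hc, lt_div_iff₀ hq]; nlinarith
      linarith
    have c0 : 0.8348 ≤ c := by rw [hc, le_div_iff₀ (by positivity)]; nlinarith
    have l := FF_lin c 0.8348 0.8822 ((0.8822 - c)/0.0474) ((c - 0.8348)/0.0474) d e (by ring) (by ring)
    have z := s1c u g
    have y : 0.0085 + 0.0098/0.0474*(c - 0.8348) ≤ FF c (1/(1-c)) d e := by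
      refine le_trans ?_ k
      rw [l]
      generalize FF 0.8822 _ d e = A at *
      generalize FF 0.8348 _ d e = B at *
      linear_combination (1/0.0474) * mul_nonneg (sub_nonneg.2 f2) (sub_nonneg.2 c0) + (1/0.0474) * mul_nonneg (sub_nonneg.2 f1) (sub_nonneg.2 c1)
    have y' := mul_nonneg (mul_nonneg hT.le (sub_nonneg.2 y)) hq.le
    rw [hcq] at z
    generalize FF c (1/(1-c)) d e = A at *
    linarith

end Oct



namespace Oct
open Real

noncomputable def Lw (T d e : ℝ) : ℝ := (1 - d) * ((1 + T^2) / (2*T) / e - (1 - T^2) / (2*T) / d)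

theorem Lw_add {T d e : ℝ} (hT : 0 < T) (hd : 0 < d) (he : 0 < e) :
    Lw T e d + Lw T d e = T * (1/d + 1/e - 2) - (1 + T^2) / (2*T) * (d - e)^2 / (d * e) := by
  unfold Lw
  field_simp
  ring

theorem chordz {m : ℕ} {T d : ℕ → ℝ} (hT : ∀ k, k < m → 0 < T k) (hT1 : T m = T 0)
    (h0 : ∀ k, k ≤ m + 1 → 0 < d k) (h1 : ∀ k, k ≤ m + 1 → d k ≤ 1) (hd : d m = d 0) (hd1 : d (m+1) = d 1)
    (H : ∀ k, k < m → ((1 - T k^2) / (2 * T k) + (1 - T (k+1)^2) / (2 * T (k+1))) / d (k+1) ≤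
      (1 + T k^2) / (2 * T k) / d k + (1 + T (k+1)^2) / (2 * T (k+1)) / d (k+2)) :
    0 ≤ ∑ k ∈ Finset.range m, (T k * (1/d k + 1/d (k+1) - 2) -
      (1 + T k^2) / (2*T k) * (d k - d (k+1))^2 / (d k * d (k+1))) := by
  have e : ∀ k ∈ Finset.range m, (T k * (1/d k + 1/d (k+1) - 2) -
      (1 + T k^2) / (2*T k) * (d k - d (k+1))^2 / (d k * d (k+1))) =
      Lw (T k) (d (k+1)) (d k) + Lw (T k) (d k) (d (k+1)) := by
    intro k hk
    have hk := Finset.mem_range.1 hk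
    rw [Lw_add (hT k hk) (h0 k (by omega)) (h0 (k+1) (by omega))]
  rw [Finset.sum_congr rfl e, Finset.sum_add_distrib]
  have tel := Finset.sum_range_sub (fun k => Lw (T k) (d k) (d (k+1))) m
  rw [Finset.sum_sub_distrib] at tel
  simp only [hT1, hd, hd1, zero_add, sub_self] at tel
  have : ∑ k ∈ Finset.range m, Lw (T k) (d k) (d (k+1)) =
    ∑ k ∈ Finset.range m, Lw (T (k+1)) (d (k+1)) (d (k+1+1)) := by linarith
  rw [this, ← Finset.sum_add_distrib]
  apply Finset.sum_nonneg
  intro k hk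
  have hk := Finset.mem_range.1 hk
  have := H k hk
  unfold Lw
  rw [← mul_add]
  apply mul_nonneg (by linarith [h1 (k+1) (by omega)])
  rw [add_div] at this
  linarith

set_option maxHeartbeats 1000000 in
theorem abstract_bound {A : ℝ} {m : ℕ} (hm : m ≤ 8) {X Y d θ : ℕ → ℝ} {s : ℕ → ℤ}
    (hX : X m = X 0) (hY : Y m = Y 0)
    (hθ : θ m = θ 0 + π) (hθ1 : θ (m+1) = θ 1 + π) (hd : d m = d 0) (hd1 : d (m+1) = d 1)
    (hs : ∀ k < m, θ k < θ (k+1) ∧ θ (k+1) < θ k + π)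
    (hσ : ∀ k < m, s k = 1 ∨ s k = -1)
    (hdX : ∀ k < m, X (k+1) - X k = s k / 2 * (d (k+1) * cos (θ (k+1)) - d k * cos (θ k)))
    (hdY : ∀ k < m, Y (k+1) - Y k = s k / 2 * (d (k+1) * sin (θ (k+1)) - d k * sin (θ k)))
    (hlo : ∀ k, k < m → 0.7268 ≤ d k) (hhi : ∀ k, k < m → d k ≤ 1)
    (hch : ∀ k < m, 0 ≤ d (k+1) * d (k+2) * sin (θ (k+2) - θ (k+1)) + d k * d (k+1) * sin (θ (k+1) - θ k)
      - d k * d (k+2) * sin (θ (k+2) - θ k))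
    (hA : A ≤ ∑ k ∈ Finset.range m, (d k * d (k+1) * sin (θ (k+1) - θ k) / 4 + (X k * Y (k+1) - Y k * X (k+1)))) :
    A ≤ 0.72686849 := by
  have hm1 : 1 < m := by
    rcases m with _ | _ | m
    · simp at hθ
    · have := hs 0 (by norm_num)
      simp at hθ this
      linarith
    · omega
  have hlo' : ∀ k, k ≤ m + 1 → 0.7268 ≤ d k := by
    intro k hk
    rcases Nat.lt_or_ge k m with h | h
    · exact hlo k h
    · obtain rfl | rfl : k = m ∨ k = m + 1 := by omega
      · rw [hd]; exact hlo 0 (by omega)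
      · rw [hd1]; exact hlo 1 (by omega)
  have hhi' : ∀ k, k ≤ m + 1 → d k ≤ 1 := by
    intro k hk
    rcases Nat.lt_or_ge k m with h | h
    · exact hhi k h
    · obtain rfl | rfl : k = m ∨ k = m + 1 := by omega
      · rw [hd]; exact hhi 0 (by omega)
      · rw [hd1]; exact hhi 1 (by omega)
  set T : ℕ → ℝ := fun k => tan ((θ (k+1) - θ k)/2) with hT
  have hTm : T m = T 0 := by simp only [hT, hθ, hθ1, zero_add]; ring_nf
  have hht : ∀ k, k < m → 0 < T k ∧ 2 * arctan (T k) = θ (k+1) - θ k := by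
    intro k hk
    obtain ⟨a, -, -, b⟩ := half_tan (p := θ (k+1) - θ k) (by linarith [hs k hk]) (by linarith [hs k hk])
    exact ⟨a, b⟩
  have hsum : ∑ k ∈ Finset.range m, 2 * arctan (T k) = π := by
    rw [Finset.sum_congr rfl (fun k hk => (hht k (Finset.mem_range.1 hk)).2), Finset.sum_range_sub, hθ]
    ring
  have hs' : ∀ k ≤ m, θ k < θ (k+1) ∧ θ (k+1) < θ k + π := by
    intro k hk
    rcases Nat.lt_or_ge k m with h | h
    · exact hs k h
    · obtain rfl : k = m := by omega
      rw [hθ, hθ1]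
      have := hs 0 (by omega)
      simp only [zero_add] at this
      constructor <;> linarith
  have H : ∀ k, k < m → ((1 - T k^2) / (2 * T k) + (1 - T (k+1)^2) / (2 * T (k+1))) / d (k+1) ≤
      (1 + T k^2) / (2 * T k) / d k + (1 + T (k+1)^2) / (2 * T (k+1)) / d (k+2) := by
    intro k hk
    have a := hs' k (by omega)
    have b := hs' (k+1) (by omega)
    apply chord_trig (p := θ (k+1) - θ k) (p' := θ (k+1+1) - θ (k+1)) (by linarith) (by linarith) (by linarith) (by linarith)
    · linarith [hlo' k (by omega)]
    · linarith [hlo' (k+1) (by omega)]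
    · linarith [hlo' (k+2) (by omega)]
    · have := hch k hk
      rw [show θ (k+1) - θ k + (θ (k+1+1) - θ (k+1)) = θ (k+2) - θ k by ring]
      exact this
  have hsq : ∀ k < m, (s k : ℝ)^2 = 1 := by
    intro k hk; rcases hσ k hk with h | h <;> rw [h] <;> norm_num
  have NB := fun (τ : ℕ → ℝ) (hτ : τ m = - τ 0) =>
    hA.trans (node_bound (σ := fun k => (s k : ℝ)) hX hY hθ hs hsq hdX hdY hτ)
  by_contra hcon
  push Not at hcon
  have hch1 := chordz (fun k hk => (hht k hk).1) hTm (fun k hk => by linarith [hlo' k hk]) hhi' hd hd1 H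
  have hV : A ≤ ∑ k ∈ Finset.range m, VV (T k) (d k) (d (k+1)) := by
    have := NB (fun _ => 0) (by simp)
    simp only [mul_zero] at this
    unfold VV
    rw [Finset.sum_add_distrib, ← Finset.mul_sum]
    linarith
  have hlin : ∀ k ∈ Finset.range m, VV (T k) (d k) (d (k+1)) ≤ 0.012543 + 0.4041 * arctan (T k) := by
    intro k hk
    have hk := Finset.mem_range.1 hk
    exact VV_le (hht k hk).1 (hlo' k (by omega)) (hhi' k (by omega)) (hlo' (k+1) (by omega)) (hhi' (k+1) (by omega))
  have hlinsum : ∑ k ∈ Finset.range m, (0.012543 + 0.4041 * arctan (T k)) = m * 0.012543 + 0.20205 * π := by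
    rw [← hsum, Finset.sum_add_distrib, Finset.mul_sum]
    simp only [Finset.sum_const, Finset.card_range, nsmul_eq_mul]
    congr 1
    apply Finset.sum_congr rfl
    intros; ring
  have hpi := Real.pi_lt_d20
  have hm8 : m = 8 := by
    by_contra hne
    have h7 : (m:ℝ) ≤ 7 := by exact_mod_cast (show m ≤ 7 by omega)
    have := hV.trans (Finset.sum_le_sum hlin)
    rw [hlinsum] at this
    nlinarith
  subst hm8
  simp only [Finset.sum_range_succ, Finset.sum_range_zero, Nat.reduceAdd, zero_add] at hV hlinsum
  have hl : ∀ k, k < 8 → VV (T k) (d k) (d (k+1)) ≤ 0.012543 + 0.4041 * arctan (T k) :=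
    fun k hk => hlin k (Finset.mem_range.2 hk)
  have l0 := hl 0 (by norm_num)
  have l1 := hl 1 (by norm_num)
  have l2 := hl 2 (by norm_num)
  have l3 := hl 3 (by norm_num)
  have l4 := hl 4 (by norm_num)
  have l5 := hl 5 (by norm_num)
  have l6 := hl 6 (by norm_num)
  have l7 := hl 7 (by norm_num)
  norm_num only at l0 l1 l2 l3 l4 l5 l6 l7
  -- no angle is large
  have hTs : ∀ k, k < 8 → T k ≤ 1/2 := by
    intro k hk
    by_contra hh
    push Not at hh
    have b := VV_big (hlo' k (by omega)) (hhi' k (by omega)) (hlo' (k+1) (by omega)) (hhi' (k+1) (by omega)) (show 1/3 ≤ T k by linarith)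
    interval_cases k <;> norm_num only at b <;> linarith
  -- no node is short
  have bl : ∀ k, k < 8 → d k ≤ 0.91 → VV (T k) (d k) (d (k+1)) ≤ 0.012543 + 0.4041 * arctan (T k) - 0.0041172 := by
    intro k hk h
    rw [VV_symm]
    exact VV_bad (hht k hk).1 (hlo' (k+1) (by omega)) (hhi' (k+1) (by omega)) (hlo' k (by omega)) h
  have br : ∀ k, k < 8 → d (k+1) ≤ 0.91 → VV (T k) (d k) (d (k+1)) ≤ 0.012543 + 0.4041 * arctan (T k) - 0.0041172 := by
    intro k hk h
    exact VV_bad (hht k hk).1 (hlo' k (by omega)) (hhi' k (by omega)) (hlo' (k+1) (by omega)) h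
  have hd91 : ∀ k, k < 8 → 0.91 ≤ d k := by
    intro k hk
    by_contra hh
    push Not at hh
    have b := bl k hk hh.le
    rcases k with _ | k
    · have c := br 7 (by norm_num) (by rw [show 7 + 1 = 8 from rfl, hd]; exact hh.le)
      norm_num only at b c
      linarith
    · have c := br k (by omega) hh.le
      have hk7 : k < 7 := by omega
      interval_cases k <;> norm_num only at b c <;> linarith
  -- final step
  have hk1 : ∀ k : Fin 8, d ((k + 1 : Fin 8) : ℕ) = d ((k:ℕ) + 1) := by
    intro k; fin_cases k <;> simp [hd]
  have hk2 : ∀ k : Fin 8, d ((k + 1 + 1 : Fin 8) : ℕ) = d ((k:ℕ) + 2) := by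
    intro k; fin_cases k <;> simp [hd, hd1]
  have hk3 : ∀ k : Fin 8, T ((k + 1 : Fin 8) : ℕ) = T ((k:ℕ) + 1) := by
    intro k; fin_cases k <;> simp [hTm]
  have S : Sys A (fun k : Fin 8 => T k) (fun k : Fin 8 => 1 - d k)
      (fun k : Fin 8 => if k = 0 then - s 0 * s 7 else s (k - 1 : Fin 8) * s k) := by
    refine ⟨fun k => (hht k k.2).1, ?_, ?_, ?_⟩
    · rw [← hsum, Finset.sum_range]
    · intro be
      have := NB (fun k => match k with
        | 0 => - (s 7 * be 0) | 1 => s 0 * be 1 | 2 => s 1 * be 2 | 3 => s 2 * be 3 | 4 => s 3 * be 4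
        | 5 => s 4 * be 5 | 6 => s 5 * be 6 | 7 => s 6 * be 7 | _ => s 7 * be 0) (by simp)
      refine this.trans (le_of_eq ?_)
      rw [Finset.sum_range]
      apply Finset.sum_congr rfl
      intro k _
      rw [hk1]
      have q := hsq k k.2
      congr 1
      · fin_cases k <;> simp <;> ring
      · fin_cases k <;> simp only [Fin.zero_eta, Fin.mk_one, Fin.reduceFinMk, Fin.reduceAdd] at q ⊢ <;> (rw [← mul_assoc, ← sq]; erw [q]; simp)
    · apply chord_sum (fun k : Fin 8 => (hht k k.2).1) (fun k => hd91 k k.2) (fun k => hhi k k.2)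
      intro k
      rw [hk1, hk2, hk3]
      exact H k k.2
  refine absurd (core S ?_ ?_ (fun k => hTs k k.2) (fun k => ⟨?_, ?_⟩)) (not_le.2 hcon)
  · intro k
    have h0 := hσ 0 (by norm_num)
    have h1 := hσ 1 (by norm_num)
    have h2 := hσ 2 (by norm_num)
    have h3 := hσ 3 (by norm_num)
    have h4 := hσ 4 (by norm_num)
    have h5 := hσ 5 (by norm_num)
    have h6 := hσ 6 (by norm_num)
    have h7 := hσ 7 (by norm_num)
    have mulpm : ∀ a b : ℤ, (a = 1 ∨ a = -1) → (b = 1 ∨ b = -1) → (a * b = 1 ∨ a * b = -1) := by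
      rintro a b (rfl | rfl) (rfl | rfl) <;> norm_num
    have h0' : - s 0 = 1 ∨ - s 0 = -1 := by omega
    fin_cases k
    · exact mulpm _ _ h0' h7
    · exact mulpm _ _ h0 h1
    · exact mulpm _ _ h1 h2
    · exact mulpm _ _ h2 h3
    · exact mulpm _ _ h3 h4
    · exact mulpm _ _ h4 h5
    · exact mulpm _ _ h5 h6
    · exact mulpm _ _ h6 h7
  · have hz : ∀ k < 8, s k * s k = 1 := by
      intro k hk; rcases hσ k hk with h | h <;> rw [h] <;> norm_num
    have e : ∏ k : Fin 8, (if k = 0 then - s 0 * s 7 else s (k - 1 : Fin 8) * s k) =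
      - ((s 0 * s 0) * (s 1 * s 1) * (s 2 * s 2) * (s 3 * s 3) * (s 4 * s 4) * (s 5 * s 5) * (s 6 * s 6) * (s 7 * s 7)) := by
      rw [Fin.prod_univ_eight]
      have : ∀ i : Fin 8, ((if i = 0 then - s 0 * s 7 else s (i - 1 : Fin 8) * s i : ℤ)) = if i = 0 then - s 0 * s 7 else s ((i:ℕ) - 1) * s i := by
        intro i; fin_cases i <;> rfl
      simp only [this]
      simp
      ring
    rw [e, hz 0 (by norm_num), hz 1 (by norm_num), hz 2 (by norm_num), hz 3 (by norm_num), hz 4 (by norm_num), hz 5 (by norm_num), hz 6 (by norm_num), hz 7 (by norm_num)]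
    norm_num
  · linarith [hhi k k.2]
  · linarith [hd91 k k.2]

end Oct


namespace Oct

/-- Linear functional in direction `(1,s)`. -/
def val (s : ℝ) (z : ℂ) : ℝ := z.re + s * z.im

def Inv (P : Finset ℂ) (p : ℂ × ℂ × ℝ) : Prop :=
  p.1 ∈ P ∧ p.2.1 ∈ P ∧ ∀ z ∈ P, val p.2.2 z ≤ val p.2.2 p.1 ∧ val p.2.2 p.2.1 ≤ val p.2.2 z

def Step (P : Finset ℂ) (p q : ℂ × ℂ × ℝ) : Prop :=
  p.2.2 ≤ q.2.2 ∧ Inv P q ∧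
  ((q.2.1 = p.2.1 ∧ p.1.im < q.1.im ∧ val q.2.2 q.1 = val q.2.2 p.1) ∨
   (q.1 = p.1 ∧ q.2.1.im < p.2.1.im ∧ val q.2.2 q.2.1 = val q.2.2 p.2.1))

noncomputable def meas (P : Finset ℂ) (p : ℂ × ℂ × ℝ) : ℕ :=
  (P.filter (fun z => p.1.im < z.im)).card + (P.filter (fun z => z.im < p.2.1.im)).card

noncomputable def slp (a z : ℂ) : ℝ := (a.re - z.re) / (z.im - a.im)

theorem val_slp {a z : ℂ} (h : a.im ≠ z.im) : val (slp a z) z = val (slp a z) a := by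
  have : z.im - a.im ≠ 0 := sub_ne_zero.2 h.symm
  unfold val slp
  field_simp
  ring

theorem le_slp {s : ℝ} {a z : ℂ} (h : a.im < z.im) : s ≤ slp a z ↔ val s z ≤ val s a := by
  unfold val slp
  rw [le_div_iff₀ (by linarith)]
  constructor <;> intro h <;> linarith

theorem le_slp' {s : ℝ} {b z : ℂ} (h : z.im < b.im) : s ≤ slp b z ↔ val s b ≤ val s z := by
  unfold val slp
  rw [le_div_iff_of_neg (by linarith)]
  constructor <;> intro h <;> linarith

theorem val_mono_im {s t : ℝ} {a z : ℂ} (hst : s ≤ t) (h : a.im ≤ z.im) (hv : val t z ≤ val t a) :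
    val s z ≤ val s a := by
  unfold val at *
  nlinarith

theorem inv_next {P : Finset ℂ} {a b : ℂ} {s t : ℝ} (hI : Inv P (a, b, s)) (hst : s ≤ t)
    (ha : ∀ z ∈ P, a.im < z.im → t ≤ slp a z) (hb : ∀ z ∈ P, z.im < b.im → t ≤ slp b z) :
    Inv P (a, b, t) := by
  obtain ⟨h1, h2, h3⟩ := hI
  refine ⟨h1, h2, fun z hz => ⟨?_, ?_⟩⟩
  · rcases lt_or_ge a.im z.im with h | h
    · exact (le_slp h).1 (ha z hz h)
    · have := (h3 z hz).1
      simp only [val] at this ⊢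
      nlinarith
  · rcases lt_or_ge z.im b.im with h | h
    · exact (le_slp' h).1 (hb z hz h)
    · have := (h3 z hz).2
      simp only [val] at this ⊢
      nlinarith

theorem exists_step {P : Finset ℂ} {p : ℂ × ℂ × ℝ} (hI : Inv P p) (hm : meas P p ≠ 0) :
    ∃ q, Step P p q ∧ meas P q < meas P p := by
  classical
  obtain ⟨a, b, s⟩ := p
  set Ca := P.filter (fun z => a.im < z.im) with hCa
  set Cb := P.filter (fun z => z.im < b.im) with hCb
  set C := Ca.image (slp a) ∪ Cb.image (slp b) with hC
  have hne : C.Nonempty := by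
    rw [Finset.nonempty_iff_ne_empty]
    intro h
    rw [hC, Finset.union_eq_empty, Finset.image_eq_empty, Finset.image_eq_empty] at h
    apply hm
    simp only [meas]
    rw [← hCa, ← hCb, h.1, h.2]; rfl
  set t := C.min' hne with ht
  have htm : t ∈ C := Finset.min'_mem _ _
  have ha : ∀ z ∈ P, a.im < z.im → t ≤ slp a z := fun z hz h =>
    Finset.min'_le _ _ (Finset.mem_union_left _ (Finset.mem_image_of_mem _ (Finset.mem_filter.2 ⟨hz, h⟩)))
  have hb : ∀ z ∈ P, z.im < b.im → t ≤ slp b z := fun z hz h =>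
    Finset.min'_le _ _ (Finset.mem_union_right _ (Finset.mem_image_of_mem _ (Finset.mem_filter.2 ⟨hz, h⟩)))
  rcases Finset.mem_union.1 htm with h | h
  · obtain ⟨z, hz, hzt⟩ := Finset.mem_image.1 h
    obtain ⟨hzP, hza⟩ := Finset.mem_filter.1 hz
    have hst : s ≤ t := by rw [← hzt, le_slp hza]; exact (hI.2.2 z hzP).1
    have hJ := inv_next hI hst ha hb
    have hv : val t z = val t a := by rw [← hzt]; exact val_slp hza.ne
    refine ⟨(z, b, t), ⟨hst, ⟨hzP, hJ.2.1, fun w hw => ?_⟩, Or.inl ⟨rfl, hza, hv⟩⟩, ?_⟩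
    · have := hJ.2.2 w hw
      simp only at this ⊢
      rwa [hv]
    · simp only [meas]
      apply Nat.add_lt_add_right
      apply Finset.card_lt_card
      refine (Finset.ssubset_iff_of_subset ?_).2 ⟨z, hz, by simp⟩
      intro w hw
      rw [Finset.mem_filter] at hw ⊢
      exact ⟨hw.1, hza.trans hw.2⟩
  · obtain ⟨z, hz, hzt⟩ := Finset.mem_image.1 h
    obtain ⟨hzP, hza⟩ := Finset.mem_filter.1 hz
    have hst : s ≤ t := by rw [← hzt, le_slp' hza]; exact (hI.2.2 z hzP).2
    have hJ := inv_next hI hst ha hb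
    have hv : val t z = val t b := by rw [← hzt]; exact val_slp hza.ne'
    refine ⟨(a, z, t), ⟨hst, ⟨hJ.1, hzP, fun w hw => ?_⟩, Or.inr ⟨rfl, hza, hv⟩⟩, ?_⟩
    · have := hJ.2.2 w hw
      simp only at this ⊢
      rwa [hv]
    · simp only [meas]
      apply Nat.add_lt_add_left
      apply Finset.card_lt_card
      refine (Finset.ssubset_iff_of_subset ?_).2 ⟨z, hz, by simp⟩
      intro w hw
      rw [Finset.mem_filter] at hw ⊢
      exact ⟨hw.1, hw.2.trans hza⟩

theorem exists_path (P : Finset ℂ) : ∀ (n : ℕ) (p : ℂ × ℂ × ℝ), Inv P p → meas P p = n →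
    ∃ (m : ℕ) (f : ℕ → ℂ × ℂ × ℝ), f 0 = p ∧ meas P (f m) = 0 ∧ ∀ k < m, Step P (f k) (f (k+1)) := by
  intro n
  induction n using Nat.strong_induction_on with
  | _ n ih =>
    intro p hI hn
    rcases Nat.eq_zero_or_pos n with h0 | h0
    · exact ⟨0, fun _ => p, rfl, by show meas P p = 0; omega, fun k hk => by omega⟩
    · obtain ⟨q, hq, hlt⟩ := exists_step hI (by omega)
      obtain ⟨m, f, f0, fm, fs⟩ := ih (meas P q) (by omega) q hq.2.1 rfl
      refine ⟨m + 1, fun k => Nat.casesOn k p f, rfl, fm, ?_⟩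
      intro k hk
      rcases k with _ | k
      · simpa [f0] using hq
      · exact fs k (by omega)

/-- Full turn of the calipers. -/
theorem calipers (P : Finset ℂ) (hne : P.Nonempty) :
    ∃ (m : ℕ) (a b : ℕ → ℂ) (s : ℕ → ℝ), (∀ k < m, s k ≤ s (k+1)) ∧
    (∀ k ≤ m, a k ∈ P ∧ b k ∈ P) ∧
    (∀ z ∈ P, (a 0).im ≤ z.im ∧ z.im ≤ (b 0).im ∧ z.im ≤ (a m).im ∧ (b m).im ≤ z.im) ∧
    (∀ k ≤ m, ∀ z ∈ P, val (s k) z ≤ val (s k) (a k) ∧ val (s k) (b k) ≤ val (s k) z) ∧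
    (∀ k < m, (b (k+1) = b k ∧ (a k).im < (a (k+1)).im ∧ val (s (k+1)) (a (k+1)) = val (s (k+1)) (a k)) ∨
      (a (k+1) = a k ∧ (b (k+1)).im < (b k).im ∧ val (s (k+1)) (b (k+1)) = val (s (k+1)) (b k))) := by
  classical
  -- a very negative slope
  obtain ⟨s, hs⟩ : ∃ s : ℝ, ∀ z ∈ P, ∀ w ∈ P, z.im < w.im → s < slp z w := by
    obtain ⟨s, hs⟩ := (Finset.bddBelow ((P ×ˢ P).image (fun x => slp x.1 x.2)))
    refine ⟨s - 1, fun z hz w hw _ => ?_⟩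
    have := hs (Finset.mem_coe.2 (Finset.mem_image_of_mem (fun x : ℂ × ℂ => slp x.1 x.2) (Finset.mk_mem_product hz hw)))
    simp only at this
    linarith
  obtain ⟨L, hL, hLm⟩ := P.exists_max_image (val s) hne
  obtain ⟨R, hR, hRm⟩ := P.exists_min_image (val s) hne
  have hI : Inv P (L, R, s) := ⟨hL, hR, fun z hz => ⟨hLm z hz, hRm z hz⟩⟩
  have hL0 : ∀ z ∈ P, L.im ≤ z.im := by
    intro z hz
    by_contra h
    push Not at h
    have h1 := hs z hz L hL h
    have h2 := hLm z hz
    unfold slp val at *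
    rw [lt_div_iff₀ (by linarith)] at h1
    linarith
  have hR0 : ∀ z ∈ P, z.im ≤ R.im := by
    intro z hz
    by_contra h
    push Not at h
    have h1 := hs R hR z hz h
    have h2 := hRm z hz
    unfold slp val at *
    rw [lt_div_iff₀ (by linarith)] at h1
    linarith
  obtain ⟨m, f, f0, fm, fs⟩ := exists_path P _ _ hI rfl
  have hInv : ∀ k ≤ m, Inv P (f k) := by
    intro k hk
    rcases k with _ | k
    · rw [f0]; exact hI
    · exact (fs k (by omega)).2.1
  refine ⟨m, fun k => (f k).1, fun k => (f k).2.1, fun k => (f k).2.2, fun k hk => (fs k hk).1,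
    fun k hk => ⟨(hInv k hk).1, (hInv k hk).2.1⟩, ?_, fun k hk => (hInv k hk).2.2, fun k hk => (fs k hk).2.2⟩
  intro z hz
  simp only [f0]
  refine ⟨hL0 z hz, hR0 z hz, ?_, ?_⟩
  · by_contra h
    push Not at h
    unfold meas at fm
    have : z ∈ P.filter (fun z => (f m).1.im < z.im) := Finset.mem_filter.2 ⟨hz, h⟩
    have hc := Finset.card_pos.2 ⟨z, this⟩
    omega
  · by_contra h
    push Not at h
    unfold meas at fm
    have : z ∈ P.filter (fun z => z.im < (f m).2.1.im) := Finset.mem_filter.2 ⟨hz, h⟩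
    have hc := Finset.card_pos.2 ⟨z, this⟩
    omega

end Oct


namespace Oct
open MeasureTheory

theorem volume_complex (S : Set (ℝ × ℝ)) (hS : MeasurableSet S) :
    volume {z : ℂ | (z.re, z.im) ∈ S} = volume S := by
  have := Complex.volume_preserving_equiv_real_prod.measure_preimage hS.nullMeasurableSet
  rw [← this]
  rfl

/-- Trapezoid term. -/
noncomputable def trap (z w : ℂ) : ℝ := (z.re + w.re) / 2 * (w.im - z.im)

theorem int_line (c s y y' : ℝ) : ∫ v in y..y', (c - s * v) = c * (y' - y) - s * (y'^2 - y^2)/2 := by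
  rw [intervalIntegral.integral_sub (by simp) (by apply Continuous.intervalIntegrable; fun_prop)]
  rw [intervalIntegral.integral_const_mul, integral_id]
  simp
  ring

/-- Area of a region between two continuous curves. -/
theorem between_area {l r : ℝ → ℝ} (hl : Continuous l) (hr : Continuous r) {v0 v1 : ℝ} (hv : v0 ≤ v1)
    (hlr : ∀ v, v0 ≤ v → v ≤ v1 → l v ≤ r v) :
    volume {z : ℂ | v0 ≤ z.im ∧ z.im ≤ v1 ∧ l z.im ≤ z.re ∧ z.re ≤ r z.im} =
      ENNReal.ofReal ((∫ v in v0..v1, r v) - ∫ v in v0..v1, l v) := by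
  set S : Set (ℝ × ℝ) := {p | v0 ≤ p.2 ∧ p.2 ≤ v1 ∧ l p.2 ≤ p.1 ∧ p.1 ≤ r p.2} with hS
  have hc : IsClosed S := by
    have e : S = {p : ℝ × ℝ | v0 ≤ p.2} ∩ ({p | p.2 ≤ v1} ∩ ({p | l p.2 ≤ p.1} ∩ {p | p.1 ≤ r p.2})) := by
      ext p; rfl
    rw [e]
    exact (isClosed_le (by fun_prop) (by fun_prop)).inter ((isClosed_le (by fun_prop) (by fun_prop)).inter
      ((isClosed_le (by fun_prop) (by fun_prop)).inter (isClosed_le (by fun_prop) (by fun_prop))))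
  have h1 := volume_complex S hc.measurableSet
  have h2 : {z : ℂ | v0 ≤ z.im ∧ z.im ≤ v1 ∧ l z.im ≤ z.re ∧ z.re ≤ r z.im} = {z : ℂ | (z.re, z.im) ∈ S} := rfl
  rw [h2, h1, Measure.volume_eq_prod, Measure.prod_apply_symm hc.measurableSet]
  have h3 : ∀ y : ℝ, volume ((fun x => (x, y)) ⁻¹' S) =
      (Set.Icc v0 v1).indicator (fun y => ENNReal.ofReal (r y - l y)) y := by
    intro y
    by_cases hy : y ∈ Set.Icc v0 v1
    · rw [Set.indicator_of_mem hy, ← Real.volume_Icc]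
      congr 1
      ext x
      simp [hS, hy.1, hy.2]
    · rw [Set.indicator_of_notMem hy]
      convert measure_empty (μ := volume)
      ext x
      simp only [hS, Set.mem_preimage, Set.mem_ofPred_eq, Set.mem_empty_iff_false, iff_false]
      intro h
      exact hy ⟨h.1, h.2.1⟩
  simp_rw [h3]
  rw [lintegral_indicator measurableSet_Icc, ← intervalIntegral.integral_sub (hr.intervalIntegrable _ _) (hl.intervalIntegrable _ _),
    intervalIntegral.integral_of_le hv, ← integral_Icc_eq_integral_Ioc, ofReal_integral_eq_lintegral_ofReal]
  · exact (hr.sub hl).continuousOn.integrableOn_Icc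
  · filter_upwards [ae_restrict_mem measurableSet_Icc] with x hx
    have := hlr x hx.1 hx.2
    simp only [Pi.zero_apply]
    linarith

theorem hull_re {P : Finset ℂ} {s c : ℝ} (h : ∀ z ∈ P, val s z ≤ c) {z : ℂ} (hz : z ∈ convexHull ℝ (P : Set ℂ)) :
    val s z ≤ c := by
  have hconv : Convex ℝ {z : ℂ | val s z ≤ c} := by
    apply convex_halfSpace_le
    exact ⟨fun x y => by simp [val]; ring, fun t x => by simp [val]; ring⟩
  exact convexHull_min (fun z hz => h z hz) hconv hz

theorem hull_re' {P : Finset ℂ} {s c : ℝ} (h : ∀ z ∈ P, c ≤ val s z) {z : ℂ} (hz : z ∈ convexHull ℝ (P : Set ℂ)) :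
    c ≤ val s z := by
  have hconv : Convex ℝ {z : ℂ | c ≤ val s z} := by
    apply convex_halfSpace_ge
    exact ⟨fun x y => by simp [val]; ring, fun t x => by simp [val]; ring⟩
  exact convexHull_min (fun z hz => h z hz) hconv hz

theorem hull_im {P : Finset ℂ} {c : ℝ} (h : ∀ z ∈ P, z.im ≤ c) {z : ℂ} (hz : z ∈ convexHull ℝ (P : Set ℂ)) :
    z.im ≤ c := by
  have hconv : Convex ℝ {z : ℂ | z.im ≤ c} := by
    apply convex_halfSpace_le
    exact ⟨fun x y => by simp, fun t x => by simp⟩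
  exact convexHull_min (fun z hz => h z hz) hconv hz

theorem hull_im' {P : Finset ℂ} {c : ℝ} (h : ∀ z ∈ P, c ≤ z.im) {z : ℂ} (hz : z ∈ convexHull ℝ (P : Set ℂ)) :
    c ≤ z.im := by
  have hconv : Convex ℝ {z : ℂ | c ≤ z.im} := by
    apply convex_halfSpace_ge
    exact ⟨fun x y => by simp, fun t x => by simp⟩
  exact convexHull_min (fun z hz => h z hz) hconv hz

theorem hull_area {P : Finset ℂ} {m : ℕ} {a b : ℕ → ℂ} {s : ℕ → ℝ}
    (hP : ∀ k ≤ m, a k ∈ P ∧ b k ∈ P)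
    (hE : ∀ z ∈ P, (a 0).im ≤ z.im ∧ z.im ≤ (b 0).im ∧ z.im ≤ (a m).im ∧ (b m).im ≤ z.im)
    (hS : ∀ k ≤ m, ∀ z ∈ P, val (s k) z ≤ val (s k) (a k) ∧ val (s k) (b k) ≤ val (s k) z)
    (hM : ∀ k < m, (b (k+1) = b k ∧ (a k).im < (a (k+1)).im ∧ val (s (k+1)) (a (k+1)) = val (s (k+1)) (a k)) ∨
      (a (k+1) = a k ∧ (b (k+1)).im < (b k).im ∧ val (s (k+1)) (b (k+1)) = val (s (k+1)) (b k))) :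
    (volume (convexHull ℝ (P : Set ℂ))).toReal ≤
      ∑ k ∈ Finset.range m, (trap (a k) (a (k+1)) + trap (b k) (b (k+1))) := by
  have hne : (Finset.range (m+1)).Nonempty := ⟨0, by simp⟩
  set r : ℝ → ℝ := fun v => (Finset.range (m+1)).inf' hne (fun k => val (s k) (a k) - s k * v) with hr
  set l : ℝ → ℝ := fun v => (Finset.range (m+1)).sup' hne (fun k => val (s k) (b k) - s k * v) with hl
  have hrc : Continuous r := by
    apply Continuous.finset_inf'_apply
    intro i _; fun_prop
  have hlc : Continuous l := by
    apply Continuous.finset_sup'_apply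
    intro i _; fun_prop
  have hrk : ∀ k ≤ m, ∀ v, r v ≤ val (s k) (a k) - s k * v := fun k hk v =>
    Finset.inf'_le (fun k => val (s k) (a k) - s k * v) (Finset.mem_range.2 (by omega))
  have hlk : ∀ k ≤ m, ∀ v, val (s k) (b k) - s k * v ≤ l v := fun k hk v =>
    Finset.le_sup' (fun k => val (s k) (b k) - s k * v) (Finset.mem_range.2 (by omega))
  have hin : ∀ z ∈ convexHull ℝ (P : Set ℂ), l z.im ≤ z.re ∧ z.re ≤ r z.im := by
    intro z hz
    constructor
    · apply Finset.sup'_le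
      intro k hk
      have hk' : k ≤ m := by have := Finset.mem_range.1 hk; omega
      have := hull_re' (fun z hz => (hS k hk' z hz).2) hz
      simp only [val] at this ⊢
      linarith
    · apply Finset.le_inf'
      intro k hk
      have hk' : k ≤ m := by have := Finset.mem_range.1 hk; omega
      have := hull_re (fun z hz => (hS k hk' z hz).1) hz
      simp only [val] at this ⊢
      linarith
  set v0 := (a 0).im with hv0
  set v1 := (a m).im with hv1
  have h0P := (hP 0 (by omega))
  have hmP := (hP m le_rfl)
  have hb0 : (b 0).im = v1 := le_antisymm (hE _ h0P.2).2.2.1 (hE _ hmP.1).2.1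
  have hbm : (b m).im = v0 := le_antisymm (hE _ h0P.1).2.2.2 (hE _ hmP.2).1
  have h01 : v0 ≤ v1 := (hE _ h0P.1).2.2.1
  have hlr : ∀ v, v0 ≤ v → v ≤ v1 → l v ≤ r v := by
    intro v hv hv'
    have hseg : v ∈ segment ℝ v0 v1 := by rw [segment_eq_Icc h01]; exact ⟨hv, hv'⟩
    obtain ⟨p, q, hp, hq, hpq, hv⟩ := hseg
    have hz : p • a 0 + q • a m ∈ convexHull ℝ (P : Set ℂ) :=
      (convex_convexHull ℝ _) (subset_convexHull ℝ _ h0P.1) (subset_convexHull ℝ _ hmP.1) hp hq hpq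
    have h := hin _ hz
    have him : (p • a 0 + q • a m).im = v := by rw [← hv]; simp [hv0, hv1]
    rw [him] at h
    linarith
  have hvol := between_area hlc hrc h01 hlr
  have hsub : convexHull ℝ (P : Set ℂ) ⊆ {z : ℂ | v0 ≤ z.im ∧ z.im ≤ v1 ∧ l z.im ≤ z.re ∧ z.re ≤ r z.im} := by
    intro z hz
    exact ⟨hull_im' (fun z hz => (hE z hz).1) hz, hull_im (fun z hz => (hE z hz).2.2.1) hz, hin z hz⟩
  have hle := measure_mono (μ := volume) hsub
  rw [hvol] at hle
  have hnn : 0 ≤ (∫ v in v0..v1, r v) - ∫ v in v0..v1, l v := by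
    rw [sub_nonneg]
    apply intervalIntegral.integral_mono_on h01 (hlc.intervalIntegrable _ _) (hrc.intervalIntegrable _ _)
    exact fun x hx => hlr x hx.1 hx.2
  have h2 := ENNReal.toReal_le_of_le_ofReal hnn hle
  refine h2.trans ?_
  have hri : ∫ v in v0..v1, r v = ∑ k ∈ Finset.range m, ∫ v in (a k).im..(a (k+1)).im, r v :=
    (intervalIntegral.sum_integral_adjacent_intervals (a := fun k => (a k).im) (fun k _ => hrc.intervalIntegrable _ _)).symm
  have hli : ∫ v in (b 0).im..(b m).im, l v = ∑ k ∈ Finset.range m, ∫ v in (b k).im..(b (k+1)).im, l v :=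
    (intervalIntegral.sum_integral_adjacent_intervals (a := fun k => (b k).im) (fun k _ => hlc.intervalIntegrable _ _)).symm
  rw [hb0, hbm, intervalIntegral.integral_symm] at hli
  rw [sub_eq_add_neg, hri, hli, ← Finset.sum_add_distrib]
  apply Finset.sum_le_sum
  intro k hk
  have hk' := Finset.mem_range.1 hk
  rcases hM k hk' with ⟨h1, h2, h3⟩ | ⟨h1, h2, h3⟩
  · rw [h1]
    have : ∫ v in (a k).im..(a (k+1)).im, r v ≤ ∫ v in (a k).im..(a (k+1)).im,
        (val (s (k+1)) (a (k+1)) - s (k+1) * v) := by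
      apply intervalIntegral.integral_mono_on h2.le (hrc.intervalIntegrable _ _)
        (by apply Continuous.intervalIntegrable; fun_prop)
      exact fun x _ => hrk (k+1) (by omega) x
    rw [int_line] at this
    rw [intervalIntegral.integral_same]
    simp only [trap, val] at *
    refine (add_le_add_left this _).trans (le_of_eq ?_)
    linear_combination (1/2) * ((a (k+1)).im - (a k).im) * h3
  · rw [h1]
    have : ∫ v in (b (k+1)).im..(b k).im, (val (s (k+1)) (b (k+1)) - s (k+1) * v) ≤ ∫ v in (b (k+1)).im..(b k).im, l v := by
      apply intervalIntegral.integral_mono_on h2.le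
        (by apply Continuous.intervalIntegrable; fun_prop) (hlc.intervalIntegrable _ _)
      exact fun x _ => hlk (k+1) (by omega) x
    rw [int_line] at this
    rw [intervalIntegral.integral_same, intervalIntegral.integral_symm]
    simp only [trap, val] at *
    refine (add_le_add_right (neg_le_neg this) _).trans (le_of_eq ?_)
    linear_combination (1/2) * ((b (k+1)).im - (b k).im) * h3

end Oct


namespace Oct
open MeasureTheory

theorem rect_area {x0 x1 y0 y1 : ℝ} (hx : x0 ≤ x1) :
    volume {z : ℂ | x0 ≤ z.re ∧ z.re ≤ x1 ∧ y0 ≤ z.im ∧ z.im ≤ y1} = ENNReal.ofReal (x1 - x0) * ENNReal.ofReal (y1 - y0) := by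
  have := volume_complex (Set.Icc x0 x1 ×ˢ Set.Icc y0 y1) (measurableSet_Icc.prod measurableSet_Icc)
  rw [Measure.volume_eq_prod, Measure.prod_prod, Real.volume_Icc, Real.volume_Icc] at this
  rw [← this]
  congr 1
  ext z
  simp only [Set.mem_ofPred_eq, Set.mem_prod, Set.mem_Icc]
  tauto

theorem image_rot_hull (c : Circle) (P : Finset ℂ) :
    volume (convexHull ℝ ((P.image (fun z => (c : ℂ) * z) : Finset ℂ) : Set ℂ)) = volume (convexHull ℝ (P : Set ℂ)) := by
  classical
  have h : (((P.image (fun z => (c : ℂ) * z) : Finset ℂ) : Set ℂ)) = (rotation c).toLinearEquiv.toLinearMap '' (P : Set ℂ) := by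
    ext z; simp
  rw [h, ← LinearMap.image_convexHull]
  have := (rotation c).measurePreserving
  have h2 : (rotation c).toLinearEquiv.toLinearMap '' (convexHull ℝ (P : Set ℂ)) = (rotation c) '' (convexHull ℝ (P : Set ℂ)) := rfl
  rw [h2, LinearIsometryEquiv.image_eq_preimage_symm]
  exact (rotation c).symm.measurePreserving.measure_preimage (P.finite_toSet.isCompact_convexHull (𝕜 := ℝ)).isClosed.measurableSet.nullMeasurableSet

theorem box_area {Q : Finset ℂ} (hd : ∀ z ∈ Q, ∀ w ∈ Q, dist z w ≤ 1) {x0 x1 : ℝ} (hx : x0 ≤ x1)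
    (h : ∀ z ∈ Q, x0 ≤ z.re ∧ z.re ≤ x1) :
    (volume (convexHull ℝ (Q : Set ℂ))).toReal ≤ x1 - x0 := by
  rcases Q.eq_empty_or_nonempty with he | hne
  · subst he; simp; exact hx
  obtain ⟨p, hp, hpm⟩ := Q.exists_min_image (fun z => z.im) hne
  have hsub : convexHull ℝ (Q : Set ℂ) ⊆ {z : ℂ | x0 ≤ z.re ∧ z.re ≤ x1 ∧ p.im ≤ z.im ∧ z.im ≤ p.im + 1} := by
    intro z hz
    have h1 := hull_re' (s := 0) (c := x0) (fun z hz => by simp [val]; exact (h z hz).1) hz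
    have h2 := hull_re (s := 0) (c := x1) (fun z hz => by simp [val]; exact (h z hz).2) hz
    simp [val] at h1 h2
    refine ⟨h1, h2, hull_im' hpm hz, hull_im (fun w hw => ?_) hz⟩
    have h3 := hd w hw p hp
    rw [Complex.dist_eq] at h3
    have h4 := Complex.abs_im_le_norm (w - p)
    have h5 := le_abs_self (w - p).im
    rw [Complex.sub_im] at h4 h5
    linarith
  have hle := measure_mono (μ := volume) hsub
  rw [rect_area hx] at hle
  apply ENNReal.toReal_le_of_le_ofReal (by linarith)
  simpa using hle

/-- The width in every direction bounds the area. -/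
theorem width_area {P : Finset ℂ} (hd : ∀ z ∈ P, ∀ w ∈ P, dist z w ≤ 1) {t c0 c1 : ℝ} (hc : c0 ≤ c1)
    (h : ∀ z ∈ P, c0 ≤ val t z ∧ val t z ≤ c1) :
    (volume (convexHull ℝ (P : Set ℂ))).toReal * Real.sqrt (1 + t^2) ≤ c1 - c0 := by
  classical
  set R := Real.sqrt (1 + t^2) with hR
  have hRp : 0 < R := Real.sqrt_pos.2 (by positivity)
  have hR2 : R^2 = 1 + t^2 := Real.sq_sqrt (by positivity)
  set u : ℂ := ⟨1/R, -t/R⟩ with hu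
  have hun : ‖u‖ = 1 := by
    have : Complex.normSq u = 1 := by
      rw [Complex.normSq_mk]
      field_simp
      linarith
    rw [Complex.norm_def, this, Real.sqrt_one]
  set c : Circle := ⟨u, mem_sphere_zero_iff_norm.2 hun⟩ with hcdef
  have hcu : (c : ℂ) = u := rfl
  rw [← image_rot_hull c P]
  have hre : ∀ z : ℂ, (u * z).re = val t z / R := by
    intro z
    simp only [Complex.mul_re, hu, val]
    field_simp
    ring
  have := box_area (Q := P.image (fun z => (c:ℂ) * z)) (x0 := c0 / R) (x1 := c1 / R) ?_ (by gcongr) ?_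
  · calc _ ≤ (c1 / R - c0 / R) * R := by gcongr
      _ = _ := by field_simp
  · intro z hz w hw
    obtain ⟨z', hz', rfl⟩ := Finset.mem_image.1 hz
    obtain ⟨w', hw', rfl⟩ := Finset.mem_image.1 hw
    rw [Complex.dist_eq, ← mul_sub, norm_mul, hcu, hun, one_mul, ← Complex.dist_eq]
    exact hd _ hz' _ hw'
  · intro z hz
    obtain ⟨z', hz', rfl⟩ := Finset.mem_image.1 hz
    rw [hcu, hre]
    constructor <;> gcongr
    · exact (h z' hz').1
    · exact (h z' hz').2

end Oct


namespace Oct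
open MeasureTheory

def cr (z w : ℂ) : ℝ := z.re * w.im - z.im * w.re

theorem pol_cr {d e x y : ℝ} {z w : ℂ} (h1 : d * Real.cos x = z.re) (h2 : d * Real.sin x = z.im)
    (h3 : e * Real.cos y = w.re) (h4 : e * Real.sin y = w.im) : d * e * Real.sin (y - x) = cr z w := by
  unfold cr
  rw [← h1, ← h2, ← h3, ← h4, Real.sin_sub]
  ring

theorem delta_range {z w : ℂ} (him : z.im < w.im) (hcr : 0 < cr z w) :
    z.arg < w.arg ∧ w.arg < z.arg + Real.pi := by
  have h := pol_cr (Complex.norm_mul_cos_arg z) (Complex.norm_mul_sin_arg z) (Complex.norm_mul_cos_arg w) (Complex.norm_mul_sin_arg w)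
  have hs : 0 < Real.sin (w.arg - z.arg) := by
    rw [← h] at hcr
    exact pos_of_mul_pos_right hcr (by positivity)
  have z1 := Complex.neg_pi_lt_arg z
  have z2 := Complex.arg_le_pi z
  have w1 := Complex.neg_pi_lt_arg w
  have w2 := Complex.arg_le_pi w
  have hr : -Real.pi ≤ w.arg - z.arg ∧ w.arg - z.arg ≤ 2 * Real.pi := by
    rcases lt_or_ge z.im 0 with h0 | h0
    · have := Complex.arg_neg_iff.2 h0
      constructor <;> linarith
    · have := Complex.arg_nonneg_iff.2 h0
      have := Complex.arg_nonneg_iff.2 (h0.trans him.le)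
      constructor <;> linarith
  constructor
  · by_contra hc
    push Not at hc
    have := Real.sin_nonpos_of_nonpos_of_neg_pi_le (x := w.arg - z.arg) (by linarith) hr.1
    linarith
  · by_contra hc
    push Not at hc
    have := Real.sin_nonneg_of_nonneg_of_le_pi (x := w.arg - z.arg - Real.pi) (by linarith) (by linarith)
    rw [Real.sin_sub_pi] at this
    linarith

theorem cauchy_val (t : ℝ) (z : ℂ) : val t z ≤ ‖z‖ * Real.sqrt (1 + t^2) := by
  rw [Complex.norm_def, ← Real.sqrt_mul (Complex.normSq_nonneg z)]
  apply Real.le_sqrt_of_sq_le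
  rw [Complex.normSq_apply]
  unfold val
  nlinarith [sq_nonneg (z.im - t * z.re)]

theorem complex_bound (P : Finset ℂ) (hcard : P.card ≤ 8) (hd : ∀ z ∈ P, ∀ w ∈ P, dist z w ≤ 1)
    (hinj : ∀ z ∈ P, ∀ w ∈ P, z.im = w.im → z = w) :
    (volume (convexHull ℝ (P : Set ℂ))).toReal ≤ 0.72686849 := by
  by_contra hV
  push Not at hV
  set V := (volume (convexHull ℝ (P : Set ℂ))).toReal with hVdef
  have hne : P.Nonempty := by
    rw [Finset.nonempty_iff_ne_empty]
    intro h
    rw [hVdef, h] at hV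
    simp at hV
    norm_num at hV
  obtain ⟨m, a, b, s, hs, hP, hE, hS, hM⟩ := calipers P hne
  have hA := hull_area hP hE hS hM
  -- non-degeneracy
  have hNC : ∀ t, ∀ p ∈ P, ∀ q ∈ P, (∀ z ∈ P, val t z ≤ val t p ∧ val t q ≤ val t z) →
      V * Real.sqrt (1 + t^2) ≤ val t p - val t q := fun t p hp q hq h =>
    width_area hd (h q hq).1 (fun z hz => ⟨(h z hz).2, (h z hz).1⟩)
  have hNC' : ∀ t, ∀ p ∈ P, ∀ q ∈ P, (∀ z ∈ P, val t z ≤ val t p ∧ val t q ≤ val t z) →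
      0 < val t p - val t q := fun t p hp q hq h =>
    lt_of_lt_of_le (mul_pos (by linarith) (Real.sqrt_pos.2 (by positivity))) (hNC t p hp q hq h)
  have h0P := (hP 0 (by omega))
  have hmP := (hP m le_rfl)
  have hb0 : b 0 = a m := hinj _ h0P.2 _ hmP.1 (le_antisymm (hE _ h0P.2).2.2.1 (hE _ hmP.1).2.1)
  have hbm : b m = a 0 := hinj _ hmP.2 _ h0P.1 (le_antisymm (hE _ h0P.1).2.2.2 (hE _ hmP.2).1)
  have h01 : (a 0).im < (b 0).im := by
    refine lt_of_le_of_ne (hE _ h0P.2).1 (fun h => ?_)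
    have h1 := hinj _ h0P.1 _ h0P.2 h
    have := hNC' (s 0) _ h0P.1 _ h0P.2 (hS 0 (by omega))
    rw [h1] at this
    simp at this
  have hm1 : 1 ≤ m := by
    by_contra hc
    have : m = 0 := by omega
    subst this
    rw [hb0] at h01
    simp at h01
  have hsm : ∀ i j, i ≤ j → j ≤ m → s i ≤ s j := by
    intro i j hij
    induction j, hij using Nat.le_induction with
    | base => intro _; exact le_rfl
    | succ j hj ih => intro h; exact (ih (by omega)).trans (hs j (by omega))
  have ham : ∀ i j, i ≤ j → j ≤ m → (a i).im ≤ (a j).im := by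
    intro i j hij
    induction j, hij using Nat.le_induction with
    | base => intro _; exact le_rfl
    | succ j hj ih =>
      intro h
      refine (ih (by omega)).trans ?_
      rcases hM j (by omega) with ⟨_, h2, _⟩ | ⟨h2, _⟩
      · exact h2.le
      · rw [h2]
  have hbmn : ∀ i j, i ≤ j → j ≤ m → (b j).im ≤ (b i).im := by
    intro i j hij
    induction j, hij using Nat.le_induction with
    | base => intro _; exact le_rfl
    | succ j hj ih =>
      intro h
      refine le_trans ?_ (ih (by omega))
      rcases hM j (by omega) with ⟨h2, _⟩ | ⟨_, h2, _⟩
      · rw [h2]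
      · exact h2.le
  -- counting
  have hmix : ∀ i < m, ∀ j < m, (a i).im < (a (i+1)).im → val (s (i+1)) (a (i+1)) = val (s (i+1)) (a i) →
      (b (j+1)).im < (b j).im → val (s (j+1)) (b (j+1)) = val (s (j+1)) (b j) → a (i+1) ≠ b (j+1) := by
    intro i hi j hj h1 h2 h3 h4 heq
    have k1 := (hS (j+1) (by omega) (a i) (hP i (by omega)).1).2
    have k2 := (hS (i+1) (by omega) (b j) (hP j (by omega)).2).1
    have hst : s (i+1) = s (j+1) := by
      rw [← heq] at k1 h3 h4
      unfold val at *
      apply le_antisymm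
      · nlinarith
      · nlinarith
    have := hNC' (s (i+1)) _ (hP (i+1) (by omega)).1 _ (hP (j+1) (by omega)).2 (fun z hz =>
      ⟨(hS (i+1) (by omega) z hz).1, by rw [hst]; exact (hS (j+1) (by omega) z hz).2⟩)
    rw [heq] at this
    simp at this
  classical
  have hm8 : m ≤ 8 := by
    refine le_trans ?_ hcard
    set g : ℕ → ℂ := fun k => if (a k).im < (a (k+1)).im then a (k+1) else b (k+1) with hg
    have : (Finset.range m).card ≤ P.card := by
      apply Finset.card_le_card_of_injOn g
      · intro k hk
        have hk : k < m := by simpa using hk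
        simp only [hg]
        split_ifs
        · exact (hP (k+1) (by omega)).1
        · exact (hP (k+1) (by omega)).2
      · have key : ∀ i j, i < j → j < m → g i ≠ g j := by
          intro i j hij hj
          have ai := ham (i+1) j (by omega) (by omega)
          have bi := hbmn (i+1) j (by omega) (by omega)
          rcases hM i (by omega) with ⟨i1, i2, i3⟩ | ⟨i1, i2, i3⟩ <;>
          rcases hM j (by omega) with ⟨j1, j2, j3⟩ | ⟨j1, j2, j3⟩
          · simp only [hg, if_pos i2, if_pos j2]
            intro h; rw [h] at ai; linarith
          · simp only [hg, if_pos i2, j1, lt_irrefl, if_false]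
            exact hmix i (by omega) j hj i2 i3 j2 j3
          · simp only [hg, if_pos j2, i1, lt_irrefl, if_false]
            exact (hmix j (by omega) i (by omega) j2 j3 i2 i3).symm
          · simp only [hg, i1, j1, lt_irrefl, if_false]
            intro h; rw [h] at bi; linarith
        intro i hi j hj h
        have hi : i < m := by simpa using hi
        have hj : j < m := by simpa using hj
        by_contra hc
        rcases Nat.lt_or_gt_of_ne hc with h' | h'
        · exact key i j h' hj h
        · exact key j i h' hi h.symm
    simpa using this
  -- the data
  set D : ℕ → ℂ := fun k => a k - b k with hD
  have hDm : D m = - D 0 := by simp only [hD]; rw [hb0, hbm]; ring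
  have hE1 : ∀ k < m, (D (k+1) - D k).re = - s (k+1) * (D (k+1) - D k).im ∧ 0 < (D (k+1) - D k).im := by
    intro k hk
    simp only [hD]
    rcases hM k hk with ⟨h1, h2, h3⟩ | ⟨h1, h2, h3⟩
    · rw [h1]
      simp only [val, Complex.sub_re, Complex.sub_im] at *
      constructor <;> linarith
    · rw [h1]
      simp only [val, Complex.sub_re, Complex.sub_im] at *
      constructor <;> linarith
  have hvD : ∀ k < m, V * Real.sqrt (1 + s (k+1)^2) ≤ val (s (k+1)) (D k) := by
    intro k hk
    have h := hNC (s (k+1)) _ (hP (k+1) (by omega)).1 _ (hP (k+1) (by omega)).2 (hS (k+1) (by omega))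
    refine h.trans (le_of_eq ?_)
    simp only [hD]
    rcases hM k hk with ⟨h1, h2, h3⟩ | ⟨h1, h2, h3⟩
    · rw [h1, h3]; simp [val]; ring
    · rw [h1, h3]; simp [val]; ring
  have hcrp : ∀ k < m, 0 < cr (D k) (D (k+1)) := by
    intro k hk
    have h1 := hE1 k hk
    have h2 := lt_of_lt_of_le (mul_pos (by linarith) (Real.sqrt_pos.2 (by positivity))) (hvD k hk)
    have h3 := mul_pos h1.2 h2
    have h4 : cr (D k) (D (k+1)) = (D (k+1) - D k).im * val (s (k+1)) (D k) := by
      have := h1.1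
      simp only [cr, val, Complex.sub_re, Complex.sub_im] at *
      linear_combination (-(D k).im) * this
    rw [h4]; exact h3
  set D' : ℕ → ℂ := fun k => if k ≤ m then D k else - D 1 with hD'
  set th : ℕ → ℝ := fun k => if k ≤ m then (D k).arg else (D 1).arg + Real.pi with hth
  set dd : ℕ → ℝ := fun k => if k ≤ m then ‖D k‖ else ‖D 1‖ with hdd
  have hD'k : ∀ k, k ≤ m → D' k = D k := fun k hk => by simp only [hD', if_pos hk]
  have hthk : ∀ k, k ≤ m → th k = (D k).arg := fun k hk => by simp only [hth, if_pos hk]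
  have hddk : ∀ k, k ≤ m → dd k = ‖D k‖ := fun k hk => by simp only [hdd, if_pos hk]
  have hD'm : D' (m+1) = - D 1 := by simp only [hD', if_neg (show ¬ (m + 1 ≤ m) by omega)]
  have hthm : th (m+1) = (D 1).arg + Real.pi := by simp only [hth, if_neg (show ¬ (m + 1 ≤ m) by omega)]
  have hddm : dd (m+1) = ‖D 1‖ := by simp only [hdd, if_neg (show ¬ (m + 1 ≤ m) by omega)]
  have hcos : ∀ k, dd k * Real.cos (th k) = (D' k).re := by
    intro k
    simp only [hdd, hth, hD']
    split_ifs
    · exact Complex.norm_mul_cos_arg _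
    · rw [Real.cos_add_pi, Complex.neg_re, mul_neg, Complex.norm_mul_cos_arg]
  have hsin : ∀ k, dd k * Real.sin (th k) = (D' k).im := by
    intro k
    simp only [hdd, hth, hD']
    split_ifs
    · exact Complex.norm_mul_sin_arg _
    · rw [Real.sin_add_pi, Complex.neg_im, mul_neg, Complex.norm_mul_sin_arg]
  have hpc : ∀ k j, dd k * dd j * Real.sin (th j - th k) = cr (D' k) (D' j) := fun k j =>
    pol_cr (hcos k) (hsin k) (hcos j) (hsin j)
  have hfin := abstract_bound (A := V) hm8 (X := fun k => ((a k).re + (b k).re)/2) (Y := fun k => ((a k).im + (b k).im)/2)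
    (d := dd) (θ := th) (s := fun k => if (a k).im < (a (k+1)).im then 1 else -1)
    (by simp only [hb0, hbm]; ring) (by simp only [hb0, hbm]; ring)
    (by
      rw [hthk m le_rfl, hthk 0 (by omega), hDm]
      apply Complex.arg_neg_eq_arg_add_pi_of_im_neg
      simp only [hD, Complex.sub_im]; linarith)
    (by rw [hthm, hthk 1 hm1])
    (by rw [hddk m le_rfl, hddk 0 (by omega), hDm, norm_neg])
    (by rw [hddm, hddk 1 hm1])
    (by
      intro k hk
      rw [hthk k (by omega), hthk (k+1) (by omega)]
      apply delta_range _ (hcrp k hk)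
      have := (hE1 k hk).2
      rw [Complex.sub_im] at this
      linarith)
    (by intro k hk; split_ifs <;> simp)
    (by
      intro k hk
      rw [hcos, hcos, hD'k k (by omega), hD'k (k+1) (by omega)]
      simp only [hD]
      rcases hM k hk with ⟨h1, h2, h3⟩ | ⟨h1, h2, h3⟩
      · rw [if_pos h2, h1]; simp; ring
      · rw [if_neg (by rw [h1]; exact lt_irrefl _), h1]; simp; ring)
    (by
      intro k hk
      rw [hsin, hsin, hD'k k (by omega), hD'k (k+1) (by omega)]
      simp only [hD]
      rcases hM k hk with ⟨h1, h2, h3⟩ | ⟨h1, h2, h3⟩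
      · rw [if_pos h2, h1]; simp; ring
      · rw [if_neg (by rw [h1]; exact lt_irrefl _), h1]; simp; ring)
    (by
      intro k hk
      rw [hddk k (by omega)]
      have h1 := (hvD k hk).trans (cauchy_val _ _)
      have h2 := le_of_mul_le_mul_right h1 (Real.sqrt_pos.2 (by positivity))
      linarith)
    (by
      intro k hk
      rw [hddk k (by omega)]
      have := hd _ (hP k (by omega)).1 _ (hP k (by omega)).2
      rwa [Complex.dist_eq] at this)
    (by
      intro k hk
      rw [hpc, hpc, hpc, hD'k k (by omega), hD'k (k+1) (by omega)]
      have e : ∀ x y z : ℂ, cr y z + cr x y - cr x z = cr (y - x) (z - y) := by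
        intro x y z; simp only [cr, Complex.sub_re, Complex.sub_im]; ring
      rw [e]
      have h1 := hE1 k hk
      rcases Nat.lt_or_ge (k+1) m with h | h
      · rw [hD'k (k+2) (by omega)]
        have h2 := hE1 (k+1) h
        have h3 := hs (k+1) h
        unfold cr
        rw [h1.1, h2.1]
        have := mul_nonneg (mul_nonneg h1.2.le h2.2.le) (sub_nonneg.2 h3)
        linarith
      · have hk2 : k + 1 = m := by omega
        have hk3 : D' (k+2) - D (k+1) = - (D (0+1) - D 0) := by
          rw [show k + 2 = m + 1 by omega, hD'm, hk2, hDm]; ring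
        rw [hk3]
        have h2 := hE1 0 (by omega)
        have h3 := hsm (0+1) (k+1) (by omega) (by omega)
        unfold cr
        rw [Complex.neg_re, Complex.neg_im, h1.1, h2.1]
        have := mul_nonneg (mul_nonneg h1.2.le h2.2.le) (sub_nonneg.2 h3)
        linarith)
    (by
      refine hA.trans (le_of_eq ?_)
      have ht : ∑ k ∈ Finset.range m, (((a (k+1)).re * (a (k+1)).im + (b (k+1)).re * (b (k+1)).im)/2 -
          ((a k).re * (a k).im + (b k).re * (b k).im)/2) = 0 := by
        rw [Finset.sum_range_sub (fun k => ((a k).re * (a k).im + (b k).re * (b k).im)/2), hb0, hbm]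
        ring
      rw [← sub_zero (∑ k ∈ Finset.range m, (trap (a k) (a (k+1)) + trap (b k) (b (k+1)))), ← ht, ← Finset.sum_sub_distrib]
      apply Finset.sum_congr rfl
      intro k hk
      have hk := Finset.mem_range.1 hk
      rw [hpc, hD'k k (by omega), hD'k (k+1) (by omega)]
      simp only [hD, trap, cr, Complex.sub_re, Complex.sub_im]
      ring)
  linarith

end Oct


namespace Oct
open MeasureTheory

theorem strip_mem {C : Set ℂ} (hC : Convex ℝ C) {x0 y0 x1 y1 : ℝ} (hy : y0 < y1) (hx0 : 0 ≤ x0) (hx1 : 0 ≤ x1)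
    (h1 : (⟨x0, y0⟩ : ℂ) ∈ C) (h2 : (⟨-x0, y0⟩ : ℂ) ∈ C) (h3 : (⟨x1, y1⟩ : ℂ) ∈ C) (h4 : (⟨-x1, y1⟩ : ℂ) ∈ C)
    {z : ℂ} (hz0 : y0 ≤ z.im) (hz1 : z.im ≤ y1)
    (hl : -(x0 + (x1 - x0) / (y1 - y0) * (z.im - y0)) ≤ z.re) (hr : z.re ≤ x0 + (x1 - x0) / (y1 - y0) * (z.im - y0)) :
    z ∈ C := by
  set t := (z.im - y0) / (y1 - y0) with ht
  have hp : 0 < y1 - y0 := by linarith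
  have ht0 : 0 ≤ t := div_nonneg (by linarith) hp.le
  have ht1 : t ≤ 1 := (div_le_one hp).2 (by linarith)
  have hti : t * (y1 - y0) = z.im - y0 := by rw [ht]; field_simp
  set L := (1 - t) * x0 + t * x1 with hL
  have hLe : x0 + (x1 - x0) / (y1 - y0) * (z.im - y0) = L := by
    rw [← hti, hL]; field_simp; ring
  rw [hLe] at hl hr
  have hL0 : 0 ≤ L := by have := mul_nonneg (sub_nonneg.2 ht1) hx0; have := mul_nonneg ht0 hx1; linarith
  have p1 : (⟨L, z.im⟩ : ℂ) ∈ C := by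
    have := hC h1 h3 (sub_nonneg.2 ht1) ht0 (by ring)
    convert this using 1
    apply Complex.ext
    · simp [hL]
    · simp; linarith
  have p2 : (⟨-L, z.im⟩ : ℂ) ∈ C := by
    have := hC h2 h4 (sub_nonneg.2 ht1) ht0 (by ring)
    convert this using 1
    apply Complex.ext
    · simp [hL]; ring
    · simp; linarith
  rcases hL0.eq_or_lt with h | h
  · have hz : z = ⟨L, z.im⟩ := Complex.ext (by simp; linarith) rfl
    rw [hz]; exact p1
  · have h5 := hC p2 p1 (a := (L - z.re) / (2 * L)) (b := (L + z.re) / (2 * L)) (div_nonneg (by linarith) (by linarith))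
      (div_nonneg (by linarith) (by linarith)) (by field_simp; ring)
    convert h5 using 1
    apply Complex.ext
    · simp only [Complex.add_re, Complex.real_smul, Complex.re_ofReal_mul]; field_simp; ring
    · simp only [Complex.add_im, Complex.real_smul, Complex.im_ofReal_mul]; field_simp; ring

def qx : Fin 8 → ℚ := ![0, 0.40909227188, 0.4999999995, 0.2621417125, 0, -0.2621417125, -0.4999999995, -0.40909227188]
def qy : Fin 8 → ℚ := ![0, 0.22378385813, 0.64037867341, 0.96502938845, 1, 0.96502938845, 0.64037867341, 0.22378385813]

theorem q_dist : ∀ i j, (qx i - qx j)^2 + (qy i - qy j)^2 ≤ 1 := by decide +kernel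

noncomputable def qv (i : Fin 8) : ℂ := ⟨(qx i : ℝ), (qy i : ℝ)⟩

theorem qv_dist (i j : Fin 8) : dist (qv i) (qv j) ≤ 1 := by
  have h := q_dist i j
  have h' : ((qx i : ℝ) - qx j)^2 + ((qy i : ℝ) - qy j)^2 ≤ 1 := by exact_mod_cast h
  rw [Complex.dist_eq, Complex.norm_def, Real.sqrt_le_one, Complex.normSq_apply]
  simp only [qv, Complex.sub_re, Complex.sub_im]
  nlinarith

noncomputable def ln (x0 y0 x1 y1 v : ℝ) : ℝ := x0 + (x1 - x0) / (y1 - y0) * (v - y0)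

theorem ln_cont (x0 y0 x1 y1 : ℝ) : Continuous (ln x0 y0 x1 y1) := by unfold ln; fun_prop

theorem ln_int {x0 y0 x1 y1 : ℝ} (h : y0 < y1) : ∫ v in y0..y1, ln x0 y0 x1 y1 v = (x0 + x1)/2 * (y1 - y0) := by
  have e : ∀ v, ln x0 y0 x1 y1 v = (x0 - (x1 - x0) / (y1 - y0) * y0) - (-((x1 - x0) / (y1 - y0))) * v := by
    intro v; unfold ln; ring
  simp_rw [e]
  rw [int_line]
  have : y1 - y0 ≠ 0 := by linarith
  field_simp
  ring

noncomputable def rr (v : ℝ) : ℝ := min (min (ln 0 0 0.40909227188 0.22378385813 v) (ln 0.40909227188 0.22378385813 0.4999999995 0.64037867341 v))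
  (min (ln 0.4999999995 0.64037867341 0.2621417125 0.96502938845 v) (ln 0.2621417125 0.96502938845 0 1 v))

theorem rr_cont : Continuous rr :=
  ((ln_cont _ _ _ _).min (ln_cont _ _ _ _)).min ((ln_cont _ _ _ _).min (ln_cont _ _ _ _))

theorem rr1 {v : ℝ} (h0 : 0 ≤ v) (h1 : v ≤ 0.22378385813) : rr v = ln 0 0 0.40909227188 0.22378385813 v := by
  unfold rr
  rw [min_eq_left, min_eq_left]
  · unfold ln; norm_num at *; linarith
  · apply le_min <;> apply (min_le_left _ _).trans <;> unfold ln <;> norm_num at * <;> linarith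

theorem rr2 {v : ℝ} (h0 : 0.22378385813 ≤ v) (h1 : v ≤ 0.64037867341) : rr v = ln 0.40909227188 0.22378385813 0.4999999995 0.64037867341 v := by
  unfold rr
  rw [min_eq_left, min_eq_right]
  · unfold ln; norm_num at *; linarith
  · apply le_min <;> apply (min_le_right _ _).trans <;> unfold ln <;> norm_num at * <;> linarith

theorem rr3 {v : ℝ} (h0 : 0.64037867341 ≤ v) (h1 : v ≤ 0.96502938845) : rr v = ln 0.4999999995 0.64037867341 0.2621417125 0.96502938845 v := by
  unfold rr
  rw [min_eq_right, min_eq_left]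
  · unfold ln; norm_num at *; linarith
  · apply le_min <;> apply (min_le_left _ _).trans <;> unfold ln <;> norm_num at * <;> linarith

theorem rr4 {v : ℝ} (h0 : 0.96502938845 ≤ v) (h1 : v ≤ 1) : rr v = ln 0.2621417125 0.96502938845 0 1 v := by
  unfold rr
  rw [min_eq_right, min_eq_right]
  · unfold ln; norm_num at *; linarith
  · apply le_min <;> apply (min_le_right _ _).trans <;> unfold ln <;> norm_num at * <;> linarith

theorem strip_int {x0 y0 x1 y1 : ℝ} (h : y0 < y1) (hr : ∀ v, y0 ≤ v → v ≤ y1 → rr v = ln x0 y0 x1 y1 v) :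
    ∫ v in y0..y1, rr v = (x0 + x1)/2 * (y1 - y0) := by
  rw [← ln_int h]
  apply intervalIntegral.integral_congr
  intro v hv
  rw [Set.uIcc_of_le h.le] at hv
  exact hr v hv.1 hv.2

theorem rr_int : 0.72686845 ≤ 2 * ∫ v in (0:ℝ)..1, rr v := by
  have i : ∀ x y, IntervalIntegrable rr volume x y := fun x y => rr_cont.intervalIntegrable _ _
  rw [← intervalIntegral.integral_add_adjacent_intervals (i 0 0.96502938845) (i _ 1),
    ← intervalIntegral.integral_add_adjacent_intervals (i 0 0.64037867341) (i _ 0.96502938845),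
    ← intervalIntegral.integral_add_adjacent_intervals (i 0 0.22378385813) (i _ 0.64037867341),
    strip_int (by norm_num) (fun v => rr1), strip_int (by norm_num) (fun v => rr2),
    strip_int (by norm_num) (fun v => rr3), strip_int (by norm_num) (fun v => rr4)]
  norm_num

theorem rr_nonneg {v : ℝ} (h0 : 0 ≤ v) (h1 : v ≤ 1) : 0 ≤ rr v := by
  unfold rr
  refine le_min (le_min ?_ ?_) (le_min ?_ ?_) <;> unfold ln <;> norm_num at * <;> linarith

theorem lower_area {C : Set ℂ} (hC : Convex ℝ C) (hq : ∀ i, qv i ∈ C) :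
    ENNReal.ofReal 0.72686845 ≤ volume C := by
  have h := between_area (l := fun v => - rr v) (r := rr) rr_cont.neg rr_cont (zero_le_one)
    (fun v h0 h1 => by have := rr_nonneg h0 h1; linarith)
  rw [intervalIntegral.integral_neg, sub_neg_eq_add, ← two_mul] at h
  refine (ENNReal.ofReal_le_ofReal rr_int).trans (h.symm.le.trans (measure_mono ?_))
  rintro z ⟨h0, h1, h2, h3⟩
  have q0 : (⟨0, 0⟩ : ℂ) ∈ C := by simpa [qv, qx, qy] using hq 0
  have q0' : (⟨-0, 0⟩ : ℂ) ∈ C := by simpa using q0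
  have q1 : (⟨0.40909227188, 0.22378385813⟩ : ℂ) ∈ C := by convert hq 1 using 1; simp [qv, qx, qy]
  have q2 : (⟨0.4999999995, 0.64037867341⟩ : ℂ) ∈ C := by convert hq 2 using 1; simp [qv, qx, qy]
  have q3 : (⟨0.2621417125, 0.96502938845⟩ : ℂ) ∈ C := by convert hq 3 using 1; simp [qv, qx, qy]
  have q4 : (⟨0, 1⟩ : ℂ) ∈ C := by convert hq 4 using 1; simp [qv, qx, qy]
  have q4' : (⟨-0, 1⟩ : ℂ) ∈ C := by simpa using q4
  have q5 : (⟨-0.2621417125, 0.96502938845⟩ : ℂ) ∈ C := by convert hq 5 using 1; simp [qv, qx, qy]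
  have q6 : (⟨-0.4999999995, 0.64037867341⟩ : ℂ) ∈ C := by convert hq 6 using 1; simp [qv, qx, qy]
  have q7 : (⟨-0.40909227188, 0.22378385813⟩ : ℂ) ∈ C := by convert hq 7 using 1; simp [qv, qx, qy]
  rcases le_total z.im 0.22378385813 with a1 | a1
  · simp only [rr1 h0 a1] at h2 h3
    exact strip_mem hC (by norm_num) (by norm_num) (by norm_num) q0 q0' q1 q7 h0 a1 h2 h3
  rcases le_total z.im 0.64037867341 with a2 | a2
  · simp only [rr2 a1 a2] at h2 h3
    exact strip_mem hC (by norm_num) (by norm_num) (by norm_num) q1 q7 q2 q6 a1 a2 h2 h3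
  rcases le_total z.im 0.96502938845 with a3 | a3
  · simp only [rr3 a2 a3] at h2 h3
    exact strip_mem hC (by norm_num) (by norm_num) (by norm_num) q2 q6 q3 q5 a2 a3 h2 h3
  · simp only [rr4 a3 h1] at h2 h3
    exact strip_mem hC (by norm_num) (by norm_num) (by norm_num) q3 q5 q4 q4' a3 h1 h2 h3

end Oct


namespace Oct
open MeasureTheory

theorem exists_good_rotation (P : Finset ℂ) : ∃ c : Circle, ∀ z ∈ P, ∀ w ∈ P, ((c : ℂ) * z).im = ((c : ℂ) * w).im → z = w := by
  classical
  obtain ⟨t, ht⟩ := Infinite.exists_notMem_finset ((P ×ˢ P).image (fun x => -(x.1.im - x.2.im) / (x.1.re - x.2.re)))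
  set R := Real.sqrt (1 + t^2) with hR
  have hRp : 0 < R := Real.sqrt_pos.2 (by positivity)
  have hR2 : R^2 = 1 + t^2 := Real.sq_sqrt (by positivity)
  set u : ℂ := ⟨1/R, t/R⟩ with hu
  have hun : ‖u‖ = 1 := by
    have : Complex.normSq u = 1 := by
      rw [Complex.normSq_mk]
      field_simp
      linarith
    rw [Complex.norm_def, this, Real.sqrt_one]
  refine ⟨⟨u, mem_sphere_zero_iff_norm.2 hun⟩, fun z hz w hw h => ?_⟩
  have h1 : 1/R * z.im + t/R * z.re = 1/R * w.im + t/R * w.re := by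
    simpa [Complex.mul_im, hu] using h
  have h2 : z.im + t * z.re = w.im + t * w.re := by
    field_simp at h1
    exact h1
  by_cases hre : z.re = w.re
  · exact Complex.ext hre (by rw [hre] at h2; linarith)
  · exfalso
    apply ht
    refine Finset.mem_image.2 ⟨(z, w), Finset.mk_mem_product hz hw, ?_⟩
    have : z.re - w.re ≠ 0 := sub_ne_zero.2 hre
    field_simp
    linarith

theorem complex_bound' (P : Finset ℂ) (hcard : P.card ≤ 8) (hd : ∀ z ∈ P, ∀ w ∈ P, dist z w ≤ 1) :
    (volume (convexHull ℝ (P : Set ℂ))).toReal ≤ 0.72686849 := by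
  classical
  obtain ⟨c, hc⟩ := exists_good_rotation P
  rw [← image_rot_hull c P]
  apply complex_bound
  · exact Finset.card_image_le.trans hcard
  · intro z hz w hw
    obtain ⟨z', hz', rfl⟩ := Finset.mem_image.1 hz
    obtain ⟨w', hw', rfl⟩ := Finset.mem_image.1 hw
    rw [Complex.dist_eq, ← mul_sub, norm_mul, Circle.norm_coe, one_mul, ← Complex.dist_eq]
    exact hd _ hz' _ hw'
  · intro z hz w hw h
    obtain ⟨z', hz', rfl⟩ := Finset.mem_image.1 hz
    obtain ⟨w', hw', rfl⟩ := Finset.mem_image.1 hw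
    rw [hc z' hz' w' hw' h]

theorem image_iso_hull {E F : Type*} [NormedAddCommGroup E] [InnerProductSpace ℝ E] [FiniteDimensional ℝ E]
    [MeasurableSpace E] [BorelSpace E] [NormedAddCommGroup F] [InnerProductSpace ℝ F] [FiniteDimensional ℝ F]
    [MeasurableSpace F] [BorelSpace F] [DecidableEq F] (e : E ≃ₗᵢ[ℝ] F) (P : Finset E) :
    volume (convexHull ℝ ((P.image e : Finset F) : Set F)) = volume (convexHull ℝ (P : Set E)) := by
  have h : ((P.image e : Finset F) : Set F) = e.toLinearEquiv.toLinearMap '' (P : Set E) := by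
    ext z; simp
  rw [h, ← LinearMap.image_convexHull]
  have h2 : e.toLinearEquiv.toLinearMap '' (convexHull ℝ (P : Set E)) = e '' (convexHull ℝ (P : Set E)) := rfl
  rw [h2, LinearIsometryEquiv.image_eq_preimage_symm]
  exact e.symm.measurePreserving.measure_preimage (P.finite_toSet.isClosed_convexHull ℝ).measurableSet.nullMeasurableSet

noncomputable def eC : EuclideanSpace ℝ (Fin 2) ≃ₗᵢ[ℝ] ℂ := Complex.orthonormalBasisOneI.repr.symm

theorem plane_bound (P : Finset (EuclideanSpace ℝ (Fin 2))) (hcard : P.card ≤ 8) (hd : ∀ z ∈ P, ∀ w ∈ P, dist z w ≤ 1) :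
    (volume (convexHull ℝ (P : Set (EuclideanSpace ℝ (Fin 2))))).toReal ≤ 0.72686849 := by
  classical
  rw [← image_iso_hull eC P]
  apply complex_bound'
  · exact Finset.card_image_le.trans hcard
  · intro z hz w hw
    obtain ⟨z', hz', rfl⟩ := Finset.mem_image.1 hz
    obtain ⟨w', hw', rfl⟩ := Finset.mem_image.1 hw
    rw [eC.dist_map]
    exact hd _ hz' _ hw'

theorem plane_lower : ∃ P : Finset (EuclideanSpace ℝ (Fin 2)), P.card ≤ 8 ∧ (∀ z ∈ P, ∀ w ∈ P, dist z w ≤ 1) ∧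
    0.72686845 ≤ (volume (convexHull ℝ (P : Set (EuclideanSpace ℝ (Fin 2))))).toReal := by
  classical
  refine ⟨(Finset.univ.image qv).image eC.symm, ?_, ?_, ?_⟩
  · exact Finset.card_image_le.trans (Finset.card_image_le.trans (by simp))
  · intro z hz w hw
    obtain ⟨z', hz', rfl⟩ := Finset.mem_image.1 hz
    obtain ⟨w', hw', rfl⟩ := Finset.mem_image.1 hw
    obtain ⟨i, _, rfl⟩ := Finset.mem_image.1 hz'
    obtain ⟨j, _, rfl⟩ := Finset.mem_image.1 hw'
    rw [eC.symm.dist_map]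
    exact qv_dist i j
  · rw [image_iso_hull eC.symm]
    apply (ENNReal.ofReal_le_iff_le_toReal _).1
    · apply lower_area (convex_convexHull ℝ _)
      intro i
      apply subset_convexHull
      simp
    · exact ((Finset.finite_toSet _).isCompact_convexHull ℝ).measure_lt_top.ne

end Oct

/-- The maximal area of a small octagon satisfies `0.72686845 ≤ A*₈ ≤ 0.72686849`. -/
theorem maxArea_octagon_bounds :
    0.72686845 ≤ maxArea 8 ∧ maxArea 8 ≤ 0.72686849 := by
  obtain ⟨P, h1, h2, h3⟩ := Oct.plane_lower
  have hup : ∀ a ∈ {a : ℝ | ∃ P : Finset (EuclideanSpace ℝ (Fin 2)),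
    P.card ≤ 8 ∧ (∀ p ∈ P, ∀ q ∈ P, dist p q ≤ 1) ∧
    a = (volume (convexHull ℝ (P : Set (EuclideanSpace ℝ (Fin 2))))).toReal}, a ≤ 0.72686849 := by
    rintro a ⟨Q, k1, k2, rfl⟩
    exact Oct.plane_bound Q k1 k2
  constructor
  · exact h3.trans (le_csSup ⟨_, hup⟩ ⟨P, h1, h2, rfl⟩)
  · exact csSup_le ⟨_, P, h1, h2, rfl⟩ hup
end

section
/- There exist 12 points in ℝ² whose pairwise Euclidean distances are all at most 1 and whose convex hull has 2-dimensional Lebesgue measure at least 0.7607298. Equivalently, A*_12 ≥ 0.7607298. -/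
open MeasureTheory

/-- Scaled coordinates along the symmetry axis. -/
def dodU : Fin 12 → ℤ :=
  ![0, 972232496, 3123339057, 5842743550, 8339114348, 9843613026, 9999999998,
    972232496, 3123339057, 5842743550, 8339114348, 9843613026]

/-- Scaled coordinates orthogonal to the symmetry axis. -/
def dodV : Fin 12 → ℤ :=
  ![0, 2853427812, 4623140817, 4999999999, 3908898100, 1761613624, 0,
    -2853427812, -4623140817, -4999999999, -3908898100, -1761613624]

lemma dod_dist : ∀ i j, (dodU i - dodU j) ^ 2 + (dodV i - dodV j) ^ 2 ≤ (10000000000 : ℤ) ^ 2 := by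
  intro i j; fin_cases i <;> fin_cases j <;> decide

lemma dod_inj : ∀ i j, dodU i = dodU j → dodV i = dodV j → i = j := by
  intro i j; fin_cases i <;> fin_cases j <;> decide

/-- The vertices of the dodecagon. -/
noncomputable def dodPt (i : Fin 12) : EuclideanSpace ℝ (Fin 2) :=
  !₂[(dodU i : ℝ) / 10000000000, (dodV i : ℝ) / 10000000000]

lemma dodPt_injective : Function.Injective dodPt := by
  intro i j h
  have h0 := congrArg (fun p : EuclideanSpace ℝ (Fin 2) => p 0) h
  have h1 := congrArg (fun p : EuclideanSpace ℝ (Fin 2) => p 1) h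
  simp [dodPt] at h0 h1
  exact dod_inj i j h0 h1

lemma dodPt_dist (i j : Fin 12) : dist (dodPt i) (dodPt j) ≤ 1 := by
  rw [EuclideanSpace.dist_eq, Real.sqrt_le_one]
  have h : ((dodU i : ℝ) - dodU j) ^ 2 + ((dodV i : ℝ) - dodV j) ^ 2 ≤ (10000000000 : ℝ) ^ 2 := by
    exact_mod_cast dod_dist i j
  simp only [Fin.sum_univ_two, Real.dist_eq, sq_abs, dodPt]
  simp only [Matrix.cons_val_zero, Matrix.cons_val_one]
  nlinarith

/-- A symmetric trapezoid between two parallel chords of a convex set. -/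
lemma strip_le (C : Set (ℝ × ℝ)) (hC : Convex ℝ C) (a b p q : ℝ) (hab : a < b)
    (hp : 0 ≤ p) (hq : 0 ≤ q)
    (h1 : (a, p) ∈ C) (h2 : (a, -p) ∈ C) (h3 : (b, q) ∈ C) (h4 : (b, -q) ∈ C) :
    ENNReal.ofReal ((b - a) * (p + q)) ≤ volume (C ∩ Prod.fst ⁻¹' Set.Ioc a b) := by
  let g : ℝ → ℝ := fun t => ((b - t) * p + (t - a) * q) / (b - a)
  have hba : 0 < b - a := by linarith
  have hgc : Continuous g := by fun_prop
  have hg0 : ∀ t ∈ Set.Ioc a b, 0 ≤ g t := by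
    intro t ht
    have : 0 ≤ b - t := by linarith [ht.2]
    have : 0 ≤ t - a := by linarith [ht.1]
    positivity
  have hsub : regionBetween (fun t => - g t) g (Set.Ioc a b) ⊆ C ∩ Prod.fst ⁻¹' Set.Ioc a b := by
    rintro ⟨t, y⟩ ⟨ht, hy⟩
    refine ⟨?_, ht⟩
    simp only [Set.mem_Ioo] at hy ht
    have e1 : 0 ≤ (b - t) / (b - a) := div_nonneg (by linarith [ht.2]) hba.le
    have e2 : 0 ≤ (t - a) / (b - a) := div_nonneg (by linarith [ht.1]) hba.le
    have e3 : (b - t) / (b - a) + (t - a) / (b - a) = 1 := by field_simp; ring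
    have k1 : (t, g t) ∈ C := by
      have := hC h1 h3 e1 e2 e3
      convert this using 1
      ext
      · simp; field_simp; ring
      · simp [g]; field_simp
    have k2 : (t, - g t) ∈ C := by
      have := hC h2 h4 e1 e2 e3
      convert this using 1
      ext
      · simp; field_simp; ring
      · simp [g]; field_simp; ring
    have hgp : 0 < g t := by linarith [hy.1, hy.2]
    have := hC k1 k2 (a := (g t + y) / (2 * g t)) (b := (g t - y) / (2 * g t))
      (div_nonneg (by linarith [hy.1]) (by linarith)) (div_nonneg (by linarith [hy.2]) (by linarith))
      (by field_simp; ring)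
    convert this using 1
    ext
    · simp; field_simp; ring
    · simp; field_simp; ring
  refine le_trans (le_of_eq ?_) (measure_mono hsub)
  have hintg : ∀ f : ℝ → ℝ, Continuous f → IntegrableOn f (Set.Ioc a b) := fun f hf =>
    (hf.integrableOn_Icc).mono_set Set.Ioc_subset_Icc_self
  rw [Measure.volume_eq_prod, volume_regionBetween_eq_integral (f := fun t => - g t) (hintg _ hgc.neg) (hintg _ hgc) measurableSet_Ioc
    (fun t ht => by linarith [hg0 t ht])]
  congr 1
  rw [← intervalIntegral.integral_of_le hab.le]
  have hd : ∀ t ∈ Set.uIcc a b, HasDerivAt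
      (fun t => (- (b - t) ^ 2 * p + (t - a) ^ 2 * q) / (b - a)) ((g - fun t => - g t) t) t := by
    intro t _
    have h1 : HasDerivAt (fun t : ℝ => b - t) (-1) t := by simpa using (hasDerivAt_id t).const_sub b
    have h2 : HasDerivAt (fun t : ℝ => t - a) 1 t := by simpa using (hasDerivAt_id t).sub_const a
    have h := ((((h1.pow 2).neg).mul_const p).add ((h2.pow 2).mul_const q)).div_const (b - a)
    refine h.congr_deriv ?_
    simp [g]; field_simp; ring
  rw [intervalIntegral.integral_eq_sub_of_hasDerivAt hd
    ((hgc.sub hgc.neg).intervalIntegrable _ _)]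
  field_simp
  ring

lemma strip_add (C : Set (ℝ × ℝ)) (a b : ℝ) (hab : a ≤ b) (A : ℝ) (B : ℝ) (hA : 0 ≤ A) (hB : 0 ≤ B)
    (h1 : ENNReal.ofReal A ≤ volume (C ∩ Prod.fst ⁻¹' Set.Iic a))
    (h2 : ENNReal.ofReal B ≤ volume (C ∩ Prod.fst ⁻¹' Set.Ioc a b)) :
    ENNReal.ofReal (A + B) ≤ volume (C ∩ Prod.fst ⁻¹' Set.Iic b) := by
  rw [ENNReal.ofReal_add hA hB,
    ← measure_inter_add_sdiff (C ∩ Prod.fst ⁻¹' Set.Iic b) (measurable_fst (measurableSet_Iic (a := a)))]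
  refine add_le_add (h1.trans (measure_mono ?_)) (h2.trans (measure_mono ?_))
  · rintro ⟨x, y⟩ ⟨h, h'⟩
    exact ⟨⟨h, le_trans h' hab⟩, h'⟩
  · rintro ⟨x, y⟩ ⟨h, h'⟩
    exact ⟨⟨h, h'.2⟩, not_le.mpr h'.1⟩

/-- The vertex set. -/
noncomputable def dodSet : Finset (EuclideanSpace ℝ (Fin 2)) :=
  Finset.univ.map ⟨dodPt, dodPt_injective⟩

/-- Coordinates as a measurable equivalence with the product plane. -/
noncomputable def toPair : EuclideanSpace ℝ (Fin 2) ≃ᵐ ℝ × ℝ :=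
  (MeasurableEquiv.toLp 2 (Fin 2 → ℝ)).symm.trans MeasurableEquiv.finTwoArrow

lemma toPair_mp : MeasurePreserving toPair volume volume :=
  (volume_preserving_finTwoArrow ℝ).comp
    (EuclideanSpace.volume_preserving_symm_measurableEquiv_toLp (Fin 2))

lemma toPair_symm_apply (z : ℝ × ℝ) : toPair.symm z = !₂[z.1, z.2] := by
  rfl

lemma bounded_volume (P : Finset (EuclideanSpace ℝ (Fin 2)))
    (hP : ∀ p ∈ P, ∀ q ∈ P, dist p q ≤ 1) :
    volume (convexHull ℝ (P : Set (EuclideanSpace ℝ (Fin 2)))) ≤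
      volume (Metric.closedBall (0 : EuclideanSpace ℝ (Fin 2)) 1) := by
  rcases P.eq_empty_or_nonempty with rfl | ⟨q, hq⟩
  · simp
  · rw [← Measure.addHaar_closedBall_center volume q 1]
    exact measure_mono (convexHull_min (fun p hp => hP p hp q hq) (convex_closedBall q 1))

lemma ball_ne_top : volume (Metric.closedBall (0 : EuclideanSpace ℝ (Fin 2)) 1) ≠ ⊤ :=
  measure_closedBall_lt_top.ne

lemma dodSet_dist : ∀ p ∈ dodSet, ∀ q ∈ dodSet, dist p q ≤ 1 := by
  intro p hp q hq
  simp only [dodSet, Finset.mem_map, Finset.mem_univ, true_and, Function.Embedding.coeFn_mk] at hp hq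
  obtain ⟨i, rfl⟩ := hp
  obtain ⟨j, rfl⟩ := hq
  exact dodPt_dist i j

lemma dodSet_area :
    0.7607298 ≤ (volume (convexHull ℝ (dodSet : Set (EuclideanSpace ℝ (Fin 2))))).toReal := by
  set H := convexHull ℝ (dodSet : Set (EuclideanSpace ℝ (Fin 2))) with hH
  have hfin : volume H ≠ ⊤ :=
    ((bounded_volume dodSet dodSet_dist).trans_lt (lt_top_iff_ne_top.mpr ball_ne_top)).ne
  let C : Set (ℝ × ℝ) := toPair.symm ⁻¹' H
  have hvol : volume C = volume H :=
    (toPair_mp.symm toPair).measure_preimage_equiv H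
  have hconv : Convex ℝ C := by
    intro x hx y hy s t hs ht hst
    have := (convex_convexHull ℝ (dodSet : Set (EuclideanSpace ℝ (Fin 2)))) hx hy hs ht hst
    change toPair.symm _ ∈ H
    convert this using 1
    simp only [toPair_symm_apply]
    ext i
    fin_cases i <;> simp
  have hmem : ∀ i, ((dodU i : ℝ) / 10000000000, (dodV i : ℝ) / 10000000000) ∈ C := by
    intro i
    apply subset_convexHull ℝ _
    simp only [dodSet, Finset.coe_map, Finset.coe_univ, Set.image_univ, Set.mem_range, toPair_symm_apply]
    exact ⟨i, rfl⟩
  have key : ∀ i j k l : Fin 12, dodU k = dodU i → dodV k = - dodV i → dodU l = dodU j →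
      dodV l = - dodV j → dodU i < dodU j → 0 ≤ dodV i → 0 ≤ dodV j → ∀ A : ℝ, 0 ≤ A →
      ENNReal.ofReal A ≤ volume (C ∩ Prod.fst ⁻¹' Set.Iic ((dodU i : ℝ) / 10000000000)) →
      ENNReal.ofReal (A + ((dodU j : ℝ) / 10000000000 - (dodU i : ℝ) / 10000000000) *
        ((dodV i : ℝ) / 10000000000 + (dodV j : ℝ) / 10000000000)) ≤
        volume (C ∩ Prod.fst ⁻¹' Set.Iic ((dodU j : ℝ) / 10000000000)) := by
    intro i j k l hk hk' hl hl' hij hi hj A hA h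
    have hij' : (dodU i : ℝ) / 10000000000 < (dodU j : ℝ) / 10000000000 := by
      have : (dodU i : ℝ) < dodU j := by exact_mod_cast hij
      linarith
    have hi' : 0 ≤ (dodV i : ℝ) / 10000000000 := by
      have : (0 : ℝ) ≤ dodV i := by exact_mod_cast hi
      positivity
    have hj' : 0 ≤ (dodV j : ℝ) / 10000000000 := by
      have : (0 : ℝ) ≤ dodV j := by exact_mod_cast hj
      positivity
    have mk := hmem k
    have ml := hmem l
    rw [hk, hk'] at mk
    rw [hl, hl'] at ml
    push_cast at mk ml
    rw [neg_div] at mk ml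
    exact strip_add C _ _ hij'.le _ _ hA
      (mul_nonneg (by linarith) (by linarith)) h
      (strip_le C hconv _ _ _ _ hij' hi' hj' (hmem i) mk (hmem j) ml)
  have u0 : dodU 0 = 0 := rfl
  have v0 : dodV 0 = 0 := rfl
  have u1 : dodU 1 = 972232496 := rfl
  have v1 : dodV 1 = 2853427812 := rfl
  have u2 : dodU 2 = 3123339057 := rfl
  have v2 : dodV 2 = 4623140817 := rfl
  have u3 : dodU 3 = 5842743550 := rfl
  have v3 : dodV 3 = 4999999999 := rfl
  have u4 : dodU 4 = 8339114348 := rfl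
  have v4 : dodV 4 = 3908898100 := rfl
  have u5 : dodU 5 = 9843613026 := rfl
  have v5 : dodV 5 = 1761613624 := rfl
  have u6 : dodU 6 = 9999999998 := rfl
  have v6 : dodV 6 = 0 := rfl
  have s0 : ENNReal.ofReal 0 ≤ volume (C ∩ Prod.fst ⁻¹' Set.Iic ((dodU 0 : ℝ) / 10000000000)) := by
    simp
  have s1 := key 0 1 0 7 (by decide) (by decide) (by decide) (by decide) (by decide) (by decide)
    (by decide) _ le_rfl s0
  have s2 := key 1 2 7 8 (by decide) (by decide) (by decide) (by decide) (by decide) (by decide)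
    (by decide) _ (by norm_num [u0, u1, u2, u3, u4, u5, u6, v0, v1, v2, v3, v4, v5, v6]) s1
  have s3 := key 2 3 8 9 (by decide) (by decide) (by decide) (by decide) (by decide) (by decide)
    (by decide) _ (by norm_num [u0, u1, u2, u3, u4, u5, u6, v0, v1, v2, v3, v4, v5, v6]) s2
  have s4 := key 3 4 9 10 (by decide) (by decide) (by decide) (by decide) (by decide) (by decide)
    (by decide) _ (by norm_num [u0, u1, u2, u3, u4, u5, u6, v0, v1, v2, v3, v4, v5, v6]) s3
  have s5 := key 4 5 10 11 (by decide) (by decide) (by decide) (by decide) (by decide) (by decide)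
    (by decide) _ (by norm_num [u0, u1, u2, u3, u4, u5, u6, v0, v1, v2, v3, v4, v5, v6]) s4
  have s6 := key 5 6 11 6 (by decide) (by decide) (by decide) (by decide) (by decide) (by decide)
    (by decide) _ (by norm_num [u0, u1, u2, u3, u4, u5, u6, v0, v1, v2, v3, v4, v5, v6]) s5
  have s7 := s6.trans (measure_mono Set.inter_subset_left)
  rw [hvol, ENNReal.ofReal_le_iff_le_toReal hfin] at s7
  refine le_trans ?_ s7
  norm_num [u0, u1, u2, u3, u4, u5, u6, v0, v1, v2, v3, v4, v5, v6]

/-- There exist 12 points in the plane with pairwise Euclidean distances at most `1`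
whose convex hull has 2-dimensional Lebesgue measure at least `0.7607298`; equivalently,
`A*_12 ≥ 0.7607298`. -/
theorem maxArea_dodecagon_lower_bound :
    (∃ P : Finset (EuclideanSpace ℝ (Fin 2)),
      P.card = 12 ∧ (∀ p ∈ P, ∀ q ∈ P, dist p q ≤ 1) ∧
      0.7607298 ≤ (volume (convexHull ℝ (P : Set (EuclideanSpace ℝ (Fin 2))))).toReal) ∧
    0.7607298 ≤ maxArea 12 := by
  have hcard : dodSet.card = 12 := by simp [dodSet]
  refine ⟨⟨dodSet, hcard, dodSet_dist, dodSet_area⟩, ?_⟩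
  refine dodSet_area.trans (le_csSup ?_ ⟨dodSet, hcard.le, dodSet_dist, rfl⟩)
  refine ⟨(volume (Metric.closedBall (0 : EuclideanSpace ℝ (Fin 2)) 1)).toReal, ?_⟩
  rintro _ ⟨P, _, hP, rfl⟩
  exact ENNReal.toReal_mono ball_ne_top (bounded_volume P hP)
end
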